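/- Under hypotheses (H1)–(H3), if u₀ ∈ L¹(ℝ^d) is a probability density (u₀ ≥ 0 a.e. and ∫_{ℝ^d} u₀ dx = 1), then there exists a distributional solution u : [0,∞) → L¹(ℝ^d) of the nonlinear Fokker–Planck equation ∂_t u = Σ_{i,j=1}^d ∂_i∂_j(a_ij(x,u)u) − div(b(x,u)u), continuous in the L¹-norm with u(0) = u₀, such that for every t ≥ 0 the function u(t,·) is a probability density (u(t,·) ≥ 0 a.e. and ∫_{ℝ^d} u(t,x) dx = 1), and for every bounded continuous φ : ℝ^d → ℝ the map t ↦ ∫_{ℝ^d} φ(x) u(t,x) dx is continuous on [0,∞); in particular, the probability measures μ_t(dx) = u(t,x)dx are weakly continuous in t. -/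

import Mathlib

open MeasureTheory Filter

/-- The `i`-th partial derivative of `φ : ℝ^d → ℝ`. -/
noncomputable def pd {d : ℕ} (i : Fin d) (φ : (Fin d → ℝ) → ℝ) (x : Fin d → ℝ) : ℝ :=
  fderiv ℝ φ x (Pi.single i 1)

/-- The second partial derivative `∂_i ∂_j φ`. -/
noncomputable def pd2 {d : ℕ} (i j : Fin d) (φ : (Fin d → ℝ) → ℝ) (x : Fin d → ℝ) : ℝ :=
  pd i (pd j φ) x

/-- Time derivative `∂_t φ` for `φ : ℝ × ℝ^d → ℝ`. -/
noncomputable def pdt {d : ℕ} (φ : ℝ × (Fin d → ℝ) → ℝ) (p : ℝ × (Fin d → ℝ)) : ℝ :=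
  fderiv ℝ φ p ((1 : ℝ), (0 : Fin d → ℝ))

/-- Spatial partial derivative `∂_{x_i} φ` for `φ : ℝ × ℝ^d → ℝ`. -/
noncomputable def pdx {d : ℕ} (i : Fin d) (φ : ℝ × (Fin d → ℝ) → ℝ) (p : ℝ × (Fin d → ℝ)) : ℝ :=
  fderiv ℝ φ p ((0 : ℝ), (Pi.single i 1 : Fin d → ℝ))

/-- Second spatial partial derivative `∂_{x_i}∂_{x_j} φ`. -/
noncomputable def pdxx {d : ℕ} (i j : Fin d) (φ : ℝ × (Fin d → ℝ) → ℝ)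
    (p : ℝ × (Fin d → ℝ)) : ℝ :=
  pdx i (pdx j φ) p

/-- Distributional solution of the nonlinear Fokker–Planck equation
`∂_t u = Σ_{i,j} ∂_i∂_j(a_ij(x,u)u) - div(b(x,u)u)` on `(0,∞) × ℝ^d`. -/
def IsFPESol {d : ℕ} (a : Fin d → Fin d → (Fin d → ℝ) → ℝ → ℝ)
    (b : Fin d → (Fin d → ℝ) → ℝ → ℝ) (u : ℝ → (Fin d → ℝ) → ℝ) : Prop :=
  ∀ φ : ℝ × (Fin d → ℝ) → ℝ, ContDiff ℝ (⊤ : ℕ∞) φ → HasCompactSupport φ →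
    tsupport φ ⊆ {p : ℝ × (Fin d → ℝ) | 0 < p.1} →
    (∫ t in Set.Ioi (0 : ℝ), ∫ x, (u t x * pdt φ (t, x)
      + ∑ i, ∑ j, a i j x (u t x) * u t x * pdxx i j φ (t, x)
      + u t x * ∑ i, b i x (u t x) * pdx i φ (t, x))) = 0



theorem MeasureTheory.Integrable.fsub {α : Type*} [MeasurableSpace α] {μ : Measure α}
    {f g : α → ℝ} (hf : Integrable f μ) (hg : Integrable g μ) :
    Integrable (fun x => f x - g x) μ := hf.sub hg

/-! ## Part 1: abstract jump generators -/

/-- A finite family of jumps `w s` with rates `F s x r`. -/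
structure JumpData (d : ℕ) (S : Type) [Fintype S] where
  w : S → (Fin d → ℝ)
  F : S → (Fin d → ℝ) → ℝ → ℝ
  K : ℝ
  K_nonneg : 0 ≤ K
  cont : ∀ s, Continuous (fun p : (Fin d → ℝ) × ℝ => F s p.1 p.2)
  zero : ∀ s x, F s x 0 = 0
  mono : ∀ s x, Monotone (F s x)
  lip : ∀ s x r r', |F s x r - F s x r'| ≤ K * |r - r'|

namespace JumpData

variable {d : ℕ} {S : Type} [Fintype S] (J : JumpData d S)

/-- The generator. -/
noncomputable def gen (u : (Fin d → ℝ) → ℝ) (x : Fin d → ℝ) : ℝ :=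
  ∑ s, (J.F s (x - J.w s) (u (x - J.w s)) - J.F s x (u x))

/-- One explicit Euler step. -/
noncomputable def step (h : ℝ) (u : (Fin d → ℝ) → ℝ) (x : Fin d → ℝ) : ℝ :=
  u x + h * J.gen u x

theorem abs_F_le (s : S) (x : Fin d → ℝ) (r : ℝ) : |J.F s x r| ≤ J.K * |r| := by
  have := J.lip s x r 0
  simpa [J.zero] using this

theorem integrable_F (s : S) {u : (Fin d → ℝ) → ℝ} (hu : Integrable u) :
    Integrable (fun x => J.F s x (u x)) := by
  refine Integrable.mono' (hu.abs.const_mul J.K) ?_ ?_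
  · have := (J.cont s).comp_aestronglyMeasurable
      (f := fun x => (x, u x)) (aestronglyMeasurable_id.prodMk hu.aestronglyMeasurable)
    exact this
  · exact Eventually.of_forall fun x => J.abs_F_le s x (u x)

theorem integrable_gen {u : (Fin d → ℝ) → ℝ} (hu : Integrable u) : Integrable (J.gen u) := by
  unfold gen
  refine integrable_finsetSum _ fun s _ => ?_
  exact ((J.integrable_F s hu).comp_sub_right (J.w s)).fsub (J.integrable_F s hu)

theorem integrable_step (h : ℝ) {u : (Fin d → ℝ) → ℝ} (hu : Integrable u) :
    Integrable (J.step h u) :=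
  hu.add ((J.integrable_gen hu).const_mul h)

theorem integral_mul_gen {u φ : (Fin d → ℝ) → ℝ} (hu : Integrable u)
    (hφm : AEStronglyMeasurable φ) {M : ℝ} (hφ : ∀ x, |φ x| ≤ M) :
    ∫ x, φ x * J.gen u x = ∫ x, ∑ s, J.F s x (u x) * (φ (x + J.w s) - φ x) := by
  have hbm : ∀ {g : (Fin d → ℝ) → ℝ}, Integrable g → Integrable (fun x => φ x * g x) := by
    intro g hg
    exact hg.bdd_mul hφm (Eventually.of_forall hφ)
  have hI1 : ∀ s, Integrable (fun x => φ x * J.F s (x - J.w s) (u (x - J.w s))) := fun s =>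
    hbm ((J.integrable_F s hu).comp_sub_right (J.w s))
  have hI2 : ∀ s, Integrable (fun x => φ x * J.F s x (u x)) := fun s => hbm (J.integrable_F s hu)
  have hI3 : ∀ s, Integrable (fun x => J.F s x (u x) * φ (x + J.w s)) := fun s => by
    have := (hI1 s).comp_add_right (J.w s)
    refine this.congr (Eventually.of_forall fun x => ?_)
    simp [mul_comm]
  have e1 : ∀ s, ∫ x, φ x * J.F s (x - J.w s) (u (x - J.w s))
      = ∫ x, J.F s x (u x) * φ (x + J.w s) := fun s => by
    rw [← integral_add_right_eq_self (fun x => φ x * J.F s (x - J.w s) (u (x - J.w s))) (J.w s)]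
    simp [mul_comm]
  have : ∀ x, φ x * J.gen u x
      = ∑ s, (φ x * J.F s (x - J.w s) (u (x - J.w s)) - φ x * J.F s x (u x)) := by
    intro x; simp [gen, Finset.mul_sum, mul_sub]
  simp_rw [this]
  rw [integral_finsetSum _ fun s _ => (hI1 s).fsub (hI2 s)]
  rw [integral_finsetSum]
  · refine Finset.sum_congr rfl fun s _ => ?_
    rw [integral_sub (hI1 s) (hI2 s), e1]
    simp_rw [mul_sub]
    rw [integral_sub (hI3 s)]
    · simp_rw [mul_comm (φ _)]
    · simpa [mul_comm] using hI2 s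
  · intro s _
    simp_rw [mul_sub]
    refine (hI3 s).sub ?_
    simpa [mul_comm] using hI2 s

theorem integral_gen {u : (Fin d → ℝ) → ℝ} (hu : Integrable u) : ∫ x, J.gen u x = 0 := by
  have := J.integral_mul_gen (φ := fun _ => 1) hu aestronglyMeasurable_const (M := 1) (by simp)
  simpa using this

theorem integral_step (h : ℝ) {u : (Fin d → ℝ) → ℝ} (hu : Integrable u) :
    ∫ x, J.step h u x = ∫ x, u x := by
  unfold step
  rw [integral_add hu ((J.integrable_gen hu).const_mul h), integral_const_mul, J.integral_gen hu]
  simp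

theorem step_mono {h : ℝ} (hh : 0 ≤ h) (hK : h * (Fintype.card S * J.K) ≤ 1)
    {u v : (Fin d → ℝ) → ℝ} (huv : ∀ x, u x ≤ v x) (x : Fin d → ℝ) :
    J.step h u x ≤ J.step h v x := by
  unfold step gen
  rw [Finset.sum_sub_distrib, Finset.sum_sub_distrib]
  have h1 : ∑ s, J.F s (x - J.w s) (u (x - J.w s)) ≤ ∑ s, J.F s (x - J.w s) (v (x - J.w s)) :=
    Finset.sum_le_sum fun s _ => J.mono s _ (huv _)
  have h2 : ∑ s, J.F s x (v x) - ∑ s, J.F s x (u x) ≤ (Fintype.card S * J.K) * (v x - u x) := by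
    rw [← Finset.sum_sub_distrib]
    have : ∀ s ∈ Finset.univ, J.F s x (v x) - J.F s x (u x) ≤ J.K * (v x - u x) := by
      intro s _
      have := J.lip s x (v x) (u x)
      rw [abs_of_nonneg (sub_nonneg.2 (huv x))] at this
      exact (le_abs_self _).trans this
    refine (Finset.sum_le_card_nsmul _ _ _ this).trans (le_of_eq ?_)
    simp [mul_assoc]
  have h3 : h * ((Fintype.card S * J.K) * (v x - u x)) ≤ 1 * (v x - u x) := by
    rw [← mul_assoc]
    exact mul_le_mul_of_nonneg_right hK (sub_nonneg.2 (huv x))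
  have h4 := mul_le_mul_of_nonneg_left h1 hh
  have h5 := mul_le_mul_of_nonneg_left h2 hh
  nlinarith

theorem step_zero (h : ℝ) : J.step h (fun _ => 0) = fun _ => 0 := by
  funext x; simp [step, gen, J.zero]

theorem step_contr {h : ℝ} (hh : 0 ≤ h) (hK : h * (Fintype.card S * J.K) ≤ 1)
    {u v : (Fin d → ℝ) → ℝ} (hu : Integrable u) (hv : Integrable v) :
    ∫ x, |J.step h u x - J.step h v x| ≤ ∫ x, |u x - v x| := by
  set m : (Fin d → ℝ) → ℝ := fun x => max (u x) (v x) with hm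
  have hmi : Integrable m := hu.sup hv
  have e : ∀ x, |u x - v x| = 2 * m x - u x - v x := by
    intro x
    simp only [hm]
    rcases le_total (u x) (v x) with h | h
    · rw [max_eq_right h, abs_of_nonpos (by linarith)]; ring
    · rw [max_eq_left h, abs_of_nonneg (by linarith)]; ring
  have key : ∀ x, |J.step h u x - J.step h v x|
      ≤ 2 * J.step h m x - J.step h u x - J.step h v x := by
    intro x
    have h1 := J.step_mono hh hK (u := u) (v := m) (fun x => le_max_left _ _) x
    have h2 := J.step_mono hh hK (u := v) (v := m) (fun x => le_max_right _ _) x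
    rw [abs_le]; constructor <;> linarith
  have iu := J.integrable_step h hu
  have iv := J.integrable_step h hv
  have im := J.integrable_step h hmi
  calc ∫ x, |J.step h u x - J.step h v x|
      ≤ ∫ x, (2 * J.step h m x - J.step h u x - J.step h v x) :=
        integral_mono (iu.fsub iv).abs (((im.const_mul 2).fsub iu).fsub iv) key
    _ = 2 * (∫ x, m x) - (∫ x, u x) - ∫ x, v x := by
        rw [integral_sub ((im.const_mul 2).fsub iu) iv, integral_sub (im.const_mul 2) iu,
          integral_const_mul, J.integral_step h hmi, J.integral_step h hu, J.integral_step h hv]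
    _ = ∫ x, |u x - v x| := by
        simp_rw [e]
        rw [integral_sub ((hmi.const_mul 2).fsub hu) hv, integral_sub (hmi.const_mul 2) hu,
          integral_const_mul]

/-- Iterates of the Euler step. -/
noncomputable def iter (h : ℝ) (k : ℕ) (u : (Fin d → ℝ) → ℝ) : (Fin d → ℝ) → ℝ :=
  (J.step h)^[k] u

theorem iter_zero (h : ℝ) (u : (Fin d → ℝ) → ℝ) : J.iter h 0 u = u := rfl

theorem iter_succ (h : ℝ) (k : ℕ) (u : (Fin d → ℝ) → ℝ) :
    J.iter h (k + 1) u = J.step h (J.iter h k u) := by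
  simp [iter, Function.iterate_succ_apply']

theorem iter_add (h : ℝ) (k l : ℕ) (u : (Fin d → ℝ) → ℝ) :
    J.iter h (k + l) u = J.iter h k (J.iter h l u) := by
  simp [iter, Function.iterate_add_apply]

theorem integrable_iter (h : ℝ) (k : ℕ) {u : (Fin d → ℝ) → ℝ} (hu : Integrable u) :
    Integrable (J.iter h k u) := by
  induction k with
  | zero => exact hu
  | succ k ih => rw [iter_succ]; exact J.integrable_step h ih

theorem integral_iter (h : ℝ) (k : ℕ) {u : (Fin d → ℝ) → ℝ} (hu : Integrable u) :
    ∫ x, J.iter h k u x = ∫ x, u x := by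
  induction k with
  | zero => rfl
  | succ k ih => rw [iter_succ, J.integral_step h (J.integrable_iter h k hu), ih]

theorem iter_contr {h : ℝ} (hh : 0 ≤ h) (hK : h * (Fintype.card S * J.K) ≤ 1) (k : ℕ)
    {u v : (Fin d → ℝ) → ℝ} (hu : Integrable u) (hv : Integrable v) :
    ∫ x, |J.iter h k u x - J.iter h k v x| ≤ ∫ x, |u x - v x| := by
  induction k with
  | zero => exact le_rfl
  | succ k ih =>
    rw [iter_succ, iter_succ]
    exact (J.step_contr hh hK (J.integrable_iter h k hu) (J.integrable_iter h k hv)).trans ih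

theorem iter_const_zero (h : ℝ) (k : ℕ) : J.iter h k (fun _ => 0) = fun _ => 0 := by
  induction k with
  | zero => rfl
  | succ k ih => rw [iter_succ, ih, step_zero]

theorem iter_nonneg {h : ℝ} (hh : 0 ≤ h) (hK : h * (Fintype.card S * J.K) ≤ 1) (k : ℕ)
    {u : (Fin d → ℝ) → ℝ} (hu : ∀ x, 0 ≤ u x) (x : Fin d → ℝ) : 0 ≤ J.iter h k u x := by
  induction k generalizing x with
  | zero => exact hu x
  | succ k ih =>
    rw [iter_succ]
    have := J.step_mono hh hK (u := fun _ => 0) (v := J.iter h k u) ih x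
    rwa [step_zero] at this

theorem iter_l1 {h : ℝ} (hh : 0 ≤ h) (hK : h * (Fintype.card S * J.K) ≤ 1) (k : ℕ)
    {u : (Fin d → ℝ) → ℝ} (hu : Integrable u) :
    ∫ x, |J.iter h k u x| ≤ ∫ x, |u x| := by
  have := J.iter_contr hh hK k hu (v := fun _ => 0) (integrable_zero _ _ _)
  simpa [iter_const_zero] using this

/-- translations of orbits -/
theorem iter_shift {h : ℝ} (hh : 0 ≤ h) (hK : h * (Fintype.card S * J.K) ≤ 1)
    {u : (Fin d → ℝ) → ℝ} (hu : Integrable u) (z : Fin d → ℝ) {δ : ℝ}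
    (hδ : ∀ x r, ∑ s, |J.F s (x + z) r - J.F s x r| ≤ δ * |r|) (hδ0 : 0 ≤ δ) (k : ℕ) :
    ∫ x, |J.iter h k u (x + z) - J.iter h k u x|
      ≤ (∫ x, |u (x + z) - u x|) + k * h * (2 * δ) * ∫ x, |u x| := by
  induction k with
  | zero => simp [iter_zero]
  | succ k ih =>
    set g := J.iter h k u with hg
    have ig : Integrable g := J.integrable_iter h k hu
    have igz : Integrable (fun x => g (x + z)) := ig.comp_add_right z
    have hpt : ∀ x, |J.step h g (x + z) - J.step h g x| ≤
        |J.step h (fun y => g (y + z)) x - J.step h g x| +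
        h * (∑ s, (|J.F s (x + z - J.w s) (g (x + z - J.w s)) - J.F s (x - J.w s) (g (x + z - J.w s))|
          + |J.F s (x + z) (g (x + z)) - J.F s x (g (x + z))|)) := by
      intro x
      have : J.step h g (x + z) - J.step h g x =
        (J.step h (fun y => g (y + z)) x - J.step h g x) + h * ∑ s, ((J.F s (x + z - J.w s) (g (x + z - J.w s)) - J.F s (x - J.w s) (g (x + z - J.w s))) - (J.F s (x + z) (g (x + z)) - J.F s x (g (x + z)))) := by
        have e : ∀ s, x - J.w s + z = x + z - J.w s := fun s => by abel
        simp only [step, gen, Finset.sum_sub_distrib, e]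
        ring
      rw [this]
      refine (abs_add_le _ _).trans (add_le_add le_rfl ?_)
      rw [abs_mul, abs_of_nonneg hh]
      refine mul_le_mul_of_nonneg_left ?_ hh
      refine (Finset.abs_sum_le_sum_abs _ _).trans (Finset.sum_le_sum fun s _ => ?_)
      exact abs_sub _ _
    have iF1 : ∀ s, Integrable (fun x => |J.F s (x + z) (g (x + z)) - J.F s x (g (x + z))|) := fun s =>
      (((J.integrable_F s ig).comp_add_right z).fsub (J.integrable_F s igz)).abs
    have iF2 : ∀ s, Integrable (fun x => |J.F s (x + z - J.w s) (g (x + z - J.w s)) - J.F s (x - J.w s) (g (x + z - J.w s))|) := fun s => by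
      have := (iF1 s).comp_sub_right (J.w s)
      refine this.congr (Eventually.of_forall fun x => ?_)
      have e : x - J.w s + z = x + z - J.w s := by abel
      simp only [e]
    have eF2 : ∀ s, ∫ x, |J.F s (x + z - J.w s) (g (x + z - J.w s)) - J.F s (x - J.w s) (g (x + z - J.w s))| = ∫ x, |J.F s (x + z) (g (x + z)) - J.F s x (g (x + z))| := fun s => by
      rw [← integral_sub_right_eq_self (fun x => |J.F s (x + z) (g (x + z)) - J.F s x (g (x + z))|) (J.w s)]
      congr 1; funext x
      have e : x - J.w s + z = x + z - J.w s := by abel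
      simp only [e]
    have iS : Integrable (fun x => ∑ s, (|J.F s (x + z - J.w s) (g (x + z - J.w s)) - J.F s (x - J.w s) (g (x + z - J.w s))|
          + |J.F s (x + z) (g (x + z)) - J.F s x (g (x + z))|)) :=
      integrable_finsetSum _ fun s _ => (iF2 s).fun_add (iF1 s)
    have eS : ∫ x, ∑ s, (|J.F s (x + z - J.w s) (g (x + z - J.w s)) - J.F s (x - J.w s) (g (x + z - J.w s))|
          + |J.F s (x + z) (g (x + z)) - J.F s x (g (x + z))|) ≤ 2 * δ * ∫ x, |u x| := by
      rw [integral_finsetSum _ fun s _ => (iF2 s).fun_add (iF1 s)]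
      have : ∀ s, ∫ x, (|J.F s (x + z - J.w s) (g (x + z - J.w s)) - J.F s (x - J.w s) (g (x + z - J.w s))|
          + |J.F s (x + z) (g (x + z)) - J.F s x (g (x + z))|) = 2 * ∫ x, |J.F s (x + z) (g (x + z)) - J.F s x (g (x + z))| := by
        intro s
        rw [integral_add (iF2 s) (iF1 s), eF2]; ring
      simp_rw [this]
      rw [← Finset.mul_sum, ← integral_finsetSum _ fun s _ => iF1 s, mul_assoc]
      refine mul_le_mul_of_nonneg_left ?_ (by norm_num)
      calc ∫ x, ∑ s, |J.F s (x + z) (g (x + z)) - J.F s x (g (x + z))|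
          ≤ ∫ x, δ * |g (x + z)| := by
            refine integral_mono (integrable_finsetSum _ fun s _ => iF1 s) (igz.abs.const_mul δ) ?_
            intro x; exact hδ x (g (x + z))
        _ = δ * ∫ x, |g x| := by
            rw [integral_const_mul, integral_add_right_eq_self (fun x => |g x|) z]
        _ ≤ δ * ∫ x, |u x| := mul_le_mul_of_nonneg_left (J.iter_l1 hh hK k hu) hδ0
    rw [iter_succ, ← hg]
    have i1 := J.integrable_step h igz
    have i2 := J.integrable_step h ig
    calc ∫ x, |J.step h g (x + z) - J.step h g x|
        ≤ ∫ x, (|J.step h (fun y => g (y + z)) x - J.step h g x| +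
        h * (∑ s, (|J.F s (x + z - J.w s) (g (x + z - J.w s)) - J.F s (x - J.w s) (g (x + z - J.w s))|
          + |J.F s (x + z) (g (x + z)) - J.F s x (g (x + z))|))) :=
          integral_mono ((i2.comp_add_right z).fsub i2).abs
            ((i1.fsub i2).abs.fun_add (iS.const_mul h)) hpt
      _ ≤ (∫ x, |g (x + z) - g x|) + h * (2 * δ * ∫ x, |u x|) := by
          rw [integral_add (i1.fsub i2).abs (iS.const_mul h), integral_const_mul]
          exact add_le_add (J.step_contr hh hK igz ig) (mul_le_mul_of_nonneg_left eS hh)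
      _ ≤ _ := by push_cast; nlinarith [ih]

/-- weak form along the orbit -/
theorem integral_mul_iter (h : ℝ) {u φ : (Fin d → ℝ) → ℝ} (hu : Integrable u)
    (hφm : AEStronglyMeasurable φ) {M : ℝ} (hφ : ∀ x, |φ x| ≤ M) (k : ℕ) :
    ∫ x, φ x * J.iter h k u x = (∫ x, φ x * u x)
      + ∑ l ∈ Finset.range k, h * ∫ x, φ x * J.gen (J.iter h l u) x := by
  have hbm : ∀ {g : (Fin d → ℝ) → ℝ}, Integrable g → Integrable (fun x => φ x * g x) := by
    intro g hg
    exact hg.bdd_mul hφm (Eventually.of_forall hφ)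
  induction k with
  | zero => simp [iter_zero]
  | succ k ih =>
    rw [Finset.sum_range_succ, ← add_assoc, ← ih, iter_succ]
    have ik := J.integrable_iter h k hu
    have : ∀ x, φ x * J.step h (J.iter h k u) x
        = φ x * J.iter h k u x + h * (φ x * J.gen (J.iter h k u) x) := by
      intro x; simp only [step]; ring
    simp_rw [this]
    rw [integral_add (hbm ik) ((hbm (J.integrable_gen ik)).const_mul h), integral_const_mul]

/-- boundedness is preserved -/
theorem gen_bdd {u : (Fin d → ℝ) → ℝ} {M : ℝ} (hM : ∀ x, |u x| ≤ M) (x : Fin d → ℝ) :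
    |J.gen u x| ≤ Fintype.card S * (J.K * M + J.K * M) := by
  unfold gen
  refine (Finset.abs_sum_le_sum_abs _ _).trans ?_
  have : ∀ s ∈ Finset.univ, |J.F s (x - J.w s) (u (x - J.w s)) - J.F s x (u x)|
      ≤ J.K * M + J.K * M := by
    intro s _
    refine (abs_sub _ _).trans (add_le_add ?_ ?_)
    · exact (J.abs_F_le s _ _).trans (mul_le_mul_of_nonneg_left (hM _) J.K_nonneg)
    · exact (J.abs_F_le s _ _).trans (mul_le_mul_of_nonneg_left (hM _) J.K_nonneg)
  refine (Finset.sum_le_card_nsmul _ _ _ this).trans (le_of_eq ?_)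
  simp [mul_add]

theorem step_bdd (h : ℝ) {u : (Fin d → ℝ) → ℝ} (hM : ∃ M, ∀ x, |u x| ≤ M) :
    ∃ M, ∀ x, |J.step h u x| ≤ M := by
  obtain ⟨M, hM⟩ := hM
  refine ⟨M + |h| * (Fintype.card S * (J.K * M + J.K * M)), fun x => ?_⟩
  refine (abs_add_le _ _).trans (add_le_add (hM x) ?_)
  rw [abs_mul]
  exact mul_le_mul_of_nonneg_left (J.gen_bdd hM x) (abs_nonneg _)

theorem iter_bdd (h : ℝ) (k : ℕ) {u : (Fin d → ℝ) → ℝ} (hM : ∃ M, ∀ x, |u x| ≤ M) :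
    ∃ M, ∀ x, |J.iter h k u x| ≤ M := by
  induction k with
  | zero => exact hM
  | succ k ih => rw [iter_succ]; exact J.step_bdd h ih

end JumpData

theorem integrable_mul_bdd {d : ℕ} {u v : (Fin d → ℝ) → ℝ} (hu : Integrable u)
    (hv : Integrable v) (hM : ∃ M, ∀ x, |u x| ≤ M) : Integrable (fun x => u x * v x) := by
  obtain ⟨M, hM⟩ := hM
  exact hv.bdd_mul hu.aestronglyMeasurable (Eventually.of_forall hM)

theorem integrable_sq_bdd {d : ℕ} {u : (Fin d → ℝ) → ℝ} (hu : Integrable u)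
    (hM : ∃ M, ∀ x, |u x| ≤ M) : Integrable (fun x => u x ^ 2) := by
  simpa [sq] using integrable_mul_bdd hu hu hM

namespace JumpData
variable {d : ℕ} {S : Type} [Fintype S] (J : JumpData d S)

theorem integral_gen_sq_le {u : (Fin d → ℝ) → ℝ} (hu : Integrable u)
    (hM : ∃ M, ∀ x, |u x| ≤ M) :
    ∫ x, J.gen u x ^ 2 ≤ 4 * (Fintype.card S : ℝ) ^ 2 * J.K ^ 2 * ∫ x, u x ^ 2 := by
  have iu2 := integrable_sq_bdd hu hM
  have ish : ∀ s, Integrable (fun x => u (x - J.w s) ^ 2) := fun s => iu2.comp_sub_right (J.w s)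
  have ig : Integrable (fun x => J.gen u x ^ 2) :=
    integrable_sq_bdd (J.integrable_gen hu) (by
      obtain ⟨M, hM⟩ := hM; exact ⟨_, J.gen_bdd hM⟩)
  have iS1 : ∀ s, Integrable (fun x => 2 * J.K ^ 2 * (u (x - J.w s) ^ 2 + u x ^ 2)) := fun s =>
    ((ish s).fun_add iu2).const_mul _
  have iS2 : Integrable (fun x => ∑ s, (2 * J.K ^ 2 * (u (x - J.w s) ^ 2 + u x ^ 2))) :=
    integrable_finsetSum _ fun s _ => iS1 s
  have hpt : ∀ x, J.gen u x ^ 2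
      ≤ (Fintype.card S : ℝ) * ∑ s, (2 * J.K ^ 2 * (u (x - J.w s) ^ 2 + u x ^ 2)) := by
    intro x
    unfold gen
    refine (sq_sum_le_card_mul_sum_sq).trans ?_
    rw [Finset.card_univ]
    refine mul_le_mul_of_nonneg_left (Finset.sum_le_sum fun s _ => ?_) (by positivity)
    have h1 := J.abs_F_le s (x - J.w s) (u (x - J.w s))
    have h2 := J.abs_F_le s x (u x)
    have h1' := sq_le_sq' (by linarith [abs_nonneg (J.F s (x - J.w s) (u (x - J.w s))), J.K_nonneg]) h1
    have h2' := sq_le_sq' (by linarith [abs_nonneg (J.F s x (u x))]) h2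
    rw [sq_abs, mul_pow, sq_abs] at h1' h2'
    nlinarith [sq_nonneg (J.F s (x - J.w s) (u (x - J.w s)) + J.F s x (u x))]
  calc ∫ x, J.gen u x ^ 2
      ≤ ∫ x, (Fintype.card S : ℝ) * ∑ s, (2 * J.K ^ 2 * (u (x - J.w s) ^ 2 + u x ^ 2)) :=
        integral_mono ig (iS2.const_mul _) hpt
    _ = _ := by
        rw [integral_const_mul, integral_finsetSum _ fun s _ => iS1 s]
        have : ∀ s, ∫ x, 2 * J.K ^ 2 * (u (x - J.w s) ^ 2 + u x ^ 2)
            = 4 * J.K ^ 2 * ∫ x, u x ^ 2 := by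
          intro s
          rw [integral_const_mul, integral_add (ish s) iu2,
            integral_sub_right_eq_self (fun x => u x ^ 2) (J.w s)]
          ring
        simp_rw [this]
        simp
        ring

theorem integral_step_sq {h : ℝ} (hh : 0 ≤ h)
    (hK2 : h * (4 * (Fintype.card S : ℝ) ^ 2 * J.K ^ 2) ≤ 1)
    {u : (Fin d → ℝ) → ℝ} (hu : Integrable u) (hM : ∃ M, ∀ x, |u x| ≤ M) :
    ∫ x, J.step h u x ^ 2 ≤ (∫ x, u x ^ 2) + h * (∫ x, u x ^ 2)
      + 2 * h * ∫ x, u x * J.gen u x := by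
  have iu2 := integrable_sq_bdd hu hM
  have igen := J.integrable_gen hu
  have ig : Integrable (fun x => J.gen u x ^ 2) :=
    integrable_sq_bdd igen (by
      obtain ⟨M, hM⟩ := hM; exact ⟨_, J.gen_bdd hM⟩)
  have iug := integrable_mul_bdd hu igen hM
  have e : ∀ x, J.step h u x ^ 2
      = u x ^ 2 + 2 * h * (u x * J.gen u x) + h ^ 2 * J.gen u x ^ 2 := by
    intro x; unfold step; ring
  simp_rw [e]
  rw [integral_add (iu2.fun_add (iug.const_mul _)) (ig.const_mul _), integral_add iu2 (iug.const_mul _),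
    integral_const_mul, integral_const_mul]
  have h1 := J.integral_gen_sq_le hu hM
  have h2 : 0 ≤ ∫ x, u x ^ 2 := integral_nonneg fun x => sq_nonneg _
  have h3 : h ^ 2 * ∫ x, J.gen u x ^ 2 ≤ h * ∫ x, u x ^ 2 := by
    calc h ^ 2 * ∫ x, J.gen u x ^ 2
        ≤ h ^ 2 * (4 * (Fintype.card S : ℝ) ^ 2 * J.K ^ 2 * ∫ x, u x ^ 2) :=
          mul_le_mul_of_nonneg_left h1 (sq_nonneg h)
      _ = h * ((h * (4 * (Fintype.card S : ℝ) ^ 2 * J.K ^ 2)) * ∫ x, u x ^ 2) := by ring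
      _ ≤ h * (1 * ∫ x, u x ^ 2) := by gcongr
      _ = _ := by ring
  linarith

end JumpData


/-! ## Part 2: the concrete scheme -/

/-- sign attached to a boolean -/
noncomputable def bsgn (b : Bool) : ℝ := cond b 1 (-1)

/-- the unit vectors -/
noncomputable def ev {d : ℕ} (i : Fin d) : Fin d → ℝ := Pi.single i 1

/-- The data of a monotone finite difference scheme. -/
structure Scheme (d : ℕ) where
  Q : Type
  fQ : Fintype Q
  ρ : Q → (Fin d → ℝ) → ℝ
  c : Q → ℝ → ℝ
  v : Q → (Fin d → ℝ)
  f : Fin d → (Fin d → ℝ) → ℝ → ℝ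
  γ : ℝ
  ε : ℝ
  ε' : ℝ
  h : ℝ
  L : ℝ
  Lf : ℝ
  γ_pos : 0 < γ
  ε_pos : 0 < ε
  ε'_pos : 0 < ε'
  h_pos : 0 < h
  L_nonneg : 0 ≤ L
  Lf_nonneg : 0 ≤ Lf
  ρ_smooth : ∀ q, ContDiff ℝ 1 (ρ q)
  ρ_nonneg : ∀ q x, 0 ≤ ρ q x
  ρ_le : ∀ q x, ρ q x ≤ L
  dρ_le : ∀ q x, |fderiv ℝ (ρ q) x (v q)| ≤ L
  c_mono : ∀ q, Monotone (c q)
  c_zero : ∀ q, c q 0 = 0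
  c_lip : ∀ q r r', |c q r - c q r'| ≤ L * |r - r'|
  f_cont : ∀ i, Continuous (fun p : (Fin d → ℝ) × ℝ => f i p.1 p.2)
  f_zero : ∀ i x, f i x 0 = 0
  f_lip : ∀ i x r r', |f i x r - f i x r'| ≤ Lf * |r - r'|
  f_small : ε * Lf ≤ γ

namespace Scheme
variable {d : ℕ} (σ : Scheme d)

instance : Fintype σ.Q := σ.fQ

/-- jump index set -/
abbrev S : Type := (Fin d × Bool) ⊕ ((Fin d × Bool) ⊕ (σ.Q × Bool))

/-- jump vectors -/
noncomputable def jw : σ.S → (Fin d → ℝ)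
  | Sum.inl (i, b) => (bsgn b * σ.ε) • ev i
  | Sum.inr (Sum.inl (i, b)) => (bsgn b * σ.ε') • ev i
  | Sum.inr (Sum.inr (q, b)) => (bsgn b * σ.ε) • σ.v q

/-- jump rates -/
noncomputable def jF : σ.S → (Fin d → ℝ) → ℝ → ℝ
  | Sum.inl (i, b) => fun x r => σ.γ / (2 * σ.ε ^ 2) * r + bsgn b * (σ.f i x r / (2 * σ.ε))
  | Sum.inr (Sum.inl (_, _)) => fun _ r => σ.γ / (2 * σ.ε' ^ 2) * r
  | Sum.inr (Sum.inr (q, _)) => fun x r => (σ.ε ^ 2)⁻¹ * (σ.ρ q x * σ.c q r)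

theorem abs_bsgn (b : Bool) : |bsgn b| = 1 := by cases b <;> simp [bsgn]

theorem drift_aux (i : Fin d) (x : Fin d → ℝ) (r r' : ℝ) :
    |σ.f i x r / (2 * σ.ε) - σ.f i x r' / (2 * σ.ε)| ≤ σ.γ / (2 * σ.ε ^ 2) * |r - r'| := by
  have hε := σ.ε_pos
  rw [← sub_div, abs_div, abs_of_pos (show 0 < 2 * σ.ε by linarith)]
  have h1 := σ.f_lip i x r r'
  have h2 : σ.Lf / (2 * σ.ε) ≤ σ.γ / (2 * σ.ε ^ 2) := by
    rw [div_le_div_iff₀ (by positivity) (by positivity)]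
    have := σ.f_small
    nlinarith
  calc |σ.f i x r - σ.f i x r'| / (2 * σ.ε) ≤ σ.Lf * |r - r'| / (2 * σ.ε) := by gcongr
    _ = σ.Lf / (2 * σ.ε) * |r - r'| := by ring
    _ ≤ _ := by gcongr

/-- The jump data of the scheme. -/
noncomputable def jump : JumpData d σ.S where
  w := σ.jw
  F := σ.jF
  K := σ.γ / σ.ε ^ 2 + σ.γ / σ.ε' ^ 2 + (σ.ε ^ 2)⁻¹ * (σ.L * σ.L)
  K_nonneg := by
    have := σ.γ_pos; have := σ.ε_pos; have := σ.ε'_pos; have := σ.L_nonneg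
    positivity
  cont := by
    rintro (⟨i, b⟩ | ⟨i, b⟩ | ⟨q, b⟩)
    · simp only [jF]
      have := σ.f_cont i
      fun_prop
    · simp only [jF]; fun_prop
    · simp only [jF]
      have h1 := (σ.ρ_smooth q).continuous
      have h2 : Continuous (σ.c q) := by
        have : LipschitzWith (Real.toNNReal σ.L) (σ.c q) := by
          refine LipschitzWith.of_dist_le_mul fun r r' => ?_
          rw [Real.dist_eq, Real.dist_eq, Real.coe_toNNReal _ σ.L_nonneg]
          exact σ.c_lip q r r'
        exact this.continuous
      fun_prop
  zero := by
    rintro (⟨i, b⟩ | ⟨i, b⟩ | ⟨q, b⟩) x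
    · simp [jF, σ.f_zero]
    · simp [jF]
    · simp [jF, σ.c_zero]
  mono := by
    have hγ := σ.γ_pos; have hε := σ.ε_pos; have hε' := σ.ε'_pos; have := σ.L_nonneg
    rintro (⟨i, b⟩ | ⟨i, b⟩ | ⟨q, b⟩) x r r' hr
    · simp only [jF]
      have h1 := σ.drift_aux i x r r'
      rw [abs_sub_comm r, abs_of_nonneg (sub_nonneg.2 hr)] at h1
      have h2 := abs_le.1 h1
      cases b <;> simp only [bsgn, cond_true, cond_false] <;> nlinarith
    · simp only [jF]; gcongr
    · simp only [jF]
      have := σ.ρ_nonneg q x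
      have := σ.c_mono q hr
      gcongr
  lip := by
    have hγ := σ.γ_pos; have hε := σ.ε_pos; have hε' := σ.ε'_pos; have hL := σ.L_nonneg
    have p1 : 0 ≤ σ.γ / σ.ε ^ 2 := by positivity
    have p2 : 0 ≤ σ.γ / σ.ε' ^ 2 := by positivity
    have p3 : 0 ≤ (σ.ε ^ 2)⁻¹ * (σ.L * σ.L) := by positivity
    rintro (⟨i, b⟩ | ⟨i, b⟩ | ⟨q, b⟩) x r r'
    · simp only [jF]
      have h1 := σ.drift_aux i x r r'
      have e : σ.γ / (2 * σ.ε ^ 2) * r + bsgn b * (σ.f i x r / (2 * σ.ε)) -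
          (σ.γ / (2 * σ.ε ^ 2) * r' + bsgn b * (σ.f i x r' / (2 * σ.ε)))
          = σ.γ / (2 * σ.ε ^ 2) * (r - r')
            + bsgn b * (σ.f i x r / (2 * σ.ε) - σ.f i x r' / (2 * σ.ε)) := by ring
      rw [e]
      refine (abs_add_le _ _).trans ?_
      rw [abs_mul, abs_mul, abs_bsgn, one_mul, abs_of_nonneg (by positivity : 0 ≤ σ.γ / (2 * σ.ε ^ 2))]
      have e2 : σ.γ / (2 * σ.ε ^ 2) * |r - r'| + σ.γ / (2 * σ.ε ^ 2) * |r - r'|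
        = σ.γ / σ.ε ^ 2 * |r - r'| := by field_simp; ring
      have := abs_nonneg (r - r')
      nlinarith [mul_nonneg p2 this, mul_nonneg p3 this]
    · simp only [jF]
      rw [← mul_sub, abs_mul, abs_of_nonneg (by positivity : 0 ≤ σ.γ / (2 * σ.ε' ^ 2))]
      have e2 : σ.γ / (2 * σ.ε' ^ 2) * |r - r'| + σ.γ / (2 * σ.ε' ^ 2) * |r - r'|
        = σ.γ / σ.ε' ^ 2 * |r - r'| := by field_simp; ring
      have := abs_nonneg (r - r')
      have : 0 ≤ σ.γ / (2 * σ.ε' ^ 2) * |r - r'| := by positivity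
      nlinarith [mul_nonneg p2 (abs_nonneg (r - r')), mul_nonneg p3 (abs_nonneg (r - r')),
        mul_nonneg p1 (abs_nonneg (r - r'))]
    · simp only [jF]
      rw [← mul_sub, ← mul_sub, abs_mul, abs_mul, abs_of_nonneg (σ.ρ_nonneg q x),
        abs_of_nonneg (by positivity : 0 ≤ (σ.ε ^ 2)⁻¹)]
      have h1 : σ.ρ q x * |σ.c q r - σ.c q r'| ≤ σ.L * (σ.L * |r - r'|) :=
        mul_le_mul (σ.ρ_le q x) (σ.c_lip q r r') (abs_nonneg _) hL
      have h2 : (σ.ε ^ 2)⁻¹ * (σ.ρ q x * |σ.c q r - σ.c q r'|)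
        ≤ (σ.ε ^ 2)⁻¹ * (σ.L * (σ.L * |r - r'|)) := by gcongr
      nlinarith [mul_nonneg p2 (abs_nonneg (r - r')), mul_nonneg p1 (abs_nonneg (r - r'))]

/-- symmetric second difference -/
def D2 (φ : (Fin d → ℝ) → ℝ) (w x : Fin d → ℝ) : ℝ := φ (x + w) + φ (x - w) - 2 * φ x

theorem sum_formula (φ : (Fin d → ℝ) → ℝ) (x : Fin d → ℝ) (r : ℝ) :
    ∑ s, σ.jump.F s x r * (φ (x + σ.jump.w s) - φ x)
      = σ.γ / (2 * σ.ε ^ 2) * r * ∑ i, D2 φ (σ.ε • ev i) x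
        + σ.γ / (2 * σ.ε' ^ 2) * r * ∑ i, D2 φ (σ.ε' • ev i) x
        + ∑ q, (σ.ε ^ 2)⁻¹ * (σ.ρ q x * σ.c q r) * D2 φ (σ.ε • σ.v q) x
        + ∑ i, σ.f i x r / (2 * σ.ε) * (φ (x + σ.ε • ev i) - φ (x - σ.ε • ev i)) := by
  simp only [jump, Fintype.sum_sum_type, Fintype.sum_prod_type, Fintype.sum_bool, jF, jw, bsgn,
    cond_true, cond_false, one_mul, neg_mul, neg_smul, ← sub_eq_add_neg, D2]
  have e1 : ∀ A B C D A' : ℝ, A' = A + D → A' + (B + C) = A + B + C + D := by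
    intro A B C D A' h; rw [h]; ring
  have e2 : ∀ q, σ.ε ^ 2 = σ.ε ^ 2 ∧ (σ.ε ^ 2)⁻¹ * (σ.ρ q x * σ.c q r) * (φ (x + σ.ε • σ.v q) - φ x)
      + (σ.ε ^ 2)⁻¹ * (σ.ρ q x * σ.c q r) * (φ (x - σ.ε • σ.v q) - φ x)
      = (σ.ε ^ 2)⁻¹ * (σ.ρ q x * σ.c q r)
        * (φ (x + σ.ε • σ.v q) + φ (x - σ.ε • σ.v q) - 2 * φ x) := fun q => ⟨rfl, by ring⟩
  rw [Finset.sum_congr rfl fun q _ => (e2 q).2]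
  have e3 : ∑ i, (σ.γ / (2 * σ.ε' ^ 2) * r * (φ (x + σ.ε' • ev i) - φ x)
      + σ.γ / (2 * σ.ε' ^ 2) * r * (φ (x - σ.ε' • ev i) - φ x))
      = σ.γ / (2 * σ.ε' ^ 2) * r * ∑ i, (φ (x + σ.ε' • ev i) + φ (x - σ.ε' • ev i) - 2 * φ x) := by
    rw [Finset.mul_sum]
    exact Finset.sum_congr rfl fun i _ => by ring
  rw [e3]
  apply e1
  rw [Finset.mul_sum, ← Finset.sum_add_distrib]
  exact Finset.sum_congr rfl fun i _ => by ring

end Scheme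


/-! ## Part 3: energy estimate -/

theorem MeasureTheory.Integrable.cbm {d : ℕ} {g φ : (Fin d → ℝ) → ℝ} (hg : Integrable g)
    (hφ : Continuous φ) {M : ℝ} (hM : ∀ x, |φ x| ≤ M) : Integrable (fun x => g x * φ x) := by
  have := hg.bdd_mul hφ.aestronglyMeasurable (Eventually.of_forall hM)
  simpa only [mul_comm] using this

/-- integrable and bounded functions -/
def IB {d : ℕ} (u : (Fin d → ℝ) → ℝ) : Prop := Integrable u ∧ ∃ M, ∀ x, |u x| ≤ M

namespace IB
variable {d : ℕ} {u v : (Fin d → ℝ) → ℝ}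

theorem add (hu : IB u) (hv : IB v) : IB (fun x => u x + v x) := by
  obtain ⟨hu, M, hM⟩ := hu
  obtain ⟨hv, N, hN⟩ := hv
  exact ⟨hu.fun_add hv, M + N, fun x => (abs_add_le _ _).trans (add_le_add (hM x) (hN x))⟩

theorem sub (hu : IB u) (hv : IB v) : IB (fun x => u x - v x) := by
  obtain ⟨hu, M, hM⟩ := hu
  obtain ⟨hv, N, hN⟩ := hv
  exact ⟨hu.fsub hv, M + N, fun x => (abs_sub _ _).trans (add_le_add (hM x) (hN x))⟩

theorem mul (hu : IB u) (hv : IB v) : IB (fun x => u x * v x) := by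
  refine ⟨integrable_mul_bdd hu.1 hv.1 hu.2, ?_⟩
  obtain ⟨hu, M, hM⟩ := hu
  obtain ⟨hv, N, hN⟩ := hv
  refine ⟨M * N, fun x => ?_⟩
  rw [abs_mul]
  exact mul_le_mul (hM x) (hN x) (abs_nonneg _) ((abs_nonneg _).trans (hM x))

theorem cmul (hu : IB u) (c : ℝ) : IB (fun x => c * u x) := by
  obtain ⟨hu, M, hM⟩ := hu
  refine ⟨hu.const_mul c, |c| * M, fun x => ?_⟩
  rw [abs_mul]
  exact mul_le_mul_of_nonneg_left (hM x) (abs_nonneg _)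

theorem sq (hu : IB u) : IB (fun x => u x ^ 2) := by
  simpa only [pow_two] using hu.mul hu

theorem abs (hu : IB u) : IB (fun x => |u x|) := by
  obtain ⟨hu, M, hM⟩ := hu
  exact ⟨hu.abs, M, fun x => by rw [abs_abs]; exact hM x⟩

theorem shift (hu : IB u) (w : Fin d → ℝ) : IB (fun x => u (x + w)) := by
  obtain ⟨hu, M, hM⟩ := hu
  exact ⟨hu.comp_add_right w, M, fun x => hM _⟩

theorem shift' (hu : IB u) (w : Fin d → ℝ) : IB (fun x => u (x - w)) := by
  obtain ⟨hu, M, hM⟩ := hu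
  exact ⟨hu.comp_sub_right w, M, fun x => hM _⟩

theorem sum {ι : Type*} (s : Finset ι) {u : ι → (Fin d → ℝ) → ℝ} (hu : ∀ i, IB (u i)) :
    IB (fun x => ∑ i ∈ s, u i x) := by
  refine ⟨integrable_finsetSum _ fun i _ => (hu i).1, ?_⟩
  choose M hM using fun i => (hu i).2
  exact ⟨∑ i ∈ s, M i, fun x => (Finset.abs_sum_le_sum_abs _ _).trans
    (Finset.sum_le_sum fun i _ => hM i x)⟩

theorem mulc (hu : IB u) {φ : (Fin d → ℝ) → ℝ} (hφ : Continuous φ)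
    (hM : ∃ M, ∀ x, |φ x| ≤ M) : IB (fun x => u x * φ x) := by
  obtain ⟨hu, N, hN⟩ := hu
  obtain ⟨M, hM⟩ := hM
  refine ⟨hu.cbm hφ hM, N * M, fun x => ?_⟩
  rw [abs_mul]
  exact mul_le_mul (hN x) (hM x) (abs_nonneg _) ((abs_nonneg _).trans (hN x))

/-- composition with a function of linear growth -/
theorem of_le {F : (Fin d → ℝ) × ℝ → ℝ} (hF : Continuous F) (hu : IB u) {v : (Fin d → ℝ) → ℝ}
    (hv : IB v) (h : ∀ x, |F (x, u x)| ≤ v x) : IB (fun x => F (x, u x)) := by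
  obtain ⟨hu, N, hN⟩ := hu
  obtain ⟨hv, M, hM⟩ := hv
  refine ⟨hv.mono' (hF.comp_aestronglyMeasurable
      (f := fun x => (x, u x)) (aestronglyMeasurable_id.prodMk hu.aestronglyMeasurable))
      (Eventually.of_forall h), M, fun x => (h x).trans ((le_abs_self _).trans (hM x))⟩

end IB

theorem integral_shift_mul {d : ℕ} (f g : (Fin d → ℝ) → ℝ) (w : Fin d → ℝ) :
    ∫ x, f x * g (x + w) = ∫ x, f (x - w) * g x := by
  rw [← integral_add_right_eq_self (fun x => f (x - w) * g x) w]
  simp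

theorem integral_shift_mul' {d : ℕ} (f g : (Fin d → ℝ) → ℝ) (w : Fin d → ℝ) :
    ∫ x, f x * g (x - w) = ∫ x, f (x + w) * g x := by
  rw [← integral_sub_right_eq_self (fun x => f (x + w) * g x) w]
  simp

namespace Scheme
variable {d : ℕ}

theorem heat_energy {u : (Fin d → ℝ) → ℝ} (hu : IB u) (w : Fin d → ℝ) :
    ∫ x, u x * D2 u w x = - ∫ x, (u (x + w) - u x) ^ 2 := by
  have i1 := (hu.mul (hu.shift w)).1
  have i2 := (hu.mul (hu.shift' w)).1
  have i3 := hu.sq.1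
  have i4 := (hu.shift w).sq.1
  have e1 : ∀ x, u x * D2 u w x = u x * u (x + w) + u x * u (x - w) - 2 * u x ^ 2 := by
    intro x; unfold D2; ring
  have e2 : ∀ x, (u (x + w) - u x) ^ 2 = u (x + w) ^ 2 + u x ^ 2 - 2 * (u x * u (x + w)) := by
    intro x; ring
  simp_rw [e1, e2]
  rw [integral_sub (i1.fun_add i2) (i3.const_mul 2), integral_add i1 i2, integral_const_mul,
    integral_sub (i4.fun_add i3) (i1.const_mul 2), integral_add i4 i3, integral_const_mul,
    integral_shift_mul', integral_add_right_eq_self (fun x => u x ^ 2) w]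
  have : ∫ x, u (x + w) * u x = ∫ x, u x * u (x + w) := by simp_rw [mul_comm]
  rw [this]; ring

theorem D2_energy {g ρ : (Fin d → ℝ) → ℝ} (hg : IB g) (hρ : Continuous ρ)
    (hM : ∃ M, ∀ x, |ρ x| ≤ M) (w : Fin d → ℝ) :
    ∫ x, ρ x * D2 g w x = ∫ x, g x * D2 ρ w x := by
  have hρ1 : Continuous fun x => ρ (x + w) := by fun_prop
  have hρ2 : Continuous fun x => ρ (x - w) := by fun_prop
  have hM1 : ∃ M, ∀ x, |ρ (x + w)| ≤ M := by obtain ⟨M, h⟩ := hM; exact ⟨M, fun x => h _⟩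
  have hM2 : ∃ M, ∀ x, |ρ (x - w)| ≤ M := by obtain ⟨M, h⟩ := hM; exact ⟨M, fun x => h _⟩
  have i0 := (hg.mulc hρ hM).1
  have i1 := (hg.mulc hρ1 hM1).1
  have i2 := (hg.mulc hρ2 hM2).1
  have i3 := ((hg.shift w).mulc hρ hM).1
  have i4 := ((hg.shift' w).mulc hρ hM).1
  have e1 : ∀ x, ρ x * D2 g w x = g (x + w) * ρ x + g (x - w) * ρ x - 2 * (g x * ρ x) := by
    intro x; unfold D2; ring
  have e2 : ∀ x, g x * D2 ρ w x = g x * ρ (x + w) + g x * ρ (x - w) - 2 * (g x * ρ x) := by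
    intro x; unfold D2; ring
  simp_rw [e1, e2]
  rw [integral_sub (i3.fun_add i4) (i0.const_mul 2), integral_add i3 i4, integral_const_mul,
    integral_sub (i1.fun_add i2) (i0.const_mul 2), integral_add i1 i2, integral_const_mul,
    integral_shift_mul', integral_shift_mul]
  ring

variable (σ : Scheme d)

/-- primitive of `c` -/
noncomputable def Ch (q : σ.Q) (s : ℝ) : ℝ := ∫ r in (0 : ℝ)..s, σ.c q r

theorem c_cont (q : σ.Q) : Continuous (σ.c q) := by
  have : LipschitzWith (Real.toNNReal σ.L) (σ.c q) := by
    refine LipschitzWith.of_dist_le_mul fun r r' => ?_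
    rw [Real.dist_eq, Real.dist_eq, Real.coe_toNNReal _ σ.L_nonneg]
    exact σ.c_lip q r r'
  exact this.continuous

theorem Ch_sub (q : σ.Q) (s t : ℝ) : σ.Ch q t - σ.Ch q s = ∫ r in s..t, σ.c q r := by
  unfold Ch
  rw [intervalIntegral.integral_interval_sub_left] <;>
  exact (σ.c_cont q).intervalIntegrable _ _

theorem Ch_convex (q : σ.Q) (s t : ℝ) : σ.c q s * (t - s) ≤ σ.Ch q t - σ.Ch q s := by
  rw [Ch_sub]
  rcases le_total s t with h | h
  · have := intervalIntegral.integral_mono_on (μ := volume) h (f := fun _ => σ.c q s) (g := σ.c q)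
      (continuous_const.intervalIntegrable _ _) ((σ.c_cont q).intervalIntegrable _ _) (fun r hr => σ.c_mono q hr.1)
    simpa [mul_comm] using this
  · rw [intervalIntegral.integral_symm]
    have := intervalIntegral.integral_mono_on (μ := volume) h (f := σ.c q) (g := fun _ => σ.c q s)
      ((σ.c_cont q).intervalIntegrable _ _) (continuous_const.intervalIntegrable _ _) (fun r hr => σ.c_mono q hr.2)
    simp only [intervalIntegral.integral_const, smul_eq_mul] at this
    linarith

theorem Ch_cont (q : σ.Q) : Continuous (σ.Ch q) :=
  intervalIntegral.continuous_primitive (fun _ _ => (σ.c_cont q).intervalIntegrable _ _) 0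

theorem Ch_le (q : σ.Q) (s : ℝ) : |σ.Ch q s| ≤ σ.L * s ^ 2 := by
  unfold Ch
  have := intervalIntegral.norm_integral_le_of_norm_le_const (f := σ.c q) (a := 0) (b := s)
    (C := σ.L * |s|) (fun r hr => by
      have h1 := σ.c_lip q r 0
      rw [σ.c_zero, sub_zero, sub_zero] at h1
      refine h1.trans (mul_le_mul_of_nonneg_left ?_ σ.L_nonneg)
      rcases Set.mem_uIoc.1 hr with ⟨h2, h3⟩ | ⟨h2, h3⟩
      · rw [abs_of_pos h2]; exact h3.trans (le_abs_self _)
      · rw [abs_of_nonpos h3, abs_of_nonpos (by linarith)]; linarith)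
  rw [Real.norm_eq_abs, sub_zero] at this
  calc _ ≤ _ := this
    _ = σ.L * |s| ^ 2 := by ring
    _ = _ := by rw [sq_abs]

/-- uniform properties of a scheme -/
structure Good (C δ : ℝ) : Prop where
  C_nonneg : 0 ≤ C
  δ_nonneg : 0 ≤ δ
  cfl1 : σ.h * (Fintype.card σ.S * σ.jump.K) ≤ 1
  cfl2 : σ.h * (4 * (Fintype.card σ.S : ℝ) ^ 2 * σ.jump.K ^ 2) ≤ 1
  h_le : σ.h ≤ δ
  ε_le : σ.ε ≤ δ
  ε'_le : σ.ε' ≤ δ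
  s1 : ∀ i x s, |∑ q, σ.c q s * (σ.v q i * fderiv ℝ (σ.ρ q) x (σ.v q))| ≤ C * |s|
  s2 : ∀ i j x s, |∑ q, σ.ρ q x * σ.c q s * (σ.v q i * σ.v q j)| ≤ C * |s|
  s3 : ∀ i x s, |σ.f i x s| ≤ C * |s|
  s4 : ∀ x s, |∑ q, σ.Ch q s * ((σ.ε ^ 2)⁻¹ * D2 (σ.ρ q) (σ.ε • σ.v q) x
      - ∑ i, σ.v q i * (fderiv ℝ (σ.ρ q) (x + σ.ε • ev i) (σ.v q)
        - fderiv ℝ (σ.ρ q) (x - σ.ε • ev i) (σ.v q)) / (2 * σ.ε))| ≤ C * s ^ 2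
  s5 : ∀ x s, σ.ε * ∑ q, σ.ρ q x * |σ.c q s| * ‖σ.v q‖ ^ 3 ≤ δ * |s|
  s6 : ∀ z, ‖z‖ ≤ σ.ε' → ∀ x r, ∑ s, |σ.jump.F s (x + z) r - σ.jump.F s x r| ≤ δ * |r|

theorem Good.s1' {σ : Scheme d} {C δ : ℝ} (G : σ.Good C δ) (i : Fin d) (x : Fin d → ℝ) (s t : ℝ) :
    |∑ q, (σ.Ch q s - σ.Ch q t) * (σ.v q i * fderiv ℝ (σ.ρ q) x (σ.v q))|
      ≤ C * (|s| + |t|) * |s - t| := by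
  have e : ∑ q, (σ.Ch q s - σ.Ch q t) * (σ.v q i * fderiv ℝ (σ.ρ q) x (σ.v q))
      = ∫ r in t..s, ∑ q, σ.c q r * (σ.v q i * fderiv ℝ (σ.ρ q) x (σ.v q)) := by
    rw [intervalIntegral.integral_finsetSum]
    · refine Finset.sum_congr rfl fun q _ => ?_
      rw [intervalIntegral.integral_mul_const, Ch_sub]
    · intro q _
      exact ((σ.c_cont q).mul continuous_const).intervalIntegrable _ _
  rw [e, ← Real.norm_eq_abs]
  refine intervalIntegral.norm_integral_le_of_norm_le_const fun r hr => ?_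
  refine (G.s1 i x r).trans (mul_le_mul_of_nonneg_left ?_ G.C_nonneg)
  rcases Set.mem_uIoc.1 hr with ⟨h2, h3⟩ | ⟨h2, h3⟩
  · rw [abs_le]
    constructor <;> linarith [le_abs_self s, neg_abs_le t, abs_nonneg s, abs_nonneg t]
  · rw [abs_le]
    constructor <;> linarith [le_abs_self t, neg_abs_le s, abs_nonneg s, abs_nonneg t]

end Scheme

namespace Scheme
variable {d : ℕ} {σ : Scheme d}

theorem sq_integral_facts {u : (Fin d → ℝ) → ℝ} (hu : IB u) (w : Fin d → ℝ) :
    ∫ x, (u (x + w) - u (x - w)) ^ 2 ≤ 4 * ∫ x, (u (x + w) - u x) ^ 2 := by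
  have i1 := ((hu.shift w).sub hu).sq.1
  have i2 := (hu.sub (hu.shift' w)).sq.1
  have e : ∫ x, (u x - u (x - w)) ^ 2 = ∫ x, (u (x + w) - u x) ^ 2 := by
    rw [← integral_sub_right_eq_self (fun x => (u (x + w) - u x) ^ 2) w]
    simp
  calc ∫ x, (u (x + w) - u (x - w)) ^ 2
      ≤ ∫ x, (2 * (u (x + w) - u x) ^ 2 + 2 * (u x - u (x - w)) ^ 2) := by
        refine integral_mono ((hu.shift w).sub (hu.shift' w)).sq.1
          ((i1.const_mul 2).fun_add (i2.const_mul 2)) fun x => ?_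
        show (u (x + w) - u (x - w)) ^ 2 ≤ 2 * (u (x + w) - u x) ^ 2 + 2 * (u x - u (x - w)) ^ 2
        nlinarith [sq_nonneg ((u (x + w) - u x) - (u x - u (x - w)))]
    _ = _ := by
        rw [integral_add (i1.const_mul 2) (i2.const_mul 2), integral_const_mul, integral_const_mul, e]
        ring

theorem young {γ ε C P D : ℝ} (hγ : 0 < γ) (hε : 0 < ε) :
    (2 * ε)⁻¹ * (C * P * D) ≤ γ / (16 * ε ^ 2) * D ^ 2 + C ^ 2 / γ * P ^ 2 := by
  have h : γ / (16 * ε ^ 2) * D ^ 2 + C ^ 2 / γ * P ^ 2 - (2 * ε)⁻¹ * (C * P * D)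
      = γ * (D / (4 * ε) - C * P / γ) ^ 2 := by
    field_simp; ring
  nlinarith [mul_nonneg hγ.le (sq_nonneg (D / (4 * ε) - C * P / γ))]

theorem Good.energy_q {C δ : ℝ} (G : σ.Good C δ) {u : (Fin d → ℝ) → ℝ} (hu : IB u) :
    ∫ x, ∑ q, (σ.ε ^ 2)⁻¹ * (σ.ρ q x * σ.c q (u x)) * D2 u (σ.ε • σ.v q) x
      ≤ C * (∫ x, u x ^ 2) + ∑ i, (σ.γ / (16 * σ.ε ^ 2) *
          (∫ x, (u (x + σ.ε • ev i) - u (x - σ.ε • ev i)) ^ 2) + 4 * C ^ 2 / σ.γ * ∫ x, u x ^ 2) := by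
  have hε := σ.ε_pos
  have hγ := σ.γ_pos
  have ρc : ∀ q, Continuous (σ.ρ q) := fun q => (σ.ρ_smooth q).continuous
  have ρb : ∀ q, ∃ M, ∀ x, |σ.ρ q x| ≤ M := fun q =>
    ⟨σ.L, fun x => by rw [abs_of_nonneg (σ.ρ_nonneg q x)]; exact σ.ρ_le q x⟩
  have ρD2c : ∀ q w, Continuous (D2 (σ.ρ q) w) := fun q w => by
    have := ρc q
    unfold D2; fun_prop
  have ρD2b : ∀ q w, ∃ M, ∀ x, |D2 (σ.ρ q) w x| ≤ M := fun q w => by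
    obtain ⟨M, hM⟩ := ρb q
    refine ⟨M + M + 2 * M, fun x => ?_⟩
    unfold D2
    have h1 := abs_le.1 (hM (x + w)); have h2 := abs_le.1 (hM (x - w)); have h3 := abs_le.1 (hM x)
    rw [abs_le]; constructor <;> linarith
  -- the derivative functions
  set κ : σ.Q → (Fin d → ℝ) → ℝ := fun q x => fderiv ℝ (σ.ρ q) x (σ.v q) with hκ
  have κc : ∀ q, Continuous (κ q) := fun q =>
    ((σ.ρ_smooth q).continuous_fderiv (by norm_num)).clm_apply continuous_const
  have κb : ∀ q, ∃ M, ∀ x, |κ q x| ≤ M := fun q => ⟨σ.L, fun x => σ.dρ_le q x⟩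
  have iCh : ∀ q, IB (fun x => σ.Ch q (u x)) := fun q => by
    have hF : Continuous (fun p : (Fin d → ℝ) × ℝ => σ.Ch q p.2) := (σ.Ch_cont q).comp continuous_snd
    exact IB.of_le hF hu (hu.sq.cmul σ.L) (fun x => σ.Ch_le q (u x))
  have ic : ∀ q, IB (fun x => σ.c q (u x)) := fun q => by
    have hF : Continuous (fun p : (Fin d → ℝ) × ℝ => σ.c q p.2) := (σ.c_cont q).comp continuous_snd
    refine IB.of_le hF hu (hu.abs.cmul σ.L) (fun x => ?_)
    have h1 := σ.c_lip q (u x) 0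
    simpa [σ.c_zero] using h1
  have iD2 : ∀ {g : (Fin d → ℝ) → ℝ}, IB g → ∀ w, IB (D2 g w) := fun hg w =>
    ((hg.shift w).add (hg.shift' w)).sub (hg.cmul 2)
  -- step 1 : convexity
  have i1 : Integrable (fun x => ∑ q, (σ.ε ^ 2)⁻¹ * (σ.ρ q x * σ.c q (u x)) * D2 u (σ.ε • σ.v q) x) := by
    refine (IB.sum _ fun q => ?_).1
    have := (((ic q).mulc (ρc q) (ρb q)).mul (iD2 hu (σ.ε • σ.v q))).cmul (σ.ε ^ 2)⁻¹
    convert this using 2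
    ring
  have i2q : ∀ q, Integrable (fun x => (σ.ε ^ 2)⁻¹ * (σ.ρ q x * D2 (fun y => σ.Ch q (u y)) (σ.ε • σ.v q) x)) := by
    intro q
    have := (((iD2 (iCh q) (σ.ε • σ.v q)).mulc (ρc q) (ρb q)).cmul (σ.ε ^ 2)⁻¹).1
    simpa only [mul_comm (σ.ρ q _)] using this
  have i3q : ∀ q, IB (fun x => σ.Ch q (u x) * D2 (σ.ρ q) (σ.ε • σ.v q) x) := fun q =>
    (iCh q).mulc (ρD2c q _) (ρD2b q _)
  have st1 : ∫ x, ∑ q, (σ.ε ^ 2)⁻¹ * (σ.ρ q x * σ.c q (u x)) * D2 u (σ.ε • σ.v q) x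
      ≤ ∫ x, ∑ q, (σ.ε ^ 2)⁻¹ * (σ.ρ q x * D2 (fun y => σ.Ch q (u y)) (σ.ε • σ.v q) x) := by
    refine integral_mono i1 (integrable_finsetSum _ fun q _ => i2q q) fun x => ?_
    refine Finset.sum_le_sum fun q _ => ?_
    rw [mul_assoc, mul_assoc]
    refine mul_le_mul_of_nonneg_left (mul_le_mul_of_nonneg_left ?_ (σ.ρ_nonneg q x)) (by positivity)
    unfold D2
    have a1 := σ.Ch_convex q (u x) (u (x + σ.ε • σ.v q))
    have a2 := σ.Ch_convex q (u x) (u (x - σ.ε • σ.v q))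
    nlinarith
  have st2 : ∫ x, ∑ q, (σ.ε ^ 2)⁻¹ * (σ.ρ q x * D2 (fun y => σ.Ch q (u y)) (σ.ε • σ.v q) x)
      = ∫ x, ∑ q, σ.Ch q (u x) * ((σ.ε ^ 2)⁻¹ * D2 (σ.ρ q) (σ.ε • σ.v q) x) := by
    rw [integral_finsetSum _ fun q _ => i2q q, integral_finsetSum]
    · refine Finset.sum_congr rfl fun q _ => ?_
      rw [integral_const_mul, D2_energy (iCh q) (ρc q) (ρb q), ← integral_const_mul]
      congr 1; funext x; ring
    · intro q _
      have := ((i3q q).cmul (σ.ε ^ 2)⁻¹).1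
      convert this using 2
      ring
  -- the discrete divergence term
  have ish : ∀ i : Fin d, IB (fun x => u (x + σ.ε • ev i)) := fun i => hu.shift _
  have ish' : ∀ i : Fin d, IB (fun x => u (x - σ.ε • ev i)) := fun i => hu.shift' _
  have i5 : ∀ i q, IB (fun x => σ.Ch q (u x) * (σ.v q i * (κ q (x + σ.ε • ev i) - κ q (x - σ.ε • ev i)) / (2 * σ.ε))) := by
    intro i q
    have hc : Continuous (fun x => κ q (x + σ.ε • ev i) - κ q (x - σ.ε • ev i)) := by
      have := κc q
      fun_prop
    have hb : ∃ M, ∀ x, |κ q (x + σ.ε • ev i) - κ q (x - σ.ε • ev i)| ≤ M := by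
      obtain ⟨M, hM⟩ := κb q
      exact ⟨M + M, fun x => (abs_sub _ _).trans (add_le_add (hM _) (hM _))⟩
    have := ((iCh q).mulc hc hb).cmul (σ.v q i / (2 * σ.ε))
    convert this using 2
    ring
  have i5s : IB (fun x => ∑ i, ∑ q, σ.Ch q (u x) * (σ.v q i * (κ q (x + σ.ε • ev i) - κ q (x - σ.ε • ev i)) / (2 * σ.ε))) :=
    IB.sum _ fun i => IB.sum _ fun q => i5 i q
  have i4 : Integrable (fun x => ∑ q, σ.Ch q (u x) * ((σ.ε ^ 2)⁻¹ * D2 (σ.ρ q) (σ.ε • σ.v q) x)) := by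
    refine (IB.sum _ fun q => ?_).1
    have := ((i3q q).cmul (σ.ε ^ 2)⁻¹)
    convert this using 2
    ring
  have st3 : ∫ x, ∑ q, σ.Ch q (u x) * ((σ.ε ^ 2)⁻¹ * D2 (σ.ρ q) (σ.ε • σ.v q) x)
      ≤ C * (∫ x, u x ^ 2) + ∫ x, ∑ i, ∑ q, σ.Ch q (u x) * (σ.v q i * (κ q (x + σ.ε • ev i) - κ q (x - σ.ε • ev i)) / (2 * σ.ε)) := by
    rw [← integral_const_mul, ← integral_add (hu.sq.cmul C).1 i5s.1]
    refine integral_mono i4 ((hu.sq.cmul C).1.fun_add i5s.1) fun x => ?_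
    have h := (abs_le.1 (G.s4 x (u x))).2
    simp only [mul_sub, Finset.mul_sum, Finset.sum_sub_distrib] at h ⊢
    rw [Finset.sum_comm] at h
    linarith
  have st4 : ∀ i, ∫ x, ∑ q, σ.Ch q (u x) * (σ.v q i * (κ q (x + σ.ε • ev i) - κ q (x - σ.ε • ev i)) / (2 * σ.ε))
      ≤ σ.γ / (16 * σ.ε ^ 2) *
          (∫ x, (u (x + σ.ε • ev i) - u (x - σ.ε • ev i)) ^ 2) + 4 * C ^ 2 / σ.γ * ∫ x, u x ^ 2 := by
    intro i
    have a1 : ∀ q, IB (fun x => (σ.Ch q (u x)) * κ q (x + σ.ε • ev i)) := fun q => by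
      have := κc q
      obtain ⟨M, hM⟩ := κb q
      exact (iCh q).mulc (by fun_prop) ⟨M, fun x => hM _⟩
    have a2 : ∀ q, IB (fun x => (σ.Ch q (u x)) * κ q (x - σ.ε • ev i)) := fun q => by
      have := κc q
      obtain ⟨M, hM⟩ := κb q
      exact (iCh q).mulc (by fun_prop) ⟨M, fun x => hM _⟩
    have a3 : ∀ q, IB (fun x => (σ.Ch q (u (x - σ.ε • ev i))) * κ q x) := fun q =>
      ((iCh q).shift' (σ.ε • ev i)).mulc (κc q) (κb q)
    have a4 : ∀ q, IB (fun x => (σ.Ch q (u (x + σ.ε • ev i))) * κ q x) := fun q =>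
      ((iCh q).shift (σ.ε • ev i)).mulc (κc q) (κb q)
    have e1 : ∫ x, ∑ q, σ.Ch q (u x) * (σ.v q i * (κ q (x + σ.ε • ev i) - κ q (x - σ.ε • ev i)) / (2 * σ.ε))
        = ∫ x, (2 * σ.ε)⁻¹ * ∑ q, (σ.Ch q (u (x - σ.ε • ev i)) - σ.Ch q (u (x + σ.ε • ev i))) * (σ.v q i * κ q x) := by
      rw [integral_finsetSum _ fun q _ => (i5 i q).1]
      simp_rw [Finset.mul_sum]
      rw [integral_finsetSum]
      · refine Finset.sum_congr rfl fun q _ => ?_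
        have e2 : ∀ x, σ.Ch q (u x) * (σ.v q i * (κ q (x + σ.ε • ev i) - κ q (x - σ.ε • ev i)) / (2 * σ.ε))
          = ((2 * σ.ε)⁻¹ * σ.v q i) * ((σ.Ch q (u x)) * κ q (x + σ.ε • ev i) - (σ.Ch q (u x)) * κ q (x - σ.ε • ev i)) := by
          intro x; ring
        have e3 : ∀ x, (2 * σ.ε)⁻¹ * ((σ.Ch q (u (x - σ.ε • ev i)) - σ.Ch q (u (x + σ.ε • ev i))) * (σ.v q i * κ q x))
          = ((2 * σ.ε)⁻¹ * σ.v q i) * ((σ.Ch q (u (x - σ.ε • ev i))) * κ q x - (σ.Ch q (u (x + σ.ε • ev i))) * κ q x) := by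
          intro x; ring
        simp_rw [e2, e3]
        rw [integral_const_mul, integral_const_mul, integral_sub (a1 q).1 (a2 q).1,
          integral_sub (a3 q).1 (a4 q).1, integral_shift_mul (fun x => σ.Ch q (u x)),
          integral_shift_mul' (fun x => σ.Ch q (u x))]
      · intro q _
        have := (((a3 q).sub (a4 q)).cmul ((2 * σ.ε)⁻¹ * σ.v q i)).1
        convert this using 2
        ring
    rw [e1]
    have iD := ((ish i).sub (ish' i)).sq
    have iP : IB (fun x => (|u (x - σ.ε • ev i)| + |u (x + σ.ε • ev i)|) ^ 2) :=
      ((ish' i).abs.add (ish i).abs).sq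
    have iL : IB (fun x => (2 * σ.ε)⁻¹ * ∑ q, (σ.Ch q (u (x - σ.ε • ev i)) - σ.Ch q (u (x + σ.ε • ev i))) * (σ.v q i * κ q x)) := by
      refine IB.cmul (IB.sum _ fun q => ?_) _
      have := ((a3 q).sub (a4 q)).cmul (σ.v q i)
      convert this using 2
      ring
    have hP : ∫ x, (|u (x - σ.ε • ev i)| + |u (x + σ.ε • ev i)|) ^ 2 ≤ 4 * ∫ x, u x ^ 2 := by
      calc ∫ x, (|u (x - σ.ε • ev i)| + |u (x + σ.ε • ev i)|) ^ 2
          ≤ ∫ x, (2 * (u (x - σ.ε • ev i)) ^ 2 + 2 * (u (x + σ.ε • ev i)) ^ 2) := by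
            refine integral_mono iP.1 (((ish' i).sq.cmul 2).add ((ish i).sq.cmul 2)).1 fun x => ?_
            show (|u (x - σ.ε • ev i)| + |u (x + σ.ε • ev i)|) ^ 2 ≤
              2 * (u (x - σ.ε • ev i)) ^ 2 + 2 * (u (x + σ.ε • ev i)) ^ 2
            rw [← sq_abs (u (x - _)), ← sq_abs (u (x + _))]
            nlinarith [sq_nonneg (|u (x - σ.ε • ev i)| - |u (x + σ.ε • ev i)|)]
        _ = _ := by
            rw [integral_add ((ish' i).sq.cmul 2).1 ((ish i).sq.cmul 2).1, integral_const_mul,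
              integral_const_mul, integral_sub_right_eq_self (fun x => u x ^ 2),
              integral_add_right_eq_self (fun x => u x ^ 2)]
            ring
    calc _ ≤ ∫ x, (σ.γ / (16 * σ.ε ^ 2) * (u (x + σ.ε • ev i) - u (x - σ.ε • ev i)) ^ 2
          + C ^ 2 / σ.γ * (|u (x - σ.ε • ev i)| + |u (x + σ.ε • ev i)|) ^ 2) := by
          refine integral_mono iL.1 ((iD.cmul _).add (iP.cmul _)).1 fun x => ?_
          have b1 := (le_abs_self _).trans (G.s1' i x (u (x - σ.ε • ev i)) (u (x + σ.ε • ev i)))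
          have b2 := young (C := C) (P := |u (x - σ.ε • ev i)| + |u (x + σ.ε • ev i)|) (D := |u (x - σ.ε • ev i) - u (x + σ.ε • ev i)|) hγ hε
          rw [sq_abs] at b2
          have b3 := mul_le_mul_of_nonneg_left b1 (by positivity : 0 ≤ (2 * σ.ε)⁻¹)
          have b4 : (u (x - σ.ε • ev i) - u (x + σ.ε • ev i)) ^ 2 = (u (x + σ.ε • ev i) - u (x - σ.ε • ev i)) ^ 2 := by ring
          rw [b4] at b2
          exact b3.trans b2
      _ ≤ _ := by
          rw [integral_add (iD.cmul _).1 (iP.cmul _).1, integral_const_mul, integral_const_mul]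
          have : C ^ 2 / σ.γ * ∫ x, (|u (x - σ.ε • ev i)| + |u (x + σ.ε • ev i)|) ^ 2 ≤
            C ^ 2 / σ.γ * (4 * ∫ x, u x ^ 2) := mul_le_mul_of_nonneg_left hP (by positivity)
          have e : C ^ 2 / σ.γ * (4 * ∫ x, u x ^ 2) = 4 * C ^ 2 / σ.γ * ∫ x, u x ^ 2 := by ring
          linarith
  calc _ ≤ _ := st1
    _ = _ := st2
    _ ≤ _ := st3
    _ ≤ _ := by
      refine add_le_add le_rfl ?_
      rw [integral_finsetSum _ fun i _ => (IB.sum _ fun q => i5 i q).1]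
      exact Finset.sum_le_sum fun i _ => st4 i

theorem Good.energy_f {C δ : ℝ} (G : σ.Good C δ) {u : (Fin d → ℝ) → ℝ} (hu : IB u) :
    IB (fun x => ∑ i, σ.f i x (u x) / (2 * σ.ε) * (u (x + σ.ε • ev i) - u (x - σ.ε • ev i))) ∧
    ∫ x, ∑ i, σ.f i x (u x) / (2 * σ.ε) * (u (x + σ.ε • ev i) - u (x - σ.ε • ev i))
      ≤ ∑ i, (σ.γ / (16 * σ.ε ^ 2) *
          (∫ x, (u (x + σ.ε • ev i) - u (x - σ.ε • ev i)) ^ 2) + C ^ 2 / σ.γ * ∫ x, u x ^ 2) := by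
  have hε := σ.ε_pos
  have hγ := σ.γ_pos
  have ish : ∀ i : Fin d, IB (fun x => u (x + σ.ε • ev i)) := fun i => hu.shift _
  have ish' : ∀ i : Fin d, IB (fun x => u (x - σ.ε • ev i)) := fun i => hu.shift' _
  have iF : ∀ i, IB (fun x => σ.f i x (u x)) := fun i =>
    IB.of_le (σ.f_cont i) hu (hu.abs.cmul C) (fun x => G.s3 i x (u x))
  have i1 : ∀ i, IB (fun x => σ.f i x (u x) / (2 * σ.ε) * (u (x + σ.ε • ev i) - u (x - σ.ε • ev i))) := by
    intro i
    have := (((iF i).mul ((ish i).sub (ish' i))).cmul (2 * σ.ε)⁻¹)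
    convert this using 2
    ring
  refine ⟨IB.sum _ i1, ?_⟩
  rw [integral_finsetSum _ fun i _ => (i1 i).1]
  refine Finset.sum_le_sum fun i _ => ?_
  have iD := ((ish i).sub (ish' i)).sq
  calc _ ≤ ∫ x, (σ.γ / (16 * σ.ε ^ 2) * (u (x + σ.ε • ev i) - u (x - σ.ε • ev i)) ^ 2
          + C ^ 2 / σ.γ * u x ^ 2) := by
        refine integral_mono (i1 i).1 ((iD.cmul _).add (hu.sq.cmul _)).1 fun x => ?_
        have b2 := young (C := C) (P := |u x|) (D := |u (x + σ.ε • ev i) - u (x - σ.ε • ev i)|) hγ hε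
        rw [sq_abs, sq_abs] at b2
        refine le_trans ?_ b2
        show σ.f i x (u x) / (2 * σ.ε) * (u (x + σ.ε • ev i) - u (x - σ.ε • ev i)) ≤ _
        rw [div_mul_eq_mul_div, div_eq_inv_mul]
        refine mul_le_mul_of_nonneg_left ?_ (by positivity)
        refine (le_abs_self _).trans ?_
        rw [abs_mul]
        exact mul_le_mul_of_nonneg_right (G.s3 i x (u x)) (abs_nonneg _)
    _ = _ := by
        rw [integral_add (iD.cmul _).1 (hu.sq.cmul _).1, integral_const_mul, integral_const_mul]

/-- the Dirichlet form at scale `ε'` -/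
noncomputable def Dir (σ : Scheme d) (u : (Fin d → ℝ) → ℝ) : ℝ :=
  ∑ i, (σ.ε' ^ 2)⁻¹ * ∫ x, (u (x + σ.ε' • ev i) - u x) ^ 2

theorem Dir_nonneg (σ : Scheme d) (u : (Fin d → ℝ) → ℝ) : 0 ≤ σ.Dir u := by
  refine Finset.sum_nonneg fun i _ => mul_nonneg (by positivity) (integral_nonneg fun x => sq_nonneg _)

theorem Good.energy {C δ : ℝ} (G : σ.Good C δ) {u : (Fin d → ℝ) → ℝ} (hu : IB u) :
    ∫ x, u x * σ.jump.gen u x ≤ - (σ.γ / 2) * σ.Dir u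
      + (C + 5 * d * C ^ 2 / σ.γ) * ∫ x, u x ^ 2 := by
  have hε := σ.ε_pos
  have hγ := σ.γ_pos
  obtain ⟨M, hM⟩ := hu.2
  rw [σ.jump.integral_mul_gen hu.1 hu.1.aestronglyMeasurable hM]
  simp_rw [sum_formula]
  have iD2 : ∀ w, IB (D2 u w) := fun w =>
    ((hu.shift w).add (hu.shift' w)).sub (hu.cmul 2)
  have ρc : ∀ q, Continuous (σ.ρ q) := fun q => (σ.ρ_smooth q).continuous
  have ρb : ∀ q, ∃ M, ∀ x, |σ.ρ q x| ≤ M := fun q =>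
    ⟨σ.L, fun x => by rw [abs_of_nonneg (σ.ρ_nonneg q x)]; exact σ.ρ_le q x⟩
  have ic : ∀ q, IB (fun x => σ.c q (u x)) := fun q => by
    have hF : Continuous (fun p : (Fin d → ℝ) × ℝ => σ.c q p.2) := (σ.c_cont q).comp continuous_snd
    refine IB.of_le hF hu (hu.abs.cmul σ.L) (fun x => ?_)
    have h1 := σ.c_lip q (u x) 0
    simpa [σ.c_zero] using h1
  have i3 : IB (fun x => ∑ q, (σ.ε ^ 2)⁻¹ * (σ.ρ q x * σ.c q (u x)) * D2 u (σ.ε • σ.v q) x) := by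
    refine IB.sum _ fun q => ?_
    have := (((ic q).mulc (ρc q) (ρb q)).mul (iD2 (σ.ε • σ.v q))).cmul (σ.ε ^ 2)⁻¹
    convert this using 2
    ring
  have i1 : ∀ (e : ℝ), IB (fun x => σ.γ / (2 * e ^ 2) * u x * ∑ i, D2 u (e • ev i) x) := fun e =>
    (hu.cmul _).mul (IB.sum _ fun i => iD2 _)
  have e1 : ∀ (e : ℝ), ∫ x, σ.γ / (2 * e ^ 2) * u x * ∑ i, D2 u (e • ev i) x
      = ∑ i, - (σ.γ / (2 * e ^ 2)) * ∫ x, (u (x + e • ev i) - u x) ^ 2 := by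
    intro e
    have : ∀ x, σ.γ / (2 * e ^ 2) * u x * ∑ i, D2 u (e • ev i) x
        = σ.γ / (2 * e ^ 2) * ∑ i, u x * D2 u (e • ev i) x := by
      intro x; rw [mul_assoc, Finset.mul_sum]
    simp_rw [this]
    rw [integral_const_mul, integral_finsetSum _ fun i _ => (hu.mul (iD2 (e • ev i))).1, Finset.mul_sum]
    refine Finset.sum_congr rfl fun i _ => ?_
    rw [heat_energy hu]; ring
  obtain ⟨i4, f4⟩ := G.energy_f hu
  have f3 := G.energy_q hu
  rw [integral_add (((i1 _).add (i1 _)).add i3).1 i4.1, integral_add ((i1 _).add (i1 _)).1 i3.1,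
    integral_add (i1 _).1 (i1 _).1, e1, e1]
  have hD : ∑ i, - (σ.γ / (2 * σ.ε' ^ 2)) * ∫ x, (u (x + σ.ε' • ev i) - u x) ^ 2 = - (σ.γ / 2) * σ.Dir u := by
    unfold Dir
    rw [Finset.mul_sum]
    refine Finset.sum_congr rfl fun i _ => ?_
    rw [← mul_assoc]; congr 1; rw [← neg_div, div_eq_mul_inv, mul_inv]; ring
  rw [hD]
  have key : ∀ i : Fin d, - (σ.γ / (2 * σ.ε ^ 2)) * (∫ x, (u (x + σ.ε • ev i) - u x) ^ 2)
      + (σ.γ / (16 * σ.ε ^ 2) *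
          (∫ x, (u (x + σ.ε • ev i) - u (x - σ.ε • ev i)) ^ 2) + 4 * C ^ 2 / σ.γ * ∫ x, u x ^ 2)
      + (σ.γ / (16 * σ.ε ^ 2) *
          (∫ x, (u (x + σ.ε • ev i) - u (x - σ.ε • ev i)) ^ 2) + C ^ 2 / σ.γ * ∫ x, u x ^ 2)
      ≤ 5 * C ^ 2 / σ.γ * ∫ x, u x ^ 2 := by
    intro i
    have h1 := sq_integral_facts hu (σ.ε • ev i)
    have h2 := mul_le_mul_of_nonneg_left h1 (by positivity : 0 ≤ σ.γ / (16 * σ.ε ^ 2))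
    have h3 : σ.γ / (16 * σ.ε ^ 2) * (4 * ∫ x, (u (x + σ.ε • ev i) - u x) ^ 2)
      = (σ.γ / (2 * σ.ε ^ 2)) * (∫ x, (u (x + σ.ε • ev i) - u x) ^ 2) / 2 := by
      field_simp; ring
    have h4 : 4 * C ^ 2 / σ.γ * (∫ x, u x ^ 2) + C ^ 2 / σ.γ * (∫ x, u x ^ 2)
       = 5 * C ^ 2 / σ.γ * ∫ x, u x ^ 2 := by ring
    linarith
  have key2 := Finset.sum_le_sum fun i (_ : i ∈ Finset.univ) => key i
  rw [Finset.sum_add_distrib, Finset.sum_add_distrib, Finset.sum_const, Finset.card_univ, Fintype.card_fin, nsmul_eq_mul] at key2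
  have h5 : (d : ℝ) * (5 * C ^ 2 / σ.γ * ∫ x, u x ^ 2) = 5 * d * C ^ 2 / σ.γ * ∫ x, u x ^ 2 := by ring
  rw [add_mul]
  linarith

/-- the iterates -/
noncomputable def U (σ : Scheme d) (k : ℕ) (u : (Fin d → ℝ) → ℝ) : (Fin d → ℝ) → ℝ :=
  σ.jump.iter σ.h k u

theorem U_IB (σ : Scheme d) (k : ℕ) {u : (Fin d → ℝ) → ℝ} (hu : IB u) : IB (σ.U k u) :=
  ⟨σ.jump.integrable_iter _ _ hu.1, σ.jump.iter_bdd _ _ hu.2⟩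

/-- the growth constant of the energy -/
noncomputable def Ce (d : ℕ) (γ C : ℝ) : ℝ := 1 + 2 * (C + 5 * d * C ^ 2 / γ)

theorem Good.energy_step {C δ : ℝ} (G : σ.Good C δ) {u : (Fin d → ℝ) → ℝ} (hu : IB u) (k : ℕ) :
    (∫ x, σ.U (k + 1) u x ^ 2) + σ.h * (σ.γ * σ.Dir (σ.U k u))
      ≤ (1 + σ.h * Ce d σ.γ C) * ∫ x, σ.U k u x ^ 2 := by
  have hk := σ.U_IB k hu
  have h1 := σ.jump.integral_step_sq σ.h_pos.le G.cfl2 hk.1 hk.2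
  have h2 := G.energy hk
  have h3 := mul_le_mul_of_nonneg_left h2 (by linarith [σ.h_pos] : 0 ≤ 2 * σ.h)
  have e : σ.U (k + 1) u = σ.jump.step σ.h (σ.U k u) := by
    unfold U; rw [JumpData.iter_succ]
  rw [e]
  unfold Ce
  nlinarith

theorem Ce_nonneg {γ C : ℝ} (hγ : 0 < γ) (hC : 0 ≤ C) : 0 ≤ Ce d γ C := by
  unfold Ce; positivity

theorem Good.energy_exp {C δ : ℝ} (G : σ.Good C δ) {u : (Fin d → ℝ) → ℝ} (hu : IB u) (k : ℕ) :
    (∫ x, σ.U k u x ^ 2) ≤ Real.exp (Ce d σ.γ C * (k * σ.h)) * ∫ x, u x ^ 2 := by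
  have hc : 0 ≤ Ce d σ.γ C := Ce_nonneg σ.γ_pos G.C_nonneg
  induction k with
  | zero => simp [U, JumpData.iter_zero]
  | succ k ih =>
    have h1 := G.energy_step hu k
    have h2 : 0 ≤ σ.h * (σ.γ * σ.Dir (σ.U k u)) :=
      mul_nonneg σ.h_pos.le (mul_nonneg σ.γ_pos.le (σ.Dir_nonneg _))
    have h3 : 1 + σ.h * Ce d σ.γ C ≤ Real.exp (Ce d σ.γ C * σ.h) := by
      have := Real.add_one_le_exp (Ce d σ.γ C * σ.h); linarith
    have h4 : 0 ≤ ∫ x, σ.U k u x ^ 2 := integral_nonneg fun x => sq_nonneg _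
    calc ∫ x, σ.U (k + 1) u x ^ 2 ≤ (1 + σ.h * Ce d σ.γ C) * ∫ x, σ.U k u x ^ 2 := by linarith
      _ ≤ Real.exp (Ce d σ.γ C * σ.h) * ∫ x, σ.U k u x ^ 2 := by gcongr
      _ ≤ Real.exp (Ce d σ.γ C * σ.h) * (Real.exp (Ce d σ.γ C * (k * σ.h)) * ∫ x, u x ^ 2) := by gcongr
      _ = _ := by
        rw [← mul_assoc, ← Real.exp_add]; push_cast; ring_nf

theorem Good.energy_growth {C δ T : ℝ} (G : σ.Good C δ) {u : (Fin d → ℝ) → ℝ} (hu : IB u) (k : ℕ)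
    (hk : k * σ.h ≤ T) :
    (∫ x, σ.U k u x ^ 2) + σ.γ * ∑ l ∈ Finset.range k, σ.h * σ.Dir (σ.U l u)
      ≤ (∫ x, u x ^ 2) + (k * σ.h) * (Ce d σ.γ C * (Real.exp (Ce d σ.γ C * T) * ∫ x, u x ^ 2)) := by
  have hc : 0 ≤ Ce d σ.γ C := Ce_nonneg σ.γ_pos G.C_nonneg
  have hh := σ.h_pos
  induction k with
  | zero => simp [U, JumpData.iter_zero]
  | succ k ih =>
    push_cast at hk
    have hk' : k * σ.h ≤ T := by nlinarith
    have ih := ih hk'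
    have h1 := G.energy_step hu k
    rw [Finset.sum_range_succ]
    have h4 : 0 ≤ ∫ x, u x ^ 2 := integral_nonneg fun x => sq_nonneg _
    have h5 : (∫ x, σ.U k u x ^ 2) ≤ Real.exp (Ce d σ.γ C * T) * ∫ x, u x ^ 2 := by
      refine (G.energy_exp hu k).trans ?_
      gcongr
    have h6 : σ.h * Ce d σ.γ C * (∫ x, σ.U k u x ^ 2) ≤ σ.h * Ce d σ.γ C * (Real.exp (Ce d σ.γ C * T) * ∫ x, u x ^ 2) := by
      gcongr
    push_cast
    nlinarith

end Scheme


/-! ## Part 4: Taylor bounds and weak consistency -/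

section Taylor
variable {E V : Type*} [NormedAddCommGroup E] [NormedSpace ℝ E] [NormedAddCommGroup V]
  [NormedSpace ℝ V]

theorem taylor_one {F : E → V} (hF : Differentiable ℝ F) {K : ℝ} (hK : 0 ≤ K)
    (hL : ∀ x y, ‖fderiv ℝ F y - fderiv ℝ F x‖ ≤ K * ‖y - x‖) (x v : E) :
    ‖F (x + v) - F x - fderiv ℝ F x v‖ ≤ K * ‖v‖ ^ 2 := by
  have := Convex.norm_image_sub_le_of_norm_fderiv_le' (𝕜 := ℝ) (f := F) (s := Metric.closedBall x ‖v‖)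
    (φ := fderiv ℝ F x) (C := K * ‖v‖) (x := x) (y := x + v) (fun y _ => hF y)
    (fun y hy => (hL x y).trans (mul_le_mul_of_nonneg_left (by
      simpa [dist_eq_norm] using hy) hK)) (convex_closedBall _ _) (by simp) (by simp)
  simpa [pow_two, mul_assoc] using this

theorem taylor_two {φ : E → ℝ} (hφ : ContDiff ℝ 2 φ) {K : ℝ} (hK : 0 ≤ K)
    (hL : ∀ x y, ‖fderiv ℝ (fderiv ℝ φ) y - fderiv ℝ (fderiv ℝ φ) x‖ ≤ K * ‖y - x‖) (x v : E) :
    |φ (x + v) + φ (x - v) - 2 * φ x - fderiv ℝ (fderiv ℝ φ) x v v| ≤ 2 * K * ‖v‖ ^ 3 := by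
  have hd : Differentiable ℝ φ := hφ.differentiable (by norm_num)
  have hd2 : Differentiable ℝ (fderiv ℝ φ) :=
    (hφ.fderiv_right (m := 1) (by norm_num)).differentiable (by norm_num)
  set B := fderiv ℝ (fderiv ℝ φ) x v v with hB
  set G : ℝ → ℝ := fun t => φ (x + t • v) + φ (x - t • v) - 2 * φ x - t ^ 2 * B with hG
  have hder : ∀ t, HasDerivAt G (fderiv ℝ φ (x + t • v) v - fderiv ℝ φ (x - t • v) v - 2 * t * B) t := by
    intro t
    have h1 : HasDerivAt (fun t : ℝ => x + t • v) v t := by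
      simpa using ((hasDerivAt_id t).smul_const v).const_add x
    have h2 : HasDerivAt (fun t : ℝ => x - t • v) (-v) t := by
      simpa using ((hasDerivAt_id t).smul_const v).const_sub x
    have h3 := (hd (x + t • v)).hasFDerivAt.comp_hasDerivAt t h1
    have h4 := (hd (x - t • v)).hasFDerivAt.comp_hasDerivAt t h2
    have h5 : HasDerivAt (fun t : ℝ => t ^ 2 * B) (2 * t * B) t := by
      simpa using (hasDerivAt_pow 2 t).mul_const B
    have := ((h3.add h4).sub_const (2 * φ x)).sub h5
    have e : fderiv ℝ φ (x + t • v) v - fderiv ℝ φ (x - t • v) v - 2 * t * B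
        = fderiv ℝ φ (x + t • v) v + fderiv ℝ φ (x - t • v) (-v) - 2 * t * B := by
      rw [map_neg]; ring
    rw [e]
    exact this
  have := norm_image_sub_le_of_norm_deriv_le_segment_01' (f := G)
    (f' := fun t => fderiv ℝ φ (x + t • v) v - fderiv ℝ φ (x - t • v) v - 2 * t * B)
    (C := 2 * K * ‖v‖ ^ 3) (fun t _ => (hder t).hasDerivWithinAt) (fun t ht => by
      have a1 := taylor_one hd2 hK hL x (t • v)
      have a2 := taylor_one hd2 hK hL x (-(t • v))
      have b1 := (ContinuousLinearMap.le_opNorm (fderiv ℝ φ (x + t • v) - fderiv ℝ φ x - fderiv ℝ (fderiv ℝ φ) x (t • v)) v).trans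
        (mul_le_mul_of_nonneg_right a1 (norm_nonneg v))
      have b2 := (ContinuousLinearMap.le_opNorm (fderiv ℝ φ (x + -(t • v)) - fderiv ℝ φ x - fderiv ℝ (fderiv ℝ φ) x (-(t • v))) v).trans
        (mul_le_mul_of_nonneg_right a2 (norm_nonneg v))
      have hn : ‖t • v‖ ≤ ‖v‖ := by
        rw [norm_smul, Real.norm_eq_abs, abs_of_nonneg ht.1]
        nlinarith [norm_nonneg v, ht.2]
      have hn2 : K * ‖t • v‖ ^ 2 * ‖v‖ ≤ K * ‖v‖ ^ 2 * ‖v‖ := by gcongr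
      rw [norm_neg] at b2
      have e : fderiv ℝ φ (x + t • v) v - fderiv ℝ φ (x - t • v) v - 2 * t * B
        = (fderiv ℝ φ (x + t • v) - fderiv ℝ φ x - fderiv ℝ (fderiv ℝ φ) x (t • v)) v
          - (fderiv ℝ φ (x + -(t • v)) - fderiv ℝ φ x - fderiv ℝ (fderiv ℝ φ) x (-(t • v))) v := by
        simp [hB, sub_eq_add_neg]; ring
      rw [e]
      refine (norm_sub_le _ _).trans ?_
      nlinarith)
  simpa [hG, ← Real.norm_eq_abs, sub_eq_add_neg, two_mul, add_assoc] using this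

theorem fd_bound {g : E → V} (hg : ContDiff ℝ 2 g) (hc : HasCompactSupport g) :
    ∃ M L : ℝ, 0 ≤ M ∧ 0 ≤ L ∧ (∀ x, ‖g x‖ ≤ M) ∧ (∀ x, ‖fderiv ℝ g x‖ ≤ M) ∧
      ∀ x y, ‖fderiv ℝ g y - fderiv ℝ g x‖ ≤ L * ‖y - x‖ := by
  have h1 : ContDiff ℝ 1 (fderiv ℝ g) := hg.fderiv_right (by norm_num)
  have c1 : HasCompactSupport (fderiv ℝ g) := hc.fderiv ℝ
  obtain ⟨M0, hM0⟩ := hc.exists_bound_of_continuous hg.continuous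
  obtain ⟨M1, hM1⟩ := c1.exists_bound_of_continuous h1.continuous
  obtain ⟨L1, hL1⟩ := ContDiff.lipschitzWith_of_hasCompactSupport c1 h1 (by norm_num)
  have p0 := (norm_nonneg _).trans (hM0 0)
  have p1 := (norm_nonneg _).trans (hM1 0)
  refine ⟨M0 + M1, L1, by linarith, NNReal.coe_nonneg _, fun x => (hM0 x).trans (by linarith),
    fun x => (hM1 x).trans (by linarith), fun x y => ?_⟩
  rw [← dist_eq_norm, ← dist_eq_norm]; exact hL1.dist_le_mul y x

/-- all Taylor bounds for a test function -/
theorem taylor_exists {φ : E → ℝ} (hφ : ContDiff ℝ (⊤ : ℕ∞) φ) (hc : HasCompactSupport φ) :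
    ∃ K, 0 ≤ K ∧ (∀ x, |φ x| ≤ K) ∧ (∀ x, ‖fderiv ℝ φ x‖ ≤ K) ∧
      (∀ x, ‖fderiv ℝ (fderiv ℝ φ) x‖ ≤ K) ∧
      (∀ x v, |φ (x + v) - φ x - fderiv ℝ φ x v| ≤ K * ‖v‖ ^ 2) ∧
      (∀ x v, ‖fderiv ℝ φ (x + v) - fderiv ℝ φ x - fderiv ℝ (fderiv ℝ φ) x v‖ ≤ K * ‖v‖ ^ 2) ∧
      (∀ x v, |φ (x + v) + φ (x - v) - 2 * φ x - fderiv ℝ (fderiv ℝ φ) x v v| ≤ K * ‖v‖ ^ 3) := by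
  have h1 : ContDiff ℝ 2 (fderiv ℝ φ) := hφ.fderiv_right (by norm_cast)
  have hφ2 : ContDiff ℝ 2 φ := hφ.of_le (by norm_cast)
  obtain ⟨M0, L1, p0, q1, hM0, hM1, l1⟩ := fd_bound hφ2 hc
  obtain ⟨M2, L2, p2, q2, -, hM2, l2⟩ := fd_bound h1 (hc.fderiv ℝ)
  have t1 : ∀ x v, ‖φ (x + v) - φ x - fderiv ℝ φ x v‖ ≤ L1 * ‖v‖ ^ 2 :=
    taylor_one (hφ.differentiable (by simp)) q1 l1
  have t2 : ∀ x v, ‖fderiv ℝ φ (x + v) - fderiv ℝ φ x - fderiv ℝ (fderiv ℝ φ) x v‖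
      ≤ L2 * ‖v‖ ^ 2 := taylor_one (h1.differentiable (by norm_num)) q2 l2
  have t3 := taylor_two hφ2 q2 l2
  refine ⟨M0 + M2 + L1 + 2 * L2, by positivity, fun x => ?_, fun x => ?_, fun x => ?_,
    fun x v => ?_, fun x v => ?_, fun x v => ?_⟩
  · exact (hM0 x).trans (by linarith)
  · exact (hM1 x).trans (by linarith)
  · exact (hM2 x).trans (by linarith)
  · exact (t1 x v).trans (mul_le_mul_of_nonneg_right (by linarith) (by positivity))
  · exact (t2 x v).trans (mul_le_mul_of_nonneg_right (by linarith) (by positivity))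
  · exact (t3 x v).trans (mul_le_mul_of_nonneg_right (by linarith) (by positivity))

end Taylor

variable {d : ℕ}

theorem fderiv_eq_sum (φ : (Fin d → ℝ) → ℝ) (x v : Fin d → ℝ) :
    fderiv ℝ φ x v = ∑ i, v i * pd i φ x := by
  conv_lhs => rw [pi_eq_sum_univ' v]
  simp [pd]

theorem pd2_eq {φ : (Fin d → ℝ) → ℝ} (hφ : ContDiff ℝ 2 φ) (i j : Fin d) (x : Fin d → ℝ) :
    pd2 i j φ x = fderiv ℝ (fderiv ℝ φ) x (ev i) (ev j) := by
  have hd2 : Differentiable ℝ (fderiv ℝ φ) :=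
    (hφ.fderiv_right (m := 1) (by norm_num)).differentiable (by norm_num)
  unfold pd2 pd
  rw [fderiv_clm_apply (hd2 x) (differentiableAt_const _)]
  simp [ev]

theorem fderiv2_eq_sum {φ : (Fin d → ℝ) → ℝ} (hφ : ContDiff ℝ 2 φ) (x v w : Fin d → ℝ) :
    fderiv ℝ (fderiv ℝ φ) x v w = ∑ i, ∑ j, v i * w j * pd2 i j φ x := by
  have h1 : fderiv ℝ (fderiv ℝ φ) x v = ∑ i, v i • fderiv ℝ (fderiv ℝ φ) x (ev i) := by
    conv_lhs => rw [pi_eq_sum_univ' v]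
    simp [ev]
  have h2 : ∀ L : (Fin d → ℝ) →L[ℝ] ℝ, L w = ∑ j, w j * L (ev j) := by
    intro L
    conv_lhs => rw [pi_eq_sum_univ' w]
    simp [ev]
  rw [h1, sum_apply]
  refine Finset.sum_congr rfl fun i _ => ?_
  rw [smul_apply, h2, smul_eq_mul, Finset.mul_sum]
  exact Finset.sum_congr rfl fun j _ => by rw [pd2_eq hφ]; ring

theorem norm_ev_le (i : Fin d) : ‖(ev i : Fin d → ℝ)‖ ≤ 1 := by
  rw [pi_norm_le_iff_of_nonneg (by norm_num)]
  intro j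
  unfold ev
  by_cases h : j = i
  · subst h; simp
  · simp [h]

/-- bounds attached to a test function -/
structure TF (φ : (Fin d → ℝ) → ℝ) (K : ℝ) : Prop where
  K_nonneg : 0 ≤ K
  cont : Continuous φ
  bdd : ∃ M, ∀ x, |φ x| ≤ M
  pdc : ∀ i, Continuous (pd i φ)
  pd2c : ∀ i j, Continuous (pd2 i j φ)
  pdb : ∀ i x, |pd i φ x| ≤ K
  pd2b : ∀ i j x, |pd2 i j φ x| ≤ K
  t1 : ∀ x v, |φ (x + v) - φ (x - v) - 2 * ∑ i, v i * pd i φ x| ≤ K * ‖v‖ ^ 2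
  t2 : ∀ x v, |Scheme.D2 φ v x - ∑ i, ∑ j, v i * v j * pd2 i j φ x| ≤ K * ‖v‖ ^ 3

theorem TF.exists {φ : (Fin d → ℝ) → ℝ} (hφ : ContDiff ℝ (⊤ : ℕ∞) φ) (hc : HasCompactSupport φ) :
    ∃ K, TF φ K := by
  obtain ⟨K, hK, b0, b1, b2, t1, t2, t3⟩ := taylor_exists hφ hc
  have h2 : ContDiff ℝ 2 φ := hφ.of_le (by norm_cast)
  have c1 : Continuous (fderiv ℝ φ) := hφ.continuous_fderiv (by simp)
  have c2 : Continuous (fderiv ℝ (fderiv ℝ φ)) :=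
    (h2.fderiv_right (m := 1) (by norm_num)).continuous_fderiv (by norm_num)
  refine ⟨2 * K, by positivity, hφ.continuous, ⟨K, b0⟩, fun i => ?_, fun i j => ?_, fun i x => ?_,
    fun i j x => ?_, fun x v => ?_, fun x v => ?_⟩
  · exact c1.clm_apply continuous_const
  · simp only [funext fun x => pd2_eq h2 i j x]
    exact (c2.clm_apply continuous_const).clm_apply continuous_const
  · have := (ContinuousLinearMap.le_opNorm (fderiv ℝ φ x) (ev i)).trans
      (mul_le_mul (b1 x) (norm_ev_le i) (norm_nonneg _) hK)
    unfold pd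
    rw [← Real.norm_eq_abs]
    exact this.trans (by linarith)
  · rw [pd2_eq h2]
    have := (ContinuousLinearMap.le_opNorm₂ (fderiv ℝ (fderiv ℝ φ) x) (ev i) (ev j))
    rw [← Real.norm_eq_abs]
    have h3 : ‖fderiv ℝ (fderiv ℝ φ) x‖ * ‖(ev i : Fin d → ℝ)‖ * ‖(ev j : Fin d → ℝ)‖ ≤ K * 1 * 1 := by
      gcongr
      · exact b2 x
      · exact norm_ev_le i
      · exact norm_ev_le j
    linarith
  · rw [← fderiv_eq_sum]
    have a1 := t1 x v
    have a2 := t1 x (-v)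
    rw [norm_neg, map_neg, ← sub_eq_add_neg] at a2
    rw [abs_le] at *
    constructor <;> linarith [a1.1, a1.2, a2.1, a2.2]
  · rw [← fderiv2_eq_sum h2]
    refine (t3 x v).trans (mul_le_mul_of_nonneg_right (by linarith) (by positivity))

theorem TF.scale {φ : (Fin d → ℝ) → ℝ} {K : ℝ} (hφ : TF φ K) {R : ℝ} (hR : 1 ≤ R) :
    TF (fun x => φ (R⁻¹ • x)) (K / R) := by
  have hR0 : 0 < R := by linarith
  have hi0 : 0 < R⁻¹ := by positivity
  have hi1 : R⁻¹ ≤ 1 := inv_le_one_of_one_le₀ hR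
  have e1 : ∀ i (ψ : (Fin d → ℝ) → ℝ), pd i (fun x => ψ (R⁻¹ • x)) = fun x => R⁻¹ * pd i ψ (R⁻¹ • x) := by
    intro i ψ; funext x
    unfold pd
    rw [fderiv_comp_smul]; simp
  have e2 : ∀ i j, pd2 i j (fun x => φ (R⁻¹ • x)) = fun x => R⁻¹ ^ 2 * pd2 i j φ (R⁻¹ • x) := by
    intro i j; funext x
    unfold pd2
    rw [e1]
    have := congrFun (e1 i (fun y => R⁻¹ * pd j φ y)) x
    rw [this]
    have e3 : pd i (fun y => R⁻¹ * pd j φ y) (R⁻¹ • x) = R⁻¹ * pd i (pd j φ) (R⁻¹ • x) := by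
      unfold pd
      have := fderiv_const_smul_field (𝕜 := ℝ) (f := fun y => pd j φ y) R⁻¹
      have h2 := congrArg (fun L => L (Pi.single i 1)) (congrFun this (R⁻¹ • x))
      exact h2
    rw [e3]; ring
  have hK := hφ.K_nonneg
  refine ⟨by positivity, by have := hφ.cont; fun_prop, ?_, fun i => ?_, fun i j => ?_, fun i x => ?_,
    fun i j x => ?_, fun x v => ?_, fun x v => ?_⟩
  · obtain ⟨M, hM⟩ := hφ.bdd; exact ⟨M, fun x => hM _⟩
  · rw [e1]; have := hφ.pdc i; fun_prop
  · rw [e2]; have := hφ.pd2c i j; fun_prop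
  · rw [e1, abs_mul, abs_of_pos hi0, div_eq_inv_mul]
    exact mul_le_mul_of_nonneg_left (hφ.pdb i _) hi0.le
  · rw [e2, abs_mul, abs_of_pos (by positivity), div_eq_inv_mul]
    refine mul_le_mul ?_ (hφ.pd2b i j _) (abs_nonneg _) hi0.le
    nlinarith
  · have := hφ.t1 (R⁻¹ • x) (R⁻¹ • v)
    rw [norm_smul, Real.norm_of_nonneg hi0.le] at this
    simp only [e1, smul_add, smul_sub]
    have e4 : ∑ i, v i * (R⁻¹ * pd i φ (R⁻¹ • x)) = ∑ i, (R⁻¹ • v) i * pd i φ (R⁻¹ • x) :=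
      Finset.sum_congr rfl fun i _ => by simp; ring
    rw [e4]
    refine this.trans ?_
    rw [mul_pow, div_eq_mul_inv, ← mul_assoc]
    refine mul_le_mul_of_nonneg_right (mul_le_mul_of_nonneg_left ?_ hK) (by positivity)
    nlinarith
  · have := hφ.t2 (R⁻¹ • x) (R⁻¹ • v)
    rw [norm_smul, Real.norm_of_nonneg hi0.le] at this
    have e4 : ∑ i, ∑ j, v i * v j * pd2 i j (fun x => φ (R⁻¹ • x)) x
        = ∑ i, ∑ j, (R⁻¹ • v) i * (R⁻¹ • v) j * pd2 i j φ (R⁻¹ • x) :=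
      Finset.sum_congr rfl fun i _ => Finset.sum_congr rfl fun j _ => by rw [e2]; simp; ring
    rw [e4]
    have e5 : Scheme.D2 (fun x => φ (R⁻¹ • x)) v x = Scheme.D2 φ (R⁻¹ • v) (R⁻¹ • x) := by
      simp [Scheme.D2, smul_add, smul_sub]
    rw [e5]
    refine this.trans ?_
    rw [mul_pow, div_eq_mul_inv, ← mul_assoc]
    refine mul_le_mul_of_nonneg_right (mul_le_mul_of_nonneg_left ?_ hK) (by positivity)
    have : R⁻¹ ^ 2 ≤ 1 := by nlinarith
    nlinarith


/-! ## Part 5: weak consistency, time equicontinuity -/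

namespace Scheme
variable {d : ℕ} {σ : Scheme d}

/-- diffusion coefficients of the scheme -/
noncomputable def Am (σ : Scheme d) (i j : Fin d) (x : Fin d → ℝ) (r : ℝ) : ℝ :=
  (if i = j then σ.γ * r else 0) + ∑ q, σ.ρ q x * σ.c q r * (σ.v q i * σ.v q j)

/-- the limiting weak form integrand -/
noncomputable def Qs (σ : Scheme d) (φ : (Fin d → ℝ) → ℝ) (x : Fin d → ℝ) (r : ℝ) : ℝ :=
  (∑ i, ∑ j, σ.Am i j x r * pd2 i j φ x) + ∑ i, σ.f i x r * pd i φ x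

/-- consistency constant -/
noncomputable def A1 (d : ℕ) (γ C : ℝ) : ℝ := γ * d + 1 + d * C
/-- size constant -/
noncomputable def A2 (d : ℕ) (γ C : ℝ) : ℝ := d * (d * (γ + C)) + d * C

theorem D2_bound {φ : (Fin d → ℝ) → ℝ} {K : ℝ} (hφ : TF φ K) {ε : ℝ} (hε : 0 < ε) (v x : Fin d → ℝ) :
    |D2 φ (ε • v) x - ε ^ 2 * ∑ i, ∑ j, v i * v j * pd2 i j φ x| ≤ K * ε ^ 3 * ‖v‖ ^ 3 := by
  have h := hφ.t2 x (ε • v)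
  rw [norm_smul, Real.norm_of_nonneg hε.le, mul_pow, ← mul_assoc] at h
  convert h using 3
  rw [Finset.mul_sum]
  refine Finset.sum_congr rfl fun i _ => ?_
  rw [Finset.mul_sum]
  refine Finset.sum_congr rfl fun j _ => ?_
  simp; ring

theorem ev_sum (i : Fin d) (g : Fin d → Fin d → ℝ) :
    ∑ k, ∑ l, (ev i : Fin d → ℝ) k * (ev i : Fin d → ℝ) l * g k l = g i i := by
  rw [Finset.sum_eq_single i]
  · rw [Finset.sum_eq_single i]
    · simp [ev]
    · intro l _ hl; simp [ev, hl]
    · simp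
  · intro k _ hk; simp [ev, hk]
  · simp

theorem D2_ev {φ : (Fin d → ℝ) → ℝ} {K : ℝ} (hφ : TF φ K) {ε : ℝ} (hε : 0 < ε) (i : Fin d) (x : Fin d → ℝ) :
    |D2 φ (ε • ev i) x - ε ^ 2 * pd2 i i φ x| ≤ K * ε ^ 3 := by
  have h := D2_bound hφ hε (ev i) x
  rw [ev_sum i (fun k l => pd2 k l φ x)] at h
  refine h.trans ?_
  have : ‖(ev i : Fin d → ℝ)‖ ^ 3 ≤ 1 := pow_le_one₀ (norm_nonneg _) (norm_ev_le i)
  have := hφ.K_nonneg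
  nlinarith [mul_nonneg this (pow_pos hε 3).le]

theorem Good.consist {C δ : ℝ} (G : σ.Good C δ) {φ : (Fin d → ℝ) → ℝ} {K : ℝ} (hφ : TF φ K)
    (x : Fin d → ℝ) (r : ℝ) :
    |∑ s, σ.jump.F s x r * (φ (x + σ.jump.w s) - φ x) - σ.Qs φ x r|
      ≤ K * (A1 d σ.γ C * δ) * |r| := by
  have hγ := σ.γ_pos
  have hε := σ.ε_pos
  have hε' := σ.ε'_pos
  have hK := hφ.K_nonneg
  have hC := G.C_nonneg
  have hδ := G.δ_nonneg
  rw [sum_formula]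
  have heat : ∀ ε, 0 < ε → ε ≤ δ → |σ.γ / (2 * ε ^ 2) * r * ∑ i, D2 φ (ε • ev i) x
      - ∑ i : Fin d, σ.γ / 2 * r * pd2 i i φ x| ≤ K * (σ.γ / 2 * d * δ) * |r| := by
    intro ε hε hεδ
    rw [Finset.mul_sum, ← Finset.sum_sub_distrib]
    calc |∑ i : Fin d, (σ.γ / (2 * ε ^ 2) * r * D2 φ (ε • ev i) x - σ.γ / 2 * r * pd2 i i φ x)|
        ≤ ∑ i : Fin d, |σ.γ / (2 * ε ^ 2) * r * D2 φ (ε • ev i) x - σ.γ / 2 * r * pd2 i i φ x| :=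
          Finset.abs_sum_le_sum_abs _ _
      _ ≤ ∑ i : Fin d, K * (σ.γ / 2 * δ) * |r| := by
          refine Finset.sum_le_sum fun i _ => ?_
          have e : σ.γ / (2 * ε ^ 2) * r * D2 φ (ε • ev i) x - σ.γ / 2 * r * pd2 i i φ x
              = σ.γ / (2 * ε ^ 2) * r * (D2 φ (ε • ev i) x - ε ^ 2 * pd2 i i φ x) := by
            field_simp
          rw [e, abs_mul, abs_mul, abs_of_pos (by positivity : 0 < σ.γ / (2 * ε ^ 2))]
          calc _ ≤ σ.γ / (2 * ε ^ 2) * |r| * (K * ε ^ 3) := by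
                gcongr
                exact D2_ev hφ hε i x
            _ = K * (σ.γ / 2 * ε) * |r| := by field_simp
            _ ≤ _ := by gcongr
      _ = _ := by
          rw [Finset.sum_const, Finset.card_univ, Fintype.card_fin, nsmul_eq_mul]; ring
  have t1 := heat σ.ε hε G.ε_le
  have t2 := heat σ.ε' hε' G.ε'_le
  have t3 : |∑ q, (σ.ε ^ 2)⁻¹ * (σ.ρ q x * σ.c q r) * D2 φ (σ.ε • σ.v q) x
      - ∑ q, σ.ρ q x * σ.c q r * ∑ i, ∑ j, σ.v q i * σ.v q j * pd2 i j φ x| ≤ K * δ * |r| := by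
    rw [← Finset.sum_sub_distrib]
    calc _ ≤ ∑ q, |(σ.ε ^ 2)⁻¹ * (σ.ρ q x * σ.c q r) * D2 φ (σ.ε • σ.v q) x
        - σ.ρ q x * σ.c q r * ∑ i, ∑ j, σ.v q i * σ.v q j * pd2 i j φ x| :=
          Finset.abs_sum_le_sum_abs _ _
      _ ≤ ∑ q, K * (σ.ε * (σ.ρ q x * |σ.c q r| * ‖σ.v q‖ ^ 3)) := by
          refine Finset.sum_le_sum fun q _ => ?_
          have e : (σ.ε ^ 2)⁻¹ * (σ.ρ q x * σ.c q r) * D2 φ (σ.ε • σ.v q) x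
            - σ.ρ q x * σ.c q r * ∑ i, ∑ j, σ.v q i * σ.v q j * pd2 i j φ x
            = (σ.ε ^ 2)⁻¹ * (σ.ρ q x * σ.c q r) * (D2 φ (σ.ε • σ.v q) x
              - σ.ε ^ 2 * ∑ i, ∑ j, σ.v q i * σ.v q j * pd2 i j φ x) := by
            field_simp
          have hρ := σ.ρ_nonneg q x
          rw [e, abs_mul, abs_mul, abs_mul, abs_of_nonneg hρ,
            abs_of_pos (by positivity : 0 < (σ.ε ^ 2)⁻¹)]
          calc _ ≤ (σ.ε ^ 2)⁻¹ * (σ.ρ q x * |σ.c q r|) * (K * σ.ε ^ 3 * ‖σ.v q‖ ^ 3) := by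
                gcongr
                exact D2_bound hφ hε _ x
            _ = _ := by field_simp
      _ = K * (σ.ε * ∑ q, σ.ρ q x * |σ.c q r| * ‖σ.v q‖ ^ 3) := by
          rw [Finset.mul_sum, Finset.mul_sum]
      _ ≤ K * (δ * |r|) := mul_le_mul_of_nonneg_left (G.s5 x r) hK
      _ = _ := by ring
  have t4 : |∑ i, σ.f i x r / (2 * σ.ε) * (φ (x + σ.ε • ev i) - φ (x - σ.ε • ev i))
      - ∑ i, σ.f i x r * pd i φ x| ≤ K * (d * C * δ) * |r| := by
    rw [← Finset.sum_sub_distrib]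
    calc _ ≤ ∑ i, |σ.f i x r / (2 * σ.ε) * (φ (x + σ.ε • ev i) - φ (x - σ.ε • ev i))
          - σ.f i x r * pd i φ x| := Finset.abs_sum_le_sum_abs _ _
      _ ≤ ∑ i : Fin d, K * (C * δ) * |r| := by
          refine Finset.sum_le_sum fun i _ => ?_
          have h := hφ.t1 x (σ.ε • ev i)
          have e0 : ∑ j, (σ.ε • ev i : Fin d → ℝ) j * pd j φ x = σ.ε * pd i φ x := by
            rw [Finset.sum_eq_single i]
            · simp [ev]
            · intro l _ hl; simp [ev, hl]
            · simp
          rw [e0, norm_smul, Real.norm_of_nonneg hε.le] at h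
          have hn : σ.ε * ‖(ev i : Fin d → ℝ)‖ ≤ σ.ε := by nlinarith [norm_ev_le i]
          have e : σ.f i x r / (2 * σ.ε) * (φ (x + σ.ε • ev i) - φ (x - σ.ε • ev i))
              - σ.f i x r * pd i φ x = σ.f i x r / (2 * σ.ε) *
              (φ (x + σ.ε • ev i) - φ (x - σ.ε • ev i) - 2 * (σ.ε * pd i φ x)) := by
            field_simp
          rw [e, abs_mul, abs_div, abs_of_pos (by positivity : 0 < 2 * σ.ε)]
          calc _ ≤ C * |r| / (2 * σ.ε) * (K * σ.ε ^ 2) := by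
                gcongr
                · exact G.s3 i x r
                · refine h.trans ?_
                  gcongr
            _ = K * (C * σ.ε) * |r| / 2 := by field_simp
            _ ≤ K * (C * σ.ε) * |r| := by
                have : 0 ≤ K * (C * σ.ε) * |r| := by positivity
                linarith
            _ ≤ _ := by gcongr; exact G.ε_le
      _ = _ := by
          rw [Finset.sum_const, Finset.card_univ, Fintype.card_fin, nsmul_eq_mul]; ring
  have eQ : σ.Qs φ x r = (∑ i : Fin d, σ.γ / 2 * r * pd2 i i φ x) + (∑ i : Fin d, σ.γ / 2 * r * pd2 i i φ x)
      + (∑ q, σ.ρ q x * σ.c q r * ∑ i, ∑ j, σ.v q i * σ.v q j * pd2 i j φ x)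
      + ∑ i, σ.f i x r * pd i φ x := by
    unfold Qs Am
    congr 1
    simp only [add_mul, Finset.sum_add_distrib]
    congr 1
    · rw [← Finset.sum_add_distrib]
      refine Finset.sum_congr rfl fun i _ => ?_
      simp; ring
    · simp only [Finset.mul_sum, Finset.sum_mul]
      rw [Finset.sum_comm_cycle]
      refine Finset.sum_congr rfl fun q _ => Finset.sum_congr rfl fun i _ =>
        Finset.sum_congr rfl fun j _ => by ring
  rw [eQ]
  unfold A1
  rw [abs_le] at *
  constructor <;> linarith [t1.1, t1.2, t2.1, t2.2, t3.1, t3.2, t4.1, t4.2]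

theorem Good.Am_le {C δ : ℝ} (G : σ.Good C δ) (i j : Fin d) (x : Fin d → ℝ) (r : ℝ) :
    |σ.Am i j x r| ≤ (σ.γ + C) * |r| := by
  have hγ := σ.γ_pos
  unfold Am
  refine (abs_add_le _ _).trans ?_
  rw [add_mul]
  refine add_le_add ?_ (G.s2 i j x r)
  split_ifs
  · rw [abs_mul, abs_of_pos hγ]
  · simp; positivity

theorem Good.Qs_le {C δ : ℝ} (G : σ.Good C δ) {φ : (Fin d → ℝ) → ℝ} {K : ℝ} (hφ : TF φ K)
    (x : Fin d → ℝ) (r : ℝ) : |σ.Qs φ x r| ≤ K * A2 d σ.γ C * |r| := by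
  have hγ := σ.γ_pos
  have hK := hφ.K_nonneg
  have hC := G.C_nonneg
  unfold Qs
  calc _ ≤ |∑ i, ∑ j, σ.Am i j x r * pd2 i j φ x| + |∑ i, σ.f i x r * pd i φ x| := abs_add_le _ _
    _ ≤ (∑ i : Fin d, ∑ j : Fin d, (σ.γ + C) * |r| * K) + ∑ i : Fin d, C * |r| * K := by
        refine add_le_add ?_ ?_
        · refine (Finset.abs_sum_le_sum_abs _ _).trans (Finset.sum_le_sum fun i _ => ?_)
          refine (Finset.abs_sum_le_sum_abs _ _).trans (Finset.sum_le_sum fun j _ => ?_)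
          rw [abs_mul]
          exact mul_le_mul (G.Am_le i j x r) (hφ.pd2b i j x) (abs_nonneg _) (by positivity)
        · refine (Finset.abs_sum_le_sum_abs _ _).trans (Finset.sum_le_sum fun i _ => ?_)
          rw [abs_mul]
          exact mul_le_mul (G.s3 i x r) (hφ.pdb i x) (abs_nonneg _) (by positivity)
    _ = _ := by
        simp only [Finset.sum_const, Finset.card_univ, Fintype.card_fin, nsmul_eq_mul]
        unfold A2; ring

theorem Am_cont (σ : Scheme d) (i j : Fin d) : Continuous (fun p : (Fin d → ℝ) × ℝ => σ.Am i j p.1 p.2) := by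
  unfold Am
  refine Continuous.add ?_ (continuous_finsetSum _ fun q _ => ?_)
  · split_ifs <;> fun_prop
  · have h1 := (σ.ρ_smooth q).continuous
    have h2 := σ.c_cont q
    fun_prop

theorem Qs_cont (σ : Scheme d) {φ : (Fin d → ℝ) → ℝ} {K : ℝ} (hφ : TF φ K) :
    Continuous (fun p : (Fin d → ℝ) × ℝ => σ.Qs φ p.1 p.2) := by
  unfold Qs
  refine Continuous.add (continuous_finsetSum _ fun i _ => continuous_finsetSum _ fun j _ => ?_)
    (continuous_finsetSum _ fun i _ => ?_)
  · exact (σ.Am_cont i j).mul ((hφ.pd2c i j).comp continuous_fst)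
  · exact (σ.f_cont i).mul ((hφ.pdc i).comp continuous_fst)

theorem integrable_comp_le {F : (Fin d → ℝ) × ℝ → ℝ} (hF : Continuous F) {A : ℝ}
    (hA : ∀ x r, |F (x, r)| ≤ A * |r|) {u : (Fin d → ℝ) → ℝ} (hu : Integrable u) :
    Integrable (fun x => F (x, u x)) := by
  refine (hu.abs.const_mul A).mono' ?_ (Eventually.of_forall fun x => ?_)
  · exact hF.comp_aestronglyMeasurable
      (aestronglyMeasurable_id.prodMk hu.aestronglyMeasurable)
  · exact hA x (u x)

theorem Good.gen_consist {C δ : ℝ} (G : σ.Good C δ) {φ : (Fin d → ℝ) → ℝ} {K : ℝ} (hφ : TF φ K)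
    {u : (Fin d → ℝ) → ℝ} (hu : Integrable u) :
    |(∫ x, φ x * σ.jump.gen u x) - ∫ x, σ.Qs φ x (u x)| ≤ K * (A1 d σ.γ C * δ) * ∫ x, |u x| := by
  obtain ⟨M, hM⟩ := hφ.bdd
  rw [σ.jump.integral_mul_gen hu hφ.cont.aestronglyMeasurable hM]
  have i2 : Integrable (fun x => σ.Qs φ x (u x)) :=
    integrable_comp_le (σ.Qs_cont hφ) (fun x r => G.Qs_le hφ x r) hu
  have i1 : Integrable (fun x => ∑ s, σ.jump.F s x (u x) * (φ (x + σ.jump.w s) - φ x)) := by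
    refine integrable_finsetSum _ fun s _ => ?_
    refine (σ.jump.integrable_F s hu).mul_bdd (c := M + M) ?_ (Eventually.of_forall fun x => ?_)
    · have := hφ.cont
      exact (by fun_prop : Continuous fun x => φ (x + σ.jump.w s) - φ x).aestronglyMeasurable
    · rw [Real.norm_eq_abs]
      exact (abs_sub _ _).trans (add_le_add (hM _) (hM _))
  rw [← integral_sub i1 i2, ← integral_const_mul, ← Real.norm_eq_abs]
  refine norm_integral_le_of_norm_le (hu.abs.const_mul _) (Eventually.of_forall fun x => ?_)
  exact G.consist hφ x (u x)

theorem Good.gen_le {C δ : ℝ} (G : σ.Good C δ) {φ : (Fin d → ℝ) → ℝ} {K : ℝ} (hφ : TF φ K)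
    {u : (Fin d → ℝ) → ℝ} (hu : Integrable u) :
    |∫ x, φ x * σ.jump.gen u x| ≤ K * (A1 d σ.γ C * δ + A2 d σ.γ C) * ∫ x, |u x| := by
  have h1 := G.gen_consist hφ hu
  have h2 : |∫ x, σ.Qs φ x (u x)| ≤ K * A2 d σ.γ C * ∫ x, |u x| := by
    rw [← integral_const_mul, ← Real.norm_eq_abs]
    refine norm_integral_le_of_norm_le (hu.abs.const_mul _) (Eventually.of_forall fun x => ?_)
    exact G.Qs_le hφ x (u x)
  have := abs_sub_abs_le_abs_sub (∫ x, φ x * σ.jump.gen u x) (∫ x, σ.Qs φ x (u x))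
  nlinarith

theorem Good.U_weak {C δ : ℝ} (G : σ.Good C δ) {φ : (Fin d → ℝ) → ℝ} {K : ℝ} (hφ : TF φ K)
    {u : (Fin d → ℝ) → ℝ} (hu : Integrable u) (k : ℕ) :
    |(∫ x, φ x * σ.U k u x) - ∫ x, φ x * u x|
      ≤ k * σ.h * (K * (A1 d σ.γ C * δ + A2 d σ.γ C) * ∫ x, |u x|) := by
  obtain ⟨M, hM⟩ := hφ.bdd
  unfold U
  rw [σ.jump.integral_mul_iter σ.h hu hφ.cont.aestronglyMeasurable hM k, add_sub_cancel_left]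
  have hA : 0 ≤ K * (A1 d σ.γ C * δ + A2 d σ.γ C) := by
    have := σ.γ_pos; have := G.C_nonneg; have := hφ.K_nonneg; have := G.δ_nonneg
    unfold A1 A2; positivity
  calc _ ≤ ∑ l ∈ Finset.range k, |σ.h * ∫ x, φ x * σ.jump.gen (σ.jump.iter σ.h l u) x| :=
        Finset.abs_sum_le_sum_abs _ _
    _ ≤ ∑ l ∈ Finset.range k, σ.h * (K * (A1 d σ.γ C * δ + A2 d σ.γ C) * ∫ x, |u x|) := by
        refine Finset.sum_le_sum fun l _ => ?_
        rw [abs_mul, abs_of_pos σ.h_pos]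
        refine mul_le_mul_of_nonneg_left ?_ σ.h_pos.le
        refine (G.gen_le hφ (σ.jump.integrable_iter _ l hu)).trans ?_
        exact mul_le_mul_of_nonneg_left (σ.jump.iter_l1 σ.h_pos.le G.cfl1 l hu) hA
    _ = _ := by rw [Finset.sum_const, Finset.card_range, nsmul_eq_mul]; ring

end Scheme


/-! ## Part 6: density of test functions and time equicontinuity -/

theorem l1_tri {d : ℕ} {f g h : (Fin d → ℝ) → ℝ} (hf : Integrable f) (hg : Integrable g)
    (hh : Integrable h) : ∫ x, |f x - h x| ≤ (∫ x, |f x - g x|) + ∫ x, |g x - h x| := by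
  rw [← integral_add (hf.fsub hg).abs (hg.fsub hh).abs]
  exact integral_mono (hf.fsub hh).abs ((hf.fsub hg).abs.add (hg.fsub hh).abs)
    fun x => abs_sub_le _ _ _

theorem exists_cutoff (d : ℕ) : ∃ χ : (Fin d → ℝ) → ℝ, ContDiff ℝ (⊤ : ℕ∞) χ ∧ HasCompactSupport χ ∧
    (∀ x, 0 ≤ χ x) ∧ (∀ x, χ x ≤ 1) ∧ (∀ x, ‖x‖ ≤ 1 → χ x = 1) ∧ (∀ x, 2 ≤ ‖x‖ → χ x = 0) := by
  let f : ContDiffBump (0 : Fin d → ℝ) := ⟨1, 2, by norm_num, by norm_num⟩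
  refine ⟨f, f.contDiff, f.hasCompactSupport, fun x => f.nonneg, fun x => f.le_one, fun x hx => ?_,
    fun x hx => ?_⟩
  · exact f.one_of_mem_closedBall (by simpa using hx)
  · exact f.zero_of_le_dist (by simpa using hx)

theorem contDiff_scale {d : ℕ} {χ : (Fin d → ℝ) → ℝ} (h : ContDiff ℝ (⊤ : ℕ∞) χ) (R : ℝ) :
    ContDiff ℝ (⊤ : ℕ∞) (fun x => χ (R⁻¹ • x)) := by
  exact h.comp (contDiff_id.const_smul _)

theorem hcs_of_zero {d : ℕ} {χ : (Fin d → ℝ) → ℝ} {R : ℝ} (h : ∀ x, R ≤ ‖x‖ → χ x = 0) :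
    HasCompactSupport χ := by
  refine HasCompactSupport.intro (isCompact_closedBall (0 : Fin d → ℝ) R) fun x hx => h x ?_
  simp at hx; exact hx.le

theorem exists_test_approx {d : ℕ} {g : (Fin d → ℝ) → ℝ} (hg : Integrable g) (hg0 : ∀ x, 0 ≤ g x)
    {η : ℝ} (hη : 0 < η) :
    ∃ w : (Fin d → ℝ) → ℝ, ContDiff ℝ (⊤ : ℕ∞) w ∧ HasCompactSupport w ∧ (∀ x, 0 ≤ w x) ∧
      Integrable w ∧ ∫ x, |g x - w x| ≤ η := by
  obtain ⟨g1, hc1, hl1, hcont1, hi1⟩ := hg.exists_hasCompactSupport_integral_sub_le (half_pos hη)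
  set p : (Fin d → ℝ) → ℝ := fun x => max (g1 x) 0 with hp
  have hpc : Continuous p := hcont1.max continuous_const
  have hps : HasCompactSupport p := hc1.comp_left (g := fun r => max r 0) (by simp)
  have hpi : Integrable p := hpc.integrable_of_hasCompactSupport hps
  have hpl : ∫ x, |g x - p x| ≤ η / 2 := by
    refine le_trans (integral_mono (hg.fsub hpi).abs (hg.fsub hi1).norm fun x => ?_) hl1
    simp only [hp, Real.norm_eq_abs]
    have := hg0 x
    rcases le_total (g1 x) 0 with h | h
    · rw [max_eq_right h, abs_of_nonneg (by linarith), abs_of_nonneg (by linarith)]; linarith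
    · rw [max_eq_left h]
  -- radius
  obtain ⟨R, hR1, hR⟩ : ∃ R : ℝ, 1 ≤ R ∧ ∀ x, R < ‖x‖ → p x = 0 := by
    obtain ⟨R, hR⟩ := hps.isCompact.isBounded.subset_closedBall (0 : Fin d → ℝ)
    refine ⟨max R 1, le_max_right _ _, fun x hx => ?_⟩
    by_contra hne
    have := hR (subset_tsupport p hne)
    simp at this
    linarith [le_max_left R 1]
  have hR0 : 0 < R := by linarith
  obtain ⟨χ, χs, -, χ0, χ1, χin, χout⟩ := exists_cutoff d
  set V : ℝ := volume.real (Metric.closedBall (0 : Fin d → ℝ) (2 * R)) with hV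
  have hV0 : 0 ≤ V := measureReal_nonneg
  set e : ℝ := η / (4 * (V + 1)) with he
  have he0 : 0 < e := by positivity
  obtain ⟨q, hq, hqd⟩ := (hpc.uniformContinuous_of_tendsto_cocompact
    (hps.is_zero_at_infty)).exists_contDiff_dist_le he0
  refine ⟨fun x => χ (R⁻¹ • x) * (q x + e), ?_, ?_, ?_, ?_, ?_⟩
  · exact (contDiff_scale χs R).mul (hq.add contDiff_const)
  · refine hcs_of_zero (R := 2 * R) fun x hx => ?_
    rw [χout, zero_mul]
    rw [norm_smul, norm_inv, Real.norm_of_nonneg hR0.le, inv_mul_eq_div, le_div_iff₀ hR0]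
    exact hx
  · intro x
    have := hqd x
    rw [Real.dist_eq, abs_lt] at this
    have h2 : 0 ≤ p x := le_max_right _ _
    exact mul_nonneg (χ0 _) (by linarith)
  · refine Continuous.integrable_of_hasCompactSupport ?_ ?_
    · exact ((contDiff_scale χs R).mul (hq.add contDiff_const)).continuous
    · refine hcs_of_zero (R := 2 * R) fun x hx => ?_
      rw [χout, zero_mul]
      rw [norm_smul, norm_inv, Real.norm_of_nonneg hR0.le, inv_mul_eq_div, le_div_iff₀ hR0]
      exact hx
  · have hwi : Integrable (fun x => χ (R⁻¹ • x) * (q x + e)) := by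
      refine Continuous.integrable_of_hasCompactSupport ?_ ?_
      · exact ((contDiff_scale χs R).mul (hq.add contDiff_const)).continuous
      · refine hcs_of_zero (R := 2 * R) fun x hx => ?_
        rw [χout, zero_mul]
        rw [norm_smul, norm_inv, Real.norm_of_nonneg hR0.le, inv_mul_eq_div, le_div_iff₀ hR0]
        exact hx
    have hpt : ∀ x, |p x - χ (R⁻¹ • x) * (q x + e)|
        ≤ (Metric.closedBall (0 : Fin d → ℝ) (2 * R)).indicator (fun _ => 2 * e) x := by
      intro x
      have h1 := hqd x
      rw [Real.dist_eq, abs_lt] at h1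
      by_cases hx : ‖x‖ ≤ R
      · rw [Set.indicator_of_mem (by simp; linarith), χin, one_mul, abs_le]
        · constructor <;> linarith
        · rw [norm_smul, norm_inv, Real.norm_of_nonneg hR0.le, inv_mul_eq_div, div_le_iff₀ hR0]
          linarith
      · push Not at hx
        rw [hR x hx] at h1 ⊢
        by_cases hx2 : ‖x‖ ≤ 2 * R
        · rw [Set.indicator_of_mem (by simpa using hx2), abs_le]
          have := χ0 (R⁻¹ • x)
          have := χ1 (R⁻¹ • x)
          constructor <;> nlinarith
        · rw [Set.indicator_of_notMem (by simpa using hx2), χout]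
          · simp
          · push Not at hx2
            rw [norm_smul, norm_inv, Real.norm_of_nonneg hR0.le, inv_mul_eq_div, le_div_iff₀ hR0]
            exact hx2.le
    have hii : Integrable ((Metric.closedBall (0 : Fin d → ℝ) (2 * R)).indicator (fun _ => 2 * e)) :=
      (integrable_indicator_iff Metric.isClosed_closedBall.measurableSet).2
        (integrableOn_const (measure_closedBall_lt_top).ne)
    have h3 : ∫ x, |p x - χ (R⁻¹ • x) * (q x + e)| ≤ η / 2 := by
      calc _ ≤ ∫ x, (Metric.closedBall (0 : Fin d → ℝ) (2 * R)).indicator (fun _ => 2 * e) x :=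
            integral_mono (hpi.fsub hwi).abs hii hpt
        _ = V * (2 * e) := by
            rw [integral_indicator Metric.isClosed_closedBall.measurableSet, setIntegral_const]
            simp [hV]
        _ ≤ (V + 1) * (2 * e) := by nlinarith
        _ = η / 2 := by rw [he]; field_simp; norm_num
    calc ∫ x, |g x - χ (R⁻¹ • x) * (q x + e)|
        ≤ ∫ x, (|g x - p x| + |p x - χ (R⁻¹ • x) * (q x + e)|) :=
          integral_mono (hg.fsub hwi).abs ((hg.fsub hpi).abs.add (hpi.fsub hwi).abs)
            fun x => abs_sub_le _ _ _
      _ = (∫ x, |g x - p x|) + ∫ x, |p x - χ (R⁻¹ • x) * (q x + e)| :=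
          integral_add (hg.fsub hpi).abs (hpi.fsub hwi).abs
      _ ≤ η := by linarith

namespace Scheme
variable {d : ℕ} {σ : Scheme d}

theorem IB_of_test {w : (Fin d → ℝ) → ℝ} (hw : Continuous w) (hc : HasCompactSupport w) : IB w :=
  ⟨hw.integrable_of_hasCompactSupport hc, hc.exists_bound_of_continuous hw⟩

theorem U_integrable (σ : Scheme d) (k : ℕ) {u : (Fin d → ℝ) → ℝ} (hu : Integrable u) :
    Integrable (σ.U k u) := σ.jump.integrable_iter _ _ hu

theorem Good.U_contr {C δ : ℝ} (G : σ.Good C δ) (k : ℕ) {u v : (Fin d → ℝ) → ℝ} (hu : Integrable u)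
    (hv : Integrable v) : ∫ x, |σ.U k u x - σ.U k v x| ≤ ∫ x, |u x - v x| :=
  σ.jump.iter_contr σ.h_pos.le G.cfl1 k hu hv

theorem Good.U_nonneg {C δ : ℝ} (G : σ.Good C δ) (k : ℕ) {u : (Fin d → ℝ) → ℝ} (hu : ∀ x, 0 ≤ u x)
    (x : Fin d → ℝ) : 0 ≤ σ.U k u x := σ.jump.iter_nonneg σ.h_pos.le G.cfl1 k hu x

theorem U_mass (σ : Scheme d) (k : ℕ) {u : (Fin d → ℝ) → ℝ} (hu : Integrable u) :
    ∫ x, σ.U k u x = ∫ x, u x := σ.jump.integral_iter _ k hu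

theorem U_add (σ : Scheme d) (k l : ℕ) (u : (Fin d → ℝ) → ℝ) : σ.U (k + l) u = σ.U k (σ.U l u) :=
  σ.jump.iter_add _ _ _ _

/-- time equicontinuity for test functions -/
theorem time_test (γ C : ℝ) (hγ : 0 < γ) (hC : 0 ≤ C) {w : (Fin d → ℝ) → ℝ}
    (hw : ContDiff ℝ (⊤ : ℕ∞) w) (hc : HasCompactSupport w)
    (hw0 : ∀ x, 0 ≤ w x) {η : ℝ} (hη : 0 < η) :
    ∃ τ, 0 < τ ∧ ∀ (σ : Scheme d) (δ : ℝ), σ.Good C δ → δ ≤ 1 → σ.γ = γ → ∀ k : ℕ, k * σ.h ≤ τ →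
      ∫ x, |σ.U k w x - w x| ≤ η := by
  obtain ⟨K, hK⟩ := TF.exists hw hc
  have hIB := IB_of_test hw.continuous hc
  have hK0 := hK.K_nonneg
  have hCe : 0 ≤ Ce d γ C := Ce_nonneg hγ hC
  set B : ℝ := Ce d γ C * (Real.exp (Ce d γ C * 1) * ∫ x, w x ^ 2)
    + 2 * (K * (A1 d γ C * 1 + A2 d γ C) * ∫ x, |w x|) with hB
  have hA1 : 0 ≤ A1 d γ C := by unfold A1; positivity
  have hA2 : 0 ≤ A2 d γ C := by unfold A2; positivity
  have hw2 : 0 ≤ ∫ x, w x ^ 2 := integral_nonneg fun x => sq_nonneg _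
  have hw1 : 0 ≤ ∫ x, |w x| := integral_nonneg fun x => abs_nonneg _
  have hB0 : 0 ≤ B := by positivity
  set V : ℝ := volume.real (tsupport w) with hV
  have hV0 : 0 ≤ V := measureReal_nonneg
  set μ : ℝ := η / (2 * (V + 1)) with hμ
  have hμ0 : 0 < μ := by positivity
  refine ⟨min 1 (η * μ / (2 * (B + 1))), by positivity, fun σ δ G hδ1 hσγ k hk => ?_⟩
  have hk1 : k * σ.h ≤ 1 := hk.trans (min_le_left _ _)
  have hk2 : k * σ.h ≤ η * μ / (2 * (B + 1)) := hk.trans (min_le_right _ _)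
  have hkh : 0 ≤ k * σ.h := mul_nonneg (Nat.cast_nonneg _) σ.h_pos.le
  have hU := σ.U_IB k hIB
  have e1 := G.energy_growth hIB k hk1
  have e2 := G.U_weak hK hIB.1 k
  have e3 : 0 ≤ σ.γ * ∑ l ∈ Finset.range k, σ.h * σ.Dir (σ.U l w) :=
    mul_nonneg σ.γ_pos.le (Finset.sum_nonneg fun l _ => mul_nonneg σ.h_pos.le (σ.Dir_nonneg _))
  rw [hσγ] at e1 e2
  have e4 : k * σ.h * (K * (A1 d γ C * δ + A2 d γ C) * ∫ x, |w x|)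
      ≤ k * σ.h * (K * (A1 d γ C * 1 + A2 d γ C) * ∫ x, |w x|) := by gcongr
  have sq : ∫ x, (σ.U k w x - w x) ^ 2 ≤ k * σ.h * B := by
    have : ∫ x, (σ.U k w x - w x) ^ 2
        = (∫ x, σ.U k w x ^ 2) - 2 * (∫ x, w x * σ.U k w x) + ∫ x, w x ^ 2 := by
      rw [← integral_const_mul, ← integral_sub hU.sq.1 ((hIB.mul hU).cmul 2).1,
        ← integral_add (hU.sq.sub ((hIB.mul hU).cmul 2)).1 hIB.sq.1]
      refine integral_congr_ae (Eventually.of_forall fun x => ?_)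
      simp only; ring
    rw [this]
    have e5 : ∫ x, w x * w x = ∫ x, w x ^ 2 := by simp only [pow_two]
    rw [e5] at e2
    have := abs_le.1 (e2.trans e4)
    rw [hσγ] at e3
    rw [hB]
    nlinarith [this.1]
  have hts : MeasurableSet (tsupport w) := (isClosed_tsupport w).measurableSet
  have hii : Integrable ((tsupport w).indicator (fun _ => μ)) :=
    (integrable_indicator_iff hts).2 (integrableOn_const hc.isCompact.measure_lt_top.ne)
  have hd := hU.sub hIB
  have pt : ∀ x, |σ.U k w x - w x| ≤ (σ.U k w x - w x) + ((tsupport w).indicator (fun _ => μ) x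
      + μ⁻¹ * (σ.U k w x - w x) ^ 2) := by
    intro x
    have hU0 := G.U_nonneg k hw0 x
    by_cases hx : x ∈ tsupport w
    · rw [Set.indicator_of_mem hx]
      set a := σ.U k w x - w x
      have h1 : 2 * |a| ≤ μ + μ⁻¹ * a ^ 2 := by
        have : 0 ≤ μ⁻¹ * (|a| - μ) ^ 2 := by positivity
        have h2 : μ⁻¹ * (|a| - μ) ^ 2 = μ⁻¹ * a ^ 2 - 2 * |a| + μ := by
          have := sq_abs a
          field_simp
          nlinarith
        linarith
      rcases abs_cases a with ⟨h, _⟩ | ⟨h, _⟩ <;> linarith [neg_abs_le a]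
    · rw [Set.indicator_of_notMem hx]
      have : w x = 0 := image_eq_zero_of_notMem_tsupport hx
      rw [this, sub_zero, abs_of_nonneg hU0]
      have : 0 ≤ μ⁻¹ * σ.U k w x ^ 2 := by positivity
      linarith
  calc ∫ x, |σ.U k w x - w x| ≤ ∫ x, ((σ.U k w x - w x) + ((tsupport w).indicator (fun _ => μ) x
      + μ⁻¹ * (σ.U k w x - w x) ^ 2)) :=
        integral_mono hd.abs.1 (hd.1.add (hii.fun_add (hd.sq.cmul _).1)) pt
    _ = (∫ x, (σ.U k w x - w x)) + ((∫ x, (tsupport w).indicator (fun _ => μ) x)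
      + μ⁻¹ * ∫ x, (σ.U k w x - w x) ^ 2) := by
        rw [integral_add hd.1 (hii.fun_add (hd.sq.cmul _).1), integral_add hii (hd.sq.cmul _).1,
          integral_const_mul]
    _ = V * μ + μ⁻¹ * ∫ x, (σ.U k w x - w x) ^ 2 := by
        rw [integral_sub hU.1 hIB.1, σ.U_mass k hIB.1, sub_self, zero_add, integral_indicator hts,
          setIntegral_const]
        simp [hV]
    _ ≤ (V + 1) * μ + μ⁻¹ * (η * μ / (2 * (B + 1)) * (B + 1)) := by
        gcongr
        · linarith
        · refine sq.trans ?_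
          have : k * σ.h * B ≤ k * σ.h * (B + 1) := by nlinarith
          refine this.trans ?_
          gcongr
    _ = η := by rw [hμ]; field_simp; norm_num

/-- time equicontinuity in general -/
theorem time_equi (γ C : ℝ) (hγ : 0 < γ) (hC : 0 ≤ C) {g : (Fin d → ℝ) → ℝ} (hg : Integrable g)
    (hg0 : ∀ x, 0 ≤ g x) {η : ℝ} (hη : 0 < η) :
    ∃ τ, 0 < τ ∧ ∀ (σ : Scheme d) (δ : ℝ), σ.Good C δ → δ ≤ 1 → σ.γ = γ → ∀ k l : ℕ, l * σ.h ≤ τ →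
      ∫ x, |σ.U (k + l) g x - σ.U k g x| ≤ η := by
  obtain ⟨w, ws, wc, w0, wi, hw⟩ := exists_test_approx hg hg0 (by positivity : 0 < η / 3)
  obtain ⟨τ, hτ, H⟩ := time_test γ C hγ hC ws wc w0 (by positivity : 0 < η / 3)
  refine ⟨τ, hτ, fun σ δ G hδ hσ k l hl => ?_⟩
  rw [σ.U_add]
  refine (G.U_contr k (σ.U_integrable l hg) hg).trans ?_
  have h1 := H σ δ G hδ hσ l hl
  have h2 := G.U_contr l hg wi
  have i1 := σ.U_integrable l hg
  have i2 := σ.U_integrable l wi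
  have hw' : ∫ x, |w x - g x| ≤ η / 3 := by
    simpa only [abs_sub_comm] using hw
  have t1 := l1_tri i1 i2 hg
  have t2 := l1_tri i2 wi hg
  linarith

end Scheme


/-! ## Part 7: translation estimates -/

section shifts
variable {d : ℕ}

/-- squared `L²` translation modulus -/
noncomputable def N2 (v : (Fin d → ℝ) → ℝ) (z : Fin d → ℝ) : ℝ := ∫ x, (v (x + z) - v x) ^ 2

theorem N2_nonneg (v : (Fin d → ℝ) → ℝ) (z : Fin d → ℝ) : 0 ≤ N2 v z :=
  integral_nonneg fun _ => sq_nonneg _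

theorem N2_zero (v : (Fin d → ℝ) → ℝ) : N2 v 0 = 0 := by simp [N2]

theorem N2_neg (v : (Fin d → ℝ) → ℝ) (z : Fin d → ℝ) : N2 v (-z) = N2 v z := by
  unfold N2
  rw [← integral_add_right_eq_self (fun x => (v (x + -z) - v x) ^ 2) z]
  refine integral_congr_ae (Eventually.of_forall fun x => ?_)
  simp only [add_neg_cancel_right]; ring

theorem N2_add {v : (Fin d → ℝ) → ℝ} (hv : IB v) (y z : Fin d → ℝ) :
    N2 v (y + z) ≤ 2 * N2 v y + 2 * N2 v z := by
  have e : N2 v z = ∫ x, (v (x + (y + z)) - v (x + y)) ^ 2 := by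
    unfold N2
    rw [← integral_add_right_eq_self (fun x => (v (x + z) - v x) ^ 2) y]
    simp only [add_assoc]
  rw [e]
  unfold N2
  rw [← integral_const_mul, ← integral_const_mul, ← integral_add
    (((hv.shift y).sub hv).sq.cmul 2).1 (((hv.shift (y + z)).sub (hv.shift y)).sq.cmul 2).1]
  refine integral_mono ((hv.shift (y + z)).sub hv).sq.1
    ((((hv.shift y).sub hv).sq.cmul 2).add (((hv.shift (y + z)).sub (hv.shift y)).sq.cmul 2)).1 fun x => ?_
  simp only
  nlinarith [sq_nonneg ((v (x + (y + z)) - v (x + y)) - (v (x + y) - v x))]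

theorem N2_nsmul {v : (Fin d → ℝ) → ℝ} (hv : IB v) (z : Fin d → ℝ) (k : ℕ) :
    N2 v ((k : ℝ) • z) ≤ (k : ℝ) ^ 2 * N2 v z := by
  have hI : ∀ j : ℕ, IB (fun x => v (x + ((j + 1 : ℕ) : ℝ) • z) - v (x + (j : ℝ) • z)) :=
    fun j => (hv.shift _).sub (hv.shift _)
  have e : ∀ j : ℕ, N2 v z = ∫ x, (v (x + ((j + 1 : ℕ) : ℝ) • z) - v (x + (j : ℝ) • z)) ^ 2 := by
    intro j
    unfold N2
    rw [← integral_add_right_eq_self (fun x => (v (x + z) - v x) ^ 2) ((j : ℝ) • z)]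
    refine integral_congr_ae (Eventually.of_forall fun x => ?_)
    simp only [Nat.cast_add, Nat.cast_one, add_smul, one_smul, add_assoc]
  have tel : ∀ x, v (x + (k : ℝ) • z) - v x
      = ∑ j ∈ Finset.range k, (v (x + ((j + 1 : ℕ) : ℝ) • z) - v (x + (j : ℝ) • z)) := by
    intro x
    rw [Finset.sum_range_sub (fun j : ℕ => v (x + (j : ℝ) • z))]
    simp
  have hS := IB.sum (Finset.range k) (u := fun j x => (v (x + ((j + 1 : ℕ) : ℝ) • z) - v (x + (j : ℝ) • z)) ^ 2) (fun j => (hI j).sq)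
  calc N2 v ((k : ℝ) • z) ≤ ∫ x, (k : ℝ) * ∑ j ∈ Finset.range k,
        (v (x + ((j + 1 : ℕ) : ℝ) • z) - v (x + (j : ℝ) • z)) ^ 2 := by
        refine integral_mono ((hv.shift _).sub hv).sq.1 (hS.cmul _).1 fun x => ?_
        simp only
        rw [tel x]
        have := sq_sum_le_card_mul_sum_sq (s := Finset.range k)
          (f := fun j => v (x + ((j + 1 : ℕ) : ℝ) • z) - v (x + (j : ℝ) • z))
        rwa [Finset.card_range] at this
    _ = k * ∑ j ∈ Finset.range k, N2 v z := by
        rw [integral_const_mul, integral_finsetSum _ fun j _ => (hI j).sq.1]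
        congr 1
        exact Finset.sum_congr rfl fun j _ => (e j).symm
    _ = _ := by rw [Finset.sum_const, Finset.card_range, nsmul_eq_mul]; ring

theorem N2_zsmul {v : (Fin d → ℝ) → ℝ} (hv : IB v) (z : Fin d → ℝ) (k : ℤ) :
    N2 v ((k : ℝ) • z) ≤ (k : ℝ) ^ 2 * N2 v z := by
  obtain ⟨n, rfl | rfl⟩ := k.eq_nat_or_neg
  · simpa using N2_nsmul hv z n
  · have := N2_nsmul hv z n
    simpa [N2_neg] using this

theorem N2_sum {v : (Fin d → ℝ) → ℝ} (hv : IB v) (y : Fin d → (Fin d → ℝ)) (s : Finset (Fin d)) :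
    N2 v (∑ i ∈ s, y i) ≤ 2 ^ s.card * ∑ i ∈ s, N2 v (y i) := by
  induction s using Finset.induction_on with
  | empty => simp [N2_zero]
  | insert a s ha ih =>
    rw [Finset.sum_insert ha, Finset.sum_insert ha, Finset.card_insert_of_notMem ha]
    refine (N2_add hv _ _).trans ?_
    have h0 : 1 ≤ (2 : ℝ) ^ s.card := one_le_pow₀ (by norm_num)
    have h1 := N2_nonneg v (y a)
    rw [pow_succ]
    nlinarith

theorem Scheme.N2_lattice (σ : Scheme d) {v : (Fin d → ℝ) → ℝ} (hv : IB v) (k : Fin d → ℤ) {r : ℝ}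
    (hr : ∀ i, |(k i : ℝ) * σ.ε'| ≤ r) :
    N2 v (∑ i, (k i : ℝ) • (σ.ε' • ev i)) ≤ 2 ^ d * (r ^ 2 * σ.Dir v) := by
  refine (N2_sum hv _ _).trans ?_
  rw [Finset.card_univ, Fintype.card_fin]
  refine mul_le_mul_of_nonneg_left ?_ (by positivity)
  unfold Scheme.Dir
  rw [Finset.mul_sum]
  refine Finset.sum_le_sum fun i _ => ?_
  refine (N2_zsmul hv _ _).trans ?_
  have hε := σ.ε'_pos
  have h1 : (k i : ℝ) ^ 2 ≤ r ^ 2 * (σ.ε' ^ 2)⁻¹ := by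
    rw [← div_eq_mul_inv, le_div_iff₀ (by positivity), ← mul_pow]
    exact sq_le_sq' (by linarith [neg_abs_le ((k i : ℝ) * σ.ε'), hr i]) ((le_abs_self _).trans (hr i))
  have := N2_nonneg v (σ.ε' • ev i)
  calc _ ≤ r ^ 2 * (σ.ε' ^ 2)⁻¹ * N2 v (σ.ε' • ev i) := by gcongr
    _ = _ := by unfold N2; ring

/-- local `L¹` translation modulus from the Dirichlet form and a remainder bound -/
theorem Scheme.local_shift (σ : Scheme d) {v : (Fin d → ℝ) → ℝ} (hv : IB v) {B : Set (Fin d → ℝ)}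
    (hB : MeasurableSet B) (hBf : volume B ≠ ⊤) {μ r κ : ℝ} (hμ : 0 < μ)
    (hκ : ∀ z, ‖z‖ ≤ σ.ε' → ∫ x, |v (x + z) - v x| ≤ κ) (z : Fin d → ℝ) (hz : ‖z‖ ≤ r) :
    ∫ x in B, |v (x + z) - v x| ≤ κ + (volume.real B * μ + μ⁻¹ * (2 ^ d * ((r + σ.ε') ^ 2 * σ.Dir v))) := by
  have hε := σ.ε'_pos
  set k : Fin d → ℤ := fun i => ⌊z i / σ.ε'⌋ with hk
  set y : Fin d → ℝ := ∑ i, (k i : ℝ) • (σ.ε' • ev i) with hy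
  have hyi : ∀ i, y i = k i * σ.ε' := by
    intro i
    rw [hy, Finset.sum_apply, Finset.sum_eq_single i]
    · simp [ev]
    · intro j _ hj; simp [ev, hj.symm]
    · simp
  have hfl : ∀ i, 0 ≤ z i - y i ∧ z i - y i ≤ σ.ε' := by
    intro i
    rw [hyi]
    have h1 := Int.floor_le (z i / σ.ε')
    have h2 := Int.lt_floor_add_one (z i / σ.ε')
    rw [le_div_iff₀ hε] at h1
    rw [div_lt_iff₀ hε] at h2
    simp only [hk]
    constructor <;> linarith
  have hz' : ‖z - y‖ ≤ σ.ε' := by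
    rw [pi_norm_le_iff_of_nonneg hε.le]
    intro i
    rw [Pi.sub_apply, Real.norm_eq_abs, abs_of_nonneg (hfl i).1]
    exact (hfl i).2
  have hki : ∀ i, |(k i : ℝ) * σ.ε'| ≤ r + σ.ε' := by
    intro i
    rw [← hyi]
    have h1 : |z i| ≤ r := (norm_le_pi_norm z i).trans hz
    have := hfl i
    rw [abs_le] at *
    constructor <;> linarith [h1.1, h1.2]
  have h2 := σ.N2_lattice hv k hki
  rw [← hy] at h2
  have hI1 := ((hv.shift z).sub (hv.shift y)).abs
  have hI2 := ((hv.shift y).sub hv).abs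
  have e1 : ∫ x, |v (x + z) - v (x + y)| ≤ κ := by
    refine le_trans (le_of_eq ?_) (hκ (z - y) hz')
    rw [← integral_add_right_eq_self (fun x => |v (x + (z - y)) - v x|) y]
    refine integral_congr_ae (Eventually.of_forall fun x => ?_)
    simp only [add_assoc, add_sub_cancel]
  have e2 : ∫ x in B, |v (x + y) - v x| ≤ volume.real B * μ + μ⁻¹ * N2 v y := by
    have hsq := ((hv.shift y).sub hv).sq
    have hcI : Integrable (fun _ : Fin d → ℝ => μ) (volume.restrict B) := integrableOn_const hBf
    have hsI : Integrable (fun x : Fin d → ℝ => μ⁻¹ * (v (x + y) - v x) ^ 2) (volume.restrict B) :=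
      (hsq.1.const_mul μ⁻¹).integrableOn
    calc _ ≤ ∫ x in B, (μ + μ⁻¹ * (v (x + y) - v x) ^ 2) := by
          refine integral_mono hI2.1.integrableOn
            (hcI.add hsI) fun x => ?_
          set a := v (x + y) - v x
          show |a| ≤ μ + μ⁻¹ * a ^ 2
          have : 0 ≤ μ⁻¹ * (|a| - μ) ^ 2 := by positivity
          have h2 : μ⁻¹ * (|a| - μ) ^ 2 = μ⁻¹ * a ^ 2 - 2 * |a| + μ := by
            have := sq_abs a
            field_simp
            nlinarith
          linarith [abs_nonneg a]
      _ = volume.real B * μ + μ⁻¹ * ∫ x in B, (v (x + y) - v x) ^ 2 := by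
          rw [integral_add hcI hsI, setIntegral_const,
            integral_const_mul, smul_eq_mul]
      _ ≤ _ := by
          gcongr
          exact setIntegral_le_integral hsq.1 (Eventually.of_forall fun x => sq_nonneg _)
  calc ∫ x in B, |v (x + z) - v x| ≤ ∫ x in B, (|v (x + z) - v (x + y)| + |v (x + y) - v x|) := by
        refine integral_mono ((hv.shift z).sub hv).abs.1.integrableOn (hI1.1.integrableOn.add hI2.1.integrableOn) fun x => ?_
        exact abs_sub_le _ _ _
    _ = (∫ x in B, |v (x + z) - v (x + y)|) + ∫ x in B, |v (x + y) - v x| :=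
        integral_add hI1.1.integrableOn hI2.1.integrableOn
    _ ≤ κ + (volume.real B * μ + μ⁻¹ * N2 v y) := by
        refine add_le_add (le_trans ?_ e1) e2
        exact setIntegral_le_integral hI1.1 (Eventually.of_forall fun x => abs_nonneg _)
    _ ≤ _ := by gcongr

/-- finite measurable discretisation -/
theorem exists_disc (d : ℕ) (R : ℝ) {r : ℝ} (hr : 0 < r) :
    ∃ (N : ℕ) (p : (Fin d → ℝ) → (Fin d → Fin N)) (y : (Fin d → Fin N) → (Fin d → ℝ)),
      Measurable p ∧ ∀ x, ‖x‖ ≤ R → ‖x - y (p x)‖ ≤ r := by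
  obtain ⟨M, hM⟩ := exists_nat_ge (|R| / r + 1)
  refine ⟨2 * M + 1, fun x i => Fin.ofNat _ (Int.toNat (⌊x i / r⌋ + M)),
    fun m i => r * ((m i : ℕ) - M : ℝ), ?_, fun x hx => ?_⟩
  · refine measurable_pi_iff.2 fun i => ?_
    have h1 : Measurable fun x : Fin d → ℝ => ⌊x i / r⌋ :=
      Int.measurable_floor.comp (by fun_prop : Measurable fun x : Fin d → ℝ => x i / r)
    exact (measurable_from_top (f := fun n : ℤ => Fin.ofNat (2 * M + 1) (Int.toNat (n + M)))).comp h1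
  · rw [pi_norm_le_iff_of_nonneg hr.le]
    intro i
    have hxi : |x i| ≤ |R| := (norm_le_pi_norm x i).trans (hx.trans (le_abs_self R))
    have h1 := Int.floor_le (x i / r)
    have h2 := Int.lt_floor_add_one (x i / r)
    have h3 : |x i / r| ≤ |R| / r := by rw [abs_div, abs_of_pos hr]; gcongr
    rw [abs_le] at h3
    have h4 : (0 : ℤ) ≤ ⌊x i / r⌋ + M := by
      have : (-1 : ℝ) < (⌊x i / r⌋ : ℝ) + M := by linarith
      have : (-1 : ℤ) < ⌊x i / r⌋ + M := by exact_mod_cast this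
      linarith
    have h5 : ⌊x i / r⌋ + M < (2 * M + 1 : ℕ) := by
      have : (⌊x i / r⌋ : ℝ) + M < ((2 * M + 1 : ℕ) : ℝ) := by push_cast; linarith
      exact_mod_cast this
    have h6 : ((Fin.ofNat (2 * M + 1) (Int.toNat (⌊x i / r⌋ + M)) : Fin (2 * M + 1)) : ℕ)
        = Int.toNat (⌊x i / r⌋ + M) := by
      simp only [Fin.val_ofNat]
      apply Nat.mod_eq_of_lt
      omega
    have h7 : ((Int.toNat (⌊x i / r⌋ + M) : ℕ) : ℝ) = (⌊x i / r⌋ : ℝ) + M := by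
      have : ((Int.toNat (⌊x i / r⌋ + M) : ℕ) : ℤ) = ⌊x i / r⌋ + M := Int.toNat_of_nonneg h4
      exact_mod_cast this
    simp only [Pi.sub_apply, h6, h7, add_sub_cancel_right]
    rw [le_div_iff₀ hr] at h1
    rw [div_lt_iff₀ hr] at h2
    rw [Real.norm_eq_abs, abs_le]
    constructor <;> linarith

end shifts


/-! ## Part 8: compactness in space -/

theorem shift_prod_integrable {d : ℕ} {v : (Fin d → ℝ) → ℝ} (hv : IB v) {B D : Set (Fin d → ℝ)}
    (hBf : volume B ≠ ⊤) (hDf : volume D ≠ ⊤) :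
    Integrable (fun p : (Fin d → ℝ) × (Fin d → ℝ) => |v (p.1 + p.2) - v p.1|)
      ((volume.restrict B).prod (volume.restrict D)) := by
  obtain ⟨M, hM⟩ := hv.2
  have : IsFiniteMeasure (volume.restrict B) := ⟨by simpa using hBf.lt_top⟩
  have : IsFiniteMeasure (volume.restrict D) := ⟨by simpa using hDf.lt_top⟩
  have h1 : AEStronglyMeasurable (fun p : (Fin d → ℝ) × (Fin d → ℝ) => v (p.1 + p.2))
      (volume.prod volume) :=
    hv.1.aestronglyMeasurable.comp_quasiMeasurePreserving
      (quasiMeasurePreserving_add volume volume)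
  have h2 : AEStronglyMeasurable (fun p : (Fin d → ℝ) × (Fin d → ℝ) => v p.1)
      (volume.prod volume) := hv.1.aestronglyMeasurable.comp_fst
  have h3 := (h1.sub h2).norm
  refine Integrable.of_bound (C := M + M) ?_ (Eventually.of_forall fun p => ?_)
  · rw [Measure.prod_restrict]
    exact h3.restrict
  · rw [Real.norm_eq_abs, abs_abs]
    exact (abs_sub _ _).trans (add_le_add (hM _) (hM _))

theorem avg_approx {d : ℕ} {v : (Fin d → ℝ) → ℝ} (hv : IB v) {B : Set (Fin d → ℝ)}
    (hB : MeasurableSet B) (hBf : volume B ≠ ⊤) {r : ℝ} (hr : 0 < r) {N : ℕ}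
    {p : (Fin d → ℝ) → (Fin d → Fin N)} (hp : Measurable p)
    (y : (Fin d → Fin N) → (Fin d → ℝ)) (hpy : ∀ x ∈ B, ‖x - y (p x)‖ ≤ r) {Ω : ℝ}
    (hΩ : ∀ z, ‖z‖ ≤ 2 * r → ∫ x in B, |v (x + z) - v x| ≤ Ω) :
    ∃ Φ : (Fin d → Fin N) → ℝ, (∀ m, |Φ m| ≤ ((2 * r) ^ d)⁻¹ * ∫ x, |v x|) ∧
      ∫ x in B, |v x - Φ (p x)| ≤ 2 ^ d * Ω := by
  have hvol : ∀ s : ℝ, 0 ≤ s → ∀ a : Fin d → ℝ,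
      volume.real (Metric.closedBall a s) = (2 * s) ^ d := by
    intro s hs a
    rw [Measure.real, Real.volume_pi_closedBall a hs, Fintype.card_fin,
      ENNReal.toReal_ofReal (by positivity)]
  have hfin : ∀ s : ℝ, ∀ a : Fin d → ℝ, volume (Metric.closedBall a s) ≠ ⊤ := fun s a =>
    measure_closedBall_lt_top.ne
  set V : ℝ := (2 * r) ^ d with hV
  have hVpos : 0 < V := by positivity
  set Φ : (Fin d → Fin N) → ℝ := fun m => V⁻¹ * ∫ w in Metric.closedBall (y m) r, v w with hΦ
  refine ⟨Φ, fun m => ?_, ?_⟩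
  · rw [hΦ]
    simp only
    rw [abs_mul, abs_of_pos (inv_pos.2 hVpos)]
    gcongr
    refine (abs_integral_le_integral_abs).trans ?_
    exact setIntegral_le_integral hv.1.abs (Eventually.of_forall fun x => abs_nonneg _)
  set D : Set (Fin d → ℝ) := Metric.closedBall 0 (2 * r) with hD
  have hI := shift_prod_integrable hv hBf (hfin (2 * r) 0)
  have hmI : Integrable (fun x => ∫ z in D, |v (x + z) - v x|) (volume.restrict B) :=
    hI.integral_prod_left
  have key : ∀ x ∈ B, |v x - Φ (p x)| ≤ V⁻¹ * ∫ z in D, |v (x + z) - v x| := by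
    intro x hx
    have hcI : IntegrableOn (fun _ : Fin d → ℝ => v x) (Metric.closedBall (y (p x)) r) :=
      integrableOn_const (hfin _ _)
    have e1 : v x - Φ (p x) = V⁻¹ * ∫ w in Metric.closedBall (y (p x)) r, (v x - v w) := by
      rw [integral_sub hcI hv.1.integrableOn, setIntegral_const, hvol r hr.le, smul_eq_mul]
      rw [mul_sub, ← mul_assoc, ← hV, inv_mul_cancel₀ hVpos.ne', one_mul]
    rw [e1, abs_mul, abs_of_pos (inv_pos.2 hVpos)]
    gcongr
    refine (abs_integral_le_integral_abs).trans ?_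
    have hJ : IntegrableOn (fun w => |v w - v x|) (Metric.closedBall x (2 * r)) :=
      (hv.1.integrableOn.sub (integrableOn_const (hfin _ _))).abs
    calc ∫ w in Metric.closedBall (y (p x)) r, |v x - v w|
        = ∫ w in Metric.closedBall (y (p x)) r, |v w - v x| := by
          simp only [abs_sub_comm]
      _ ≤ ∫ w in Metric.closedBall x (2 * r), |v w - v x| := by
          refine setIntegral_mono_set hJ (Eventually.of_forall fun w => abs_nonneg _)
            (LE.le.eventuallyLE ?_)
          refine Metric.closedBall_subset_closedBall' ?_
          rw [dist_comm, dist_eq_norm]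
          linarith [hpy x hx]
      _ = ∫ z in D, |v (x + z) - v x| := by
          rw [← integral_indicator Metric.isClosed_closedBall.measurableSet,
            ← integral_indicator Metric.isClosed_closedBall.measurableSet,
            ← integral_add_left_eq_self _ x]
          refine integral_congr_ae (Eventually.of_forall fun z => ?_)
          simp only [Set.indicator, Metric.mem_closedBall, dist_eq_norm, add_sub_cancel_left,
            sub_zero]
  have hmeas : AEStronglyMeasurable (fun x => |v x - Φ (p x)|) (volume.restrict B) := by
    have : Measurable fun x => Φ (p x) := (measurable_of_finite Φ).comp hp
    exact (hv.1.aestronglyMeasurable.sub this.aestronglyMeasurable).norm.restrict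
  calc ∫ x in B, |v x - Φ (p x)| ≤ ∫ x in B, V⁻¹ * ∫ z in D, |v (x + z) - v x| := by
        refine integral_mono_of_nonneg (Eventually.of_forall fun x => abs_nonneg _)
          (hmI.const_mul _) ?_
        filter_upwards [ae_restrict_mem hB] with x hx using key x hx
    _ = V⁻¹ * ∫ z in D, ∫ x in B, |v (x + z) - v x| := by
        rw [integral_const_mul, integral_integral_swap hI]
    _ ≤ V⁻¹ * ∫ z in D, Ω := by
        refine mul_le_mul_of_nonneg_left ?_ (by positivity)
        refine setIntegral_mono_on hI.integral_prod_right (integrableOn_const (hfin _ _))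
          Metric.isClosed_closedBall.measurableSet fun z hz => hΩ z ?_
        simpa [hD] using hz
    _ = 2 ^ d * Ω := by
        rw [setIntegral_const, hvol _ (by positivity), smul_eq_mul, ← mul_assoc, mul_pow 2 (2 * r), ← hV]
        field_simp

/-- finite nets -/
theorem exists_net (d : ℕ) (R : ℝ) {r : ℝ} (hr : 0 < r) (M : ℝ) {η : ℝ} (hη : 0 < η) :
    ∃ F : Set ((Fin d → ℝ) → ℝ), F.Finite ∧ (∀ f ∈ F, Integrable f) ∧
      ∀ (v : (Fin d → ℝ) → ℝ) (Ω : ℝ), IB v → ∫ x, |v x| ≤ M →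
        (∀ z, ‖z‖ ≤ 2 * r → ∫ x in Metric.closedBall 0 R, |v (x + z) - v x| ≤ Ω) →
        ∃ f ∈ F, ∫ x, |v x - f x| ≤ 2 ^ d * Ω + η
          + ∫ x in (Metric.closedBall (0 : Fin d → ℝ) R)ᶜ, |v x| := by
  obtain ⟨N, p, y, hp, hpy⟩ := exists_disc d R hr
  set B := Metric.closedBall (0 : Fin d → ℝ) R with hB
  have hBm : MeasurableSet B := Metric.isClosed_closedBall.measurableSet
  have hBf : volume B ≠ ⊤ := measure_closedBall_lt_top.ne
  set M' := ((2 * r) ^ d)⁻¹ * M with hM'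
  set η' := η / (volume.real B + 1) with hη'
  have hb0 : 0 ≤ volume.real B := measureReal_nonneg
  have hη'0 : 0 < η' := by positivity
  obtain ⟨t, ht, htf, hcov⟩ := (isCompact_closedBall (0 : (Fin d → Fin N) → ℝ) M').finite_cover_balls hη'0
  have hfi : ∀ Φ : (Fin d → Fin N) → ℝ, IntegrableOn (fun x => Φ (p x)) B := by
    intro Φ
    have h1 : Measurable fun x => Φ (p x) := (measurable_of_finite Φ).comp hp
    have : IsFiniteMeasure (volume.restrict B) := ⟨by simpa using hBf.lt_top⟩
    refine Integrable.of_bound (C := ‖Φ‖) h1.aestronglyMeasurable (Eventually.of_forall fun x => ?_)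
    exact norm_le_pi_norm Φ (p x)
  refine ⟨Set.image (fun Φ : (Fin d → Fin N) → ℝ => B.indicator fun x => Φ (p x)) t, htf.image _, ?_, ?_⟩
  · rintro f ⟨Φ, -, rfl⟩
    exact (integrable_indicator_iff hBm).2 (hfi Φ)
  · intro v Ω hv hvM hΩ
    obtain ⟨Φ, h1, h2⟩ := avg_approx hv hBm hBf hr hp y (fun x hx => hpy x (by simpa [hB] using hx)) hΩ
    have h3 : Φ ∈ Metric.closedBall (0 : (Fin d → Fin N) → ℝ) M' := by
      have hM0 : 0 ≤ M := (integral_nonneg fun x => abs_nonneg _).trans hvM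
      rw [mem_closedBall_zero_iff, pi_norm_le_iff_of_nonneg (by positivity)]
      intro m
      refine (h1 m).trans ?_
      rw [hM']
      gcongr
    have h4 := hcov h3
    simp only [Set.mem_iUnion, Metric.mem_ball] at h4
    obtain ⟨Ψ, hΨ, hd'⟩ := h4
    refine ⟨_, ⟨Ψ, hΨ, rfl⟩, ?_⟩
    have hint : Integrable fun x => |v x - B.indicator (fun x => Ψ (p x)) x| :=
      (hv.1.sub ((integrable_indicator_iff hBm).2 (hfi Ψ))).abs
    rw [← integral_add_compl hBm hint]
    have e1 : ∫ x in B, |v x - B.indicator (fun x => Ψ (p x)) x| = ∫ x in B, |v x - Ψ (p x)| :=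
      setIntegral_congr_fun hBm fun x hx => by simp [hx]
    have e2 : ∫ x in Bᶜ, |v x - B.indicator (fun x => Ψ (p x)) x| = ∫ x in Bᶜ, |v x| :=
      setIntegral_congr_fun hBm.compl fun x hx => by
        have : x ∉ B := hx
        simp [this]
    rw [e1, e2]
    have hc : IntegrableOn (fun _ : Fin d → ℝ => η') B := integrableOn_const hBf
    have hvI : IntegrableOn (fun x => |v x - Φ (p x)|) B := (hv.1.integrableOn.sub (hfi Φ)).abs
    have e3 : ∫ x in B, |v x - Ψ (p x)| ≤ 2 ^ d * Ω + η := by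
      calc _ ≤ ∫ x in B, (|v x - Φ (p x)| + η') := by
            refine integral_mono (hv.1.integrableOn.sub (hfi Ψ)).abs (hvI.add hc) fun x => ?_
            have h5 : |Φ (p x) - Ψ (p x)| ≤ η' := by
              rw [← Real.dist_eq]
              exact (dist_le_pi_dist Φ Ψ (p x)).trans hd'.le
            exact (abs_sub_le _ (Φ (p x)) _).trans (by linarith)
        _ = (∫ x in B, |v x - Φ (p x)|) + volume.real B * η' := by
            rw [integral_add hvI hc, setIntegral_const, smul_eq_mul]
        _ ≤ 2 ^ d * Ω + η := by
            refine add_le_add h2 ?_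
            rw [hη', ← mul_div_assoc, div_le_iff₀ (by positivity)]
            nlinarith
    linarith


namespace Scheme
variable {d : ℕ} {σ : Scheme d}

theorem tail_test (γ C : ℝ) (hγ : 0 < γ) (hC : 0 ≤ C) {w : (Fin d → ℝ) → ℝ}
    (hw : ContDiff ℝ (⊤ : ℕ∞) w) (hc : HasCompactSupport w)
    (hw0 : ∀ x, 0 ≤ w x) {T : ℝ} (hT : 0 ≤ T) {η : ℝ} (hη : 0 < η) :
    ∃ R : ℝ, ∀ (σ : Scheme d) (δ : ℝ), σ.Good C δ → δ ≤ 1 → σ.γ = γ → ∀ k : ℕ, k * σ.h ≤ T →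
      ∫ x in (Metric.closedBall (0 : Fin d → ℝ) R)ᶜ, |σ.U k w x| ≤ η := by
  obtain ⟨χ, χs, χc, χ0, χ1, χone, χzero⟩ := exists_cutoff d
  obtain ⟨K, hK⟩ := TF.exists χs χc
  have hIB := IB_of_test hw.continuous hc
  have hK0 := hK.K_nonneg
  have hA1 : 0 ≤ A1 d γ C := by unfold A1; positivity
  have hA2 : 0 ≤ A2 d γ C := by unfold A2; positivity
  have hw1 : 0 ≤ ∫ x, |w x| := integral_nonneg fun x => abs_nonneg _
  obtain ⟨R0, hR0⟩ := hc.isCompact.isBounded.exists_norm_le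
  set X : ℝ := T * (K * (A1 d γ C * 1 + A2 d γ C) * ∫ x, |w x|) with hX
  have hX0 : 0 ≤ X := by positivity
  set R : ℝ := 1 + |R0| + X / η with hR
  have hR1 : 1 ≤ R := by
    have : 0 ≤ X / η := by positivity
    linarith [abs_nonneg R0]
  have hRp : 0 < R := by linarith
  have hRR : R0 ≤ R := by
    have : 0 ≤ X / η := by positivity
    linarith [le_abs_self R0]
  have hXR : X / R ≤ η := by
    rw [div_le_iff₀ hRp, hR]
    have : η * (X / η) = X := by field_simp
    nlinarith [abs_nonneg R0]
  refine ⟨2 * R, fun σ δ G hδ1 hσγ k hk => ?_⟩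
  have hU := σ.U_IB k hIB
  have hs := hK.scale hR1
  have e2 := G.U_weak hs hIB.1 k
  rw [hσγ] at e2
  have hkh : 0 ≤ k * σ.h := mul_nonneg (Nat.cast_nonneg _) σ.h_pos.le
  have hδ0 := G.δ_nonneg
  have e4 : k * σ.h * (K / R * (A1 d γ C * δ + A2 d γ C) * ∫ x, |w x|) ≤ η := by
    calc _ ≤ T * (K / R * (A1 d γ C * 1 + A2 d γ C) * ∫ x, |w x|) := by gcongr
      _ = X / R := by rw [hX]; ring
      _ ≤ η := hXR
  have e5 : ∫ x, χ (R⁻¹ • x) * w x = ∫ x, σ.U k w x := by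
    rw [σ.U_mass k hIB.1]
    refine integral_congr_ae (Eventually.of_forall fun x => ?_)
    simp only
    by_cases hx : x ∈ tsupport w
    · rw [χone, one_mul]
      rw [norm_smul, Real.norm_eq_abs, abs_of_pos (inv_pos.2 hRp), inv_mul_le_iff₀ hRp, mul_one]
      exact (hR0 x hx).trans hRR
    · rw [image_eq_zero_of_notMem_tsupport hx, mul_zero]
  have hcU : Integrable fun x => χ (R⁻¹ • x) * σ.U k w x := by
    refine hU.1.bdd_mul hs.cont.aestronglyMeasurable (c := 1) (Eventually.of_forall fun x => ?_)
    rw [Real.norm_eq_abs, abs_of_nonneg (χ0 _)]; exact χ1 _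
  calc ∫ x in (Metric.closedBall (0 : Fin d → ℝ) (2 * R))ᶜ, |σ.U k w x|
      = ∫ x in (Metric.closedBall (0 : Fin d → ℝ) (2 * R))ᶜ, (σ.U k w x - χ (R⁻¹ • x) * σ.U k w x) := by
        refine setIntegral_congr_fun Metric.isClosed_closedBall.measurableSet.compl fun x hx => ?_
        have : 2 * R < ‖x‖ := by simpa using hx
        rw [χzero, zero_mul, sub_zero, abs_of_nonneg (G.U_nonneg k hw0 x)]
        rw [norm_smul, Real.norm_eq_abs, abs_of_pos (inv_pos.2 hRp), le_inv_mul_iff₀ hRp]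
        linarith
    _ ≤ ∫ x, (σ.U k w x - χ (R⁻¹ • x) * σ.U k w x) := by
        refine setIntegral_le_integral (hU.1.fsub hcU) (Eventually.of_forall fun x => ?_)
        have := G.U_nonneg k hw0 x
        have := χ1 (R⁻¹ • x)
        simp only [Pi.zero_apply]
        nlinarith
    _ = (∫ x, σ.U k w x) - ∫ x, χ (R⁻¹ • x) * σ.U k w x := integral_sub hU.1 hcU
    _ ≤ η := by
        rw [← e5]
        have := (abs_le.1 (e2.trans e4)).1
        linarith

theorem shift_test {w : (Fin d → ℝ) → ℝ} (hw : ContDiff ℝ (⊤ : ℕ∞) w) (hc : HasCompactSupport w) :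
    ∃ A, 0 ≤ A ∧ ∀ z, ‖z‖ ≤ 1 → ∫ x, |w (x + z) - w x| ≤ A * ‖z‖ := by
  obtain ⟨R0, hR0⟩ := hc.isCompact.isBounded.exists_norm_le
  have hIB := IB_of_test hw.continuous hc
  obtain ⟨L, hL⟩ := hw.lipschitzWith_of_hasCompactSupport hc (by simp)
  set B := Metric.closedBall (0 : Fin d → ℝ) (|R0| + 1) with hB
  have hBm : MeasurableSet B := Metric.isClosed_closedBall.measurableSet
  have hBf : volume B ≠ ⊤ := measure_closedBall_lt_top.ne
  refine ⟨volume.real B * L, by positivity, fun z hz => ?_⟩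
  have hii : Integrable (B.indicator (fun _ => (L : ℝ) * ‖z‖)) :=
    (integrable_indicator_iff hBm).2 (integrableOn_const hBf)
  calc ∫ x, |w (x + z) - w x| ≤ ∫ x, B.indicator (fun _ => (L : ℝ) * ‖z‖) x := by
        refine integral_mono ((hIB.shift z).sub hIB).abs.1 hii fun x => ?_
        show |w (x + z) - w x| ≤ B.indicator (fun _ => (L : ℝ) * ‖z‖) x
        by_cases hx : x ∈ B
        · rw [Set.indicator_of_mem hx]
          have := hL.dist_le_mul (x + z) x
          rwa [Real.dist_eq, dist_eq_norm, add_sub_cancel_left] at this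
        · rw [Set.indicator_of_notMem hx]
          have hx' : |R0| + 1 < ‖x‖ := by simpa [hB] using hx
          have h1 : x ∉ tsupport w := fun h => by
            have := hR0 x h; linarith [le_abs_self R0]
          have h2 : x + z ∉ tsupport w := fun h => by
            have h3 := hR0 _ h
            have : ‖x‖ ≤ ‖x + z‖ + ‖z‖ := by simpa using norm_sub_le (x + z) z
            linarith [le_abs_self R0]
          rw [image_eq_zero_of_notMem_tsupport h1, image_eq_zero_of_notMem_tsupport h2]; simp
    _ = volume.real B * L * ‖z‖ := by
        rw [integral_indicator hBm, setIntegral_const, smul_eq_mul, mul_assoc]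

set_option maxHeartbeats 1000000 in
theorem net_test (γ C : ℝ) (hγ : 0 < γ) (hC : 0 ≤ C) {w : (Fin d → ℝ) → ℝ}
    (hw : ContDiff ℝ (⊤ : ℕ∞) w) (hc : HasCompactSupport w)
    (hw0 : ∀ x, 0 ≤ w x) {t : ℝ} (ht : 0 ≤ t) {η : ℝ} (hη : 0 < η) :
    ∃ δ0 > 0, ∃ F : Set ((Fin d → ℝ) → ℝ), F.Finite ∧ (∀ f ∈ F, Integrable f) ∧
      ∀ (σ : Scheme d) (δ : ℝ), σ.Good C δ → δ ≤ δ0 → σ.γ = γ →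
        ∃ f ∈ F, ∫ x, |σ.U ⌊t / σ.h⌋₊ w x - f x| ≤ η := by
  have hIB := IB_of_test hw.continuous hc
  have hCe : 0 ≤ Ce d γ C := Ce_nonneg hγ hC
  have hw2 : 0 ≤ ∫ x, w x ^ 2 := integral_nonneg fun x => sq_nonneg _
  have hw1 : 0 ≤ ∫ x, |w x| := integral_nonneg fun x => abs_nonneg _
  set T : ℝ := t + 1 with hT
  have hT0 : 0 ≤ T := by linarith
  set E : ℝ := (∫ x, w x ^ 2) + T * (Ce d γ C * (Real.exp (Ce d γ C * T) * ∫ x, w x ^ 2)) with hE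
  have hE0 : 0 ≤ E := by positivity
  obtain ⟨τ1, hτ1, Hτ⟩ := time_test γ C hγ hC hw hc hw0 (by positivity : 0 < η / 5)
  set τ := min τ1 1 with hτ
  have hτ0 : 0 < τ := by positivity
  obtain ⟨R, HR⟩ := tail_test γ C hγ hC hw hc hw0 hT0 (by positivity : 0 < η / 5)
  obtain ⟨A, hA0, HA⟩ := shift_test hw hc
  set B := Metric.closedBall (0 : Fin d → ℝ) R with hB
  have hBm : MeasurableSet B := Metric.isClosed_closedBall.measurableSet
  have hBf : volume B ≠ ⊤ := measure_closedBall_lt_top.ne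
  have hb0 : 0 ≤ volume.real B := measureReal_nonneg
  set Dm : ℝ := 2 * E / (γ * τ) with hDm
  have hDm0 : 0 ≤ Dm := by positivity
  set ω : ℝ := η / (15 * 2 ^ d) with hω
  have hω0 : 0 < ω := by positivity
  set μ : ℝ := ω / (volume.real B + 1) with hμ
  have hμ0 : 0 < μ := by positivity
  set Y : ℝ := μ⁻¹ * (2 ^ d * (9 * Dm)) with hY
  have hY0 : 0 ≤ Y := by positivity
  set r : ℝ := min 1 (ω / (Y + 1)) with hr
  have hr0 : 0 < r := by positivity
  have hr1 : r ≤ 1 := min_le_left _ _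
  have hYr : Y * r ≤ ω := by
    have : r * (Y + 1) ≤ ω := (le_div_iff₀ (by positivity)).1 (min_le_right _ _)
    nlinarith
  set κ1 : ℝ := A + T * 2 * ∫ x, |w x| with hκ1
  have hκ10 : 0 ≤ κ1 := by positivity
  obtain ⟨F, hFf, hFi, HF⟩ := exists_net d R hr0 (∫ x, |w x|) (by positivity : 0 < η / 5)
  refine ⟨min (min 1 (τ / 2)) (min r (ω / (κ1 + 1))), by positivity, F, hFf, hFi, ?_⟩
  intro σ δ G hδ hσγ
  have hδ1 : δ ≤ 1 := hδ.trans ((min_le_left _ _).trans (min_le_left _ _))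
  have hδτ : δ ≤ τ / 2 := hδ.trans ((min_le_left _ _).trans (min_le_right _ _))
  have hδr : δ ≤ r := hδ.trans ((min_le_right _ _).trans (min_le_left _ _))
  have hδκ : κ1 * δ ≤ ω := by
    have : δ * (κ1 + 1) ≤ ω := (le_div_iff₀ (by positivity)).1
      (hδ.trans ((min_le_right _ _).trans (min_le_right _ _)))
    nlinarith [G.δ_nonneg]
  have hh := σ.h_pos
  have hhδ := G.h_le
  set k := ⌊t / σ.h⌋₊ with hk
  set m := ⌊τ / σ.h⌋₊ with hm
  have hkh : k * σ.h ≤ t := by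
    rw [← le_div_iff₀ hh]; exact Nat.floor_le (by positivity)
  have hmh : m * σ.h ≤ τ := by
    rw [← le_div_iff₀ hh]; exact Nat.floor_le (by positivity)
  have hmh2 : τ / 2 ≤ m * σ.h := by
    have := Nat.lt_floor_add_one (τ / σ.h)
    rw [div_lt_iff₀ hh] at this
    have e : (m : ℝ) = (⌊τ / σ.h⌋₊ : ℝ) := rfl
    rw [e]
    nlinarith
  have hm0 : 0 < (m : ℝ) := by
    by_contra hcon
    have : m * σ.h ≤ 0 := mul_nonpos_of_nonpos_of_nonneg (not_lt.1 hcon) hh.le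
    linarith
  have hτ1' : τ ≤ 1 := min_le_right _ _
  have hkmT : ((k + m : ℕ) : ℝ) * σ.h ≤ T := by push_cast; nlinarith
  have en := G.energy_growth hIB (k + m) hkmT
  rw [hσγ] at en
  have hU2 : 0 ≤ ∫ x, σ.U (k + m) w x ^ 2 := integral_nonneg fun x => sq_nonneg _
  have hsum : γ * ∑ l ∈ Finset.range m, σ.h * σ.Dir (σ.U (k + l) w) ≤ E := by
    rw [Finset.sum_range_add] at en
    have h1 : 0 ≤ γ * ∑ l ∈ Finset.range k, σ.h * σ.Dir (σ.U l w) :=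
      mul_nonneg hγ.le (Finset.sum_nonneg fun l _ => mul_nonneg hh.le (σ.Dir_nonneg _))
    have h2 : ((k + m : ℕ) : ℝ) * σ.h * (Ce d γ C * (Real.exp (Ce d γ C * T) * ∫ x, w x ^ 2))
      ≤ T * (Ce d γ C * (Real.exp (Ce d γ C * T) * ∫ x, w x ^ 2)) := by gcongr
    rw [mul_add] at en
    linarith
  obtain ⟨l, hl, hlD⟩ : ∃ l ∈ Finset.range m, σ.Dir (σ.U (k + l) w) ≤ Dm := by
    by_contra! hcon
    have hne : (Finset.range m).Nonempty := by
      rw [Finset.nonempty_range_iff]; rintro h0; simp [h0] at hm0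
    have h1 : ∑ l ∈ Finset.range m, σ.h * Dm < ∑ l ∈ Finset.range m, σ.h * σ.Dir (σ.U (k + l) w) :=
      Finset.sum_lt_sum_of_nonempty hne fun l hl => mul_lt_mul_of_pos_left (hcon l hl) hh
    rw [Finset.sum_const, Finset.card_range, nsmul_eq_mul] at h1
    have h2 : γ * (m * (σ.h * Dm)) < E := lt_of_lt_of_le (mul_lt_mul_of_pos_left h1 hγ) hsum
    have h3 : E ≤ γ * (m * (σ.h * Dm)) := by
      calc E = γ * (τ / 2 * Dm) := by rw [hDm]; field_simp
        _ ≤ γ * (m * σ.h * Dm) := by gcongr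
        _ = _ := by ring
    linarith
  have hlm : (l : ℝ) ≤ m := by exact_mod_cast (Finset.mem_range.1 hl).le
  have hlh : l * σ.h ≤ τ1 := by
    have : l * σ.h ≤ m * σ.h := by gcongr
    exact this.trans (hmh.trans (min_le_left _ _))
  have hklT : ((k + l : ℕ) : ℝ) * σ.h ≤ T := by
    refine le_trans ?_ hkmT
    push_cast; gcongr
  have hv := σ.U_IB (k + l) hIB
  have e1 : ∫ x, |σ.U k w x - σ.U (k + l) w x| ≤ η / 5 := by
    rw [U_add]
    refine (G.U_contr k hIB.1 (σ.U_integrable l hIB.1)).trans ?_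
    simp only [abs_sub_comm (w _)]
    exact Hτ σ δ G hδ1 hσγ l hlh
  have hvM : ∫ x, |σ.U (k + l) w x| ≤ ∫ x, |w x| := by
    simp only [abs_of_nonneg (G.U_nonneg _ hw0 _), abs_of_nonneg (hw0 _)]
    rw [σ.U_mass _ hIB.1]
  have hδ0 := G.δ_nonneg
  have hκ : ∀ z, ‖z‖ ≤ σ.ε' → ∫ x, |σ.U (k + l) w (x + z) - σ.U (k + l) w x| ≤ κ1 * δ := by
    intro z hz
    have h1 := σ.jump.iter_shift hh.le G.cfl1 hIB.1 z (G.s6 z hz) hδ0 (k + l)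
    refine h1.trans ?_
    have h2 := HA z ((hz.trans G.ε'_le).trans hδ1)
    have h3 : A * ‖z‖ ≤ A * δ := by gcongr; exact hz.trans G.ε'_le
    have h4 : ((k + l : ℕ) : ℝ) * σ.h * (2 * δ) * ∫ x, |w x| ≤ T * (2 * δ) * ∫ x, |w x| := by gcongr
    rw [hκ1]
    linarith
  have hΩ : ∀ z, ‖z‖ ≤ 2 * r → ∫ x in B, |σ.U (k + l) w (x + z) - σ.U (k + l) w x| ≤ 3 * ω := by
    intro z hz
    refine (σ.local_shift hv hBm hBf hμ0 hκ z hz).trans ?_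
    have h1 : volume.real B * μ ≤ ω := by
      rw [hμ, ← mul_div_assoc, div_le_iff₀ (by positivity)]
      nlinarith
    have h2 : μ⁻¹ * (2 ^ d * ((2 * r + σ.ε') ^ 2 * σ.Dir (σ.U (k + l) w))) ≤ ω := by
      have hε' : σ.ε' ≤ r := G.ε'_le.trans hδr
      have hε'0 := σ.ε'_pos
      have h5 := σ.Dir_nonneg (σ.U (k + l) w)
      calc _ ≤ μ⁻¹ * (2 ^ d * ((2 * r + r) ^ 2 * Dm)) := by gcongr
        _ = Y * (r * r) := by rw [hY]; ring
        _ ≤ Y * (r * 1) := by gcongr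
        _ ≤ ω := by rw [mul_one]; exact hYr
    linarith
  obtain ⟨f, hf, hfe⟩ := HF _ _ hv hvM hΩ
  refine ⟨f, hf, ?_⟩
  have e2 := HR σ δ G hδ1 hσγ (k + l) hklT
  have e3 : (2 : ℝ) ^ d * (3 * ω) = η / 5 := by rw [hω]; field_simp; norm_num
  rw [e3] at hfe
  have := l1_tri (σ.U_integrable k hIB.1) hv.1 (hFi f hf)
  linarith

theorem net (γ C : ℝ) (hγ : 0 < γ) (hC : 0 ≤ C) {g : (Fin d → ℝ) → ℝ} (hg : Integrable g)
    (hg0 : ∀ x, 0 ≤ g x) {t : ℝ} (ht : 0 ≤ t) {η : ℝ} (hη : 0 < η) :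
    ∃ δ0 > 0, ∃ F : Set ((Fin d → ℝ) → ℝ), F.Finite ∧ (∀ f ∈ F, Integrable f) ∧
      ∀ (σ : Scheme d) (δ : ℝ), σ.Good C δ → δ ≤ δ0 → σ.γ = γ →
        ∃ f ∈ F, ∫ x, |σ.U ⌊t / σ.h⌋₊ g x - f x| ≤ η := by
  obtain ⟨w, ws, wc, w0, wi, hw⟩ := exists_test_approx hg hg0 (by positivity : 0 < η / 2)
  obtain ⟨δ0, hδ0, F, hF, hFi, H⟩ := net_test γ C hγ hC ws wc w0 ht (by positivity : 0 < η / 2)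
  refine ⟨δ0, hδ0, F, hF, hFi, fun σ δ G hδ hσ => ?_⟩
  obtain ⟨f, hf, hfe⟩ := H σ δ G hδ hσ
  refine ⟨f, hf, ?_⟩
  have h1 := l1_tri (σ.U_integrable ⌊t / σ.h⌋₊ hg) (σ.U_integrable ⌊t / σ.h⌋₊ wi) (hFi f hf)
  have h2 := G.U_contr ⌊t / σ.h⌋₊ hg wi
  linarith

end Scheme


/-! ## Part 10: passage to the limit, abstract lemmas -/

/-- Arzela-Ascoli type extraction -/
theorem extract {X : Type*} [MetricSpace X] [CompleteSpace X] (V : ℕ → ℝ → X)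
    (hnet : ∀ t, 0 ≤ t → ∀ η > 0, ∃ n0 : ℕ, ∃ F : Set X, F.Finite ∧ ∀ n ≥ n0, ∃ f ∈ F, dist (V n t) f ≤ η)
    (heq : ∀ η > 0, ∃ τ > 0, ∃ n0 : ℕ, ∀ n ≥ n0, ∀ s t, 0 ≤ s → s ≤ t → t - s ≤ τ →
      dist (V n t) (V n s) ≤ η) :
    ∃ ψ : ℕ → ℕ, StrictMono ψ ∧ ∃ W : ℝ → X,
      (∀ t, 0 ≤ t → Tendsto (fun n => V (ψ n) t) atTop (nhds (W t))) := by
  have hcomp : ∀ q : ℚ, IsCompact (closure (Set.range fun n => V n |(q : ℝ)|)) := by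
    intro q
    refine TotallyBounded.isCompact_of_isClosed (TotallyBounded.closure ?_) isClosed_closure
    rw [Metric.totallyBounded_iff]
    intro ε hε
    obtain ⟨n0, F, hF, H⟩ := hnet |(q : ℝ)| (abs_nonneg _) (ε / 2) (by positivity)
    refine ⟨F ∪ Set.image (fun n => V n |(q : ℝ)|) (Set.Iio n0), hF.union ((Set.finite_Iio n0).image _), ?_⟩
    rintro _ ⟨n, rfl⟩
    simp only [Set.mem_iUnion, Metric.mem_ball, exists_prop]
    rcases lt_or_ge n n0 with h | h
    · exact ⟨_, Or.inr ⟨n, h, rfl⟩, by simpa using hε⟩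
    · obtain ⟨f, hf, hd⟩ := H n h
      exact ⟨f, Or.inl hf, by linarith⟩
  have hpi : IsCompact (Set.pi Set.univ fun q : ℚ => closure (Set.range fun n => V n |(q : ℝ)|)) :=
    isCompact_univ_pi hcomp
  obtain ⟨w, -, ψ, hψ, hw⟩ := hpi.tendsto_subseq (x := fun n (q : ℚ) => V n |(q : ℝ)|)
    (fun n q _ => subset_closure ⟨n, rfl⟩)
  rw [tendsto_pi_nhds] at hw
  refine ⟨ψ, hψ, ?_⟩
  have key : ∀ t : ℝ, ∃ W : X, 0 ≤ t → Tendsto (fun n => V (ψ n) t) atTop (nhds W) := by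
    intro t
    by_cases ht : 0 ≤ t
    swap
    · exact ⟨V 0 0, fun h => absurd h ht⟩
    suffices hC : CauchySeq fun n => V (ψ n) t by
      obtain ⟨W, hW⟩ := cauchySeq_tendsto_of_complete hC
      exact ⟨W, fun _ => hW⟩
    rw [Metric.cauchySeq_iff]
    intro ε hε
    obtain ⟨τ, hτ, n0, H⟩ := heq (ε / 4) (by positivity)
    obtain ⟨q, hq1, hq2⟩ := exists_rat_btwn (show t < t + τ by linarith)
    have hq0 : (0 : ℝ) ≤ q := by linarith
    have hqc := (hw q).cauchySeq
    rw [Metric.cauchySeq_iff] at hqc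
    obtain ⟨N, hN⟩ := hqc (ε / 4) (by positivity)
    refine ⟨max N n0, fun m hm n hn => ?_⟩
    have h1 := hN m ((le_max_left _ _).trans hm) n ((le_max_left _ _).trans hn)
    simp only [Function.comp, abs_of_nonneg hq0] at h1
    have h2 := H (ψ m) (((le_max_right _ _).trans hm).trans (hψ.id_le m)) t q ht hq1.le (by linarith)
    have h3 := H (ψ n) (((le_max_right _ _).trans hn).trans (hψ.id_le n)) t q ht hq1.le (by linarith)
    have h4 := dist_triangle4 (V (ψ m) t) (V (ψ m) q) (V (ψ n) q) (V (ψ n) t)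
    rw [dist_comm (V (ψ m) t) (V (ψ m) q)] at h4
    linarith
  choose W hW using key
  exact ⟨W, hW⟩

theorem l1_ae_subseq {d : ℕ} {v : ℕ → (Fin d → ℝ) → ℝ} {w : (Fin d → ℝ) → ℝ}
    (hv : ∀ n, Integrable (v n)) (hw : Integrable w)
    (h : Tendsto (fun n => ∫ x, |v n x - w x|) atTop (nhds 0)) :
    ∃ ns : ℕ → ℕ, StrictMono ns ∧ ∀ᵐ x, Tendsto (fun i => v (ns i) x) atTop (nhds (w x)) := by
  refine TendstoInMeasure.exists_seq_tendsto_ae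
    (tendstoInMeasure_of_tendsto_eLpNorm (p := 1) one_ne_zero (fun n => (hv n).aestronglyMeasurable)
      hw.aestronglyMeasurable ?_)
  have e : ∀ n, eLpNorm (v n - w) 1 volume = ENNReal.ofReal (∫ x, |v n x - w x|) := by
    intro n
    rw [eLpNorm_one_eq_lintegral_enorm, ← ofReal_integral_norm_eq_lintegral_enorm ((hv n).sub hw)]
    rfl
  simp only [e]
  have := (ENNReal.continuous_ofReal.tendsto 0).comp h
  rwa [ENNReal.ofReal_zero] at this

theorem clamp_abs_sub {a w v B : ℝ} (ha : |a| ≤ B * |v|) (hB : 0 ≤ B) :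
    |a - max (-(B * |w|)) (min a (B * |w|))| ≤ B * |v - w| := by
  have h1 : |v| - |w| ≤ |v - w| := abs_sub_abs_le_abs_sub v w
  have h2 : B * |v| ≤ B * |w| + B * |v - w| := by nlinarith
  have h3 : 0 ≤ B * |w| := by positivity
  have h4 : 0 ≤ B * |v - w| := by positivity
  rw [abs_le] at ha
  rcases le_total a (B * |w|) with h | h
  · rw [min_eq_left h]
    rcases le_total (-(B * |w|)) a with h' | h'
    · rw [max_eq_right h']; simpa using h4
    · rw [max_eq_left h', abs_le]; constructor <;> linarith
  · rw [min_eq_right h, max_eq_right (by linarith), abs_le]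
    constructor <;> linarith

/-- the limit lemma -/
theorem lim_lemma {d : ℕ} {v : ℕ → (Fin d → ℝ) → ℝ} {w : (Fin d → ℝ) → ℝ}
    (hv : ∀ n, Integrable (v n)) (hw : Integrable w) (hv0 : ∀ n, ∀ᵐ x, 0 ≤ v n x)
    (h : Tendsto (fun n => ∫ x, |v n x - w x|) atTop (nhds 0))
    (F : ℕ → (Fin d → ℝ) → ℝ → ℝ) (F' : (Fin d → ℝ) → ℝ → ℝ) {A : ℝ} (hA : 0 ≤ A)
    (hFc : ∀ n, Continuous fun p : (Fin d → ℝ) × ℝ => F n p.1 p.2)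
    (hFb : ∀ n x r, |F n x r| ≤ A * |r|) (hFb' : ∀ x r, |F' x r| ≤ A * |r|)
    (hF : ∀ x r, 0 ≤ r → Tendsto (fun p : ℕ × ℝ => F p.1 x p.2) (atTop ×ˢ nhdsWithin r (Set.Ici 0))
      (nhds (F' x r))) :
    Tendsto (fun n => ∫ x, F n x (v n x)) atTop (nhds (∫ x, F' x (w x))) := by
  refine tendsto_of_subseq_tendsto fun ns hns => ?_
  obtain ⟨ms, hms, hae⟩ := l1_ae_subseq (fun n => hv (ns n)) hw (h.comp hns)
  refine ⟨ms, ?_⟩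
  have hnm : Tendsto (fun i => ns (ms i)) atTop atTop := hns.comp hms.tendsto_atTop
  set c : ℕ → (Fin d → ℝ) → ℝ := fun i x =>
    max (-(A * |w x|)) (min (F (ns (ms i)) x (v (ns (ms i)) x)) (A * |w x|)) with hc
  have hFi : ∀ n, Integrable fun x => F n x (v n x) := fun n =>
    Scheme.integrable_comp_le (hFc n) (hFb n) (hv n)
  have hAw : Integrable fun x => A * |w x| := hw.abs.const_mul A
  have hcm : ∀ i, AEStronglyMeasurable (c i) volume := by
    intro i
    exact ((hAw.neg.aestronglyMeasurable).sup
      ((hFi _).aestronglyMeasurable.inf hAw.aestronglyMeasurable))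
  have hcb : ∀ i x, |c i x| ≤ A * |w x| := by
    intro i x
    have : 0 ≤ A * |w x| := by positivity
    rw [hc, abs_le]
    exact ⟨le_max_left _ _, max_le (by linarith) (min_le_right _ _)⟩
  have hci : ∀ i, Integrable (c i) := fun i =>
    hAw.mono' (hcm i) (Eventually.of_forall fun x => hcb i x)
  have hall : ∀ᵐ x, ∀ n, 0 ≤ v n x := ae_all_iff.2 hv0
  have l1 : Tendsto (fun i => ∫ x, c i x) atTop (nhds (∫ x, F' x (w x))) := by
    refine tendsto_integral_of_dominated_convergence (fun x => A * |w x|) hcm hAw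
      (fun i => Eventually.of_forall fun x => hcb i x) ?_
    filter_upwards [hae, hall] with x hx hx0
    have hw0 : 0 ≤ w x := ge_of_tendsto' hx fun i => hx0 _
    have e1 : Tendsto (fun i => F (ns (ms i)) x (v (ns (ms i)) x)) atTop (nhds (F' x (w x))) := by
      refine (hF x (w x) hw0).comp (hnm.prodMk (tendsto_nhdsWithin_iff.2 ⟨hx, ?_⟩))
      exact Eventually.of_forall fun i => hx0 _
    have e2 : F' x (w x) = max (-(A * |w x|)) (min (F' x (w x)) (A * |w x|)) := by
      have := abs_le.1 (hFb' x (w x))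
      rw [min_eq_left this.2, max_eq_right this.1]
    rw [e2]
    exact tendsto_const_nhds.max (e1.min tendsto_const_nhds)
  have l2 : Tendsto (fun i => (∫ x, F (ns (ms i)) x (v (ns (ms i)) x)) - ∫ x, c i x) atTop (nhds 0) := by
    have h0 : Tendsto (fun i => A * ∫ x, |v (ns (ms i)) x - w x|) atTop (nhds 0) := by
      simpa using (h.comp hnm).const_mul A
    refine squeeze_zero_norm (fun i => ?_) h0
    rw [← integral_sub (hFi _) (hci i), ← integral_const_mul, Real.norm_eq_abs]
    refine (abs_integral_le_integral_abs).trans ?_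
    refine integral_mono ((hFi _).fsub (hci i)).abs (((hv _).fsub hw).abs.const_mul A) fun x => ?_
    exact clamp_abs_sub (hFb _ _ _) hA
  have := l2.add l1
  simpa using this


/-! ## Part 11: the limit -/

theorem toL1_dist {d : ℕ} {f g : (Fin d → ℝ) → ℝ} (hf : Integrable f) (hg : Integrable g) :
    dist (hf.toL1 f) (hg.toL1 g) = ∫ x, |f x - g x| := by
  rw [dist_eq_norm, ← Integrable.toL1_sub, L1.norm_of_fun_eq_integral_norm]
  rfl

namespace Scheme
variable {d : ℕ}

/-- the approximate solutions -/
noncomputable def un (σ : Scheme d) (g : (Fin d → ℝ) → ℝ) (t : ℝ) : (Fin d → ℝ) → ℝ :=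
  σ.U ⌊t / σ.h⌋₊ g

theorem un_int (σ : Scheme d) {g : (Fin d → ℝ) → ℝ} (hg : Integrable g) (t : ℝ) :
    Integrable (σ.un g t) := σ.U_integrable _ hg

theorem floor_diff (σ : Scheme d) {s t : ℝ} (hs : 0 ≤ s) (hst : s ≤ t) :
    ∃ l : ℕ, ⌊t / σ.h⌋₊ = ⌊s / σ.h⌋₊ + l ∧ |l * σ.h - (t - s)| ≤ σ.h := by
  have hh := σ.h_pos
  have hle : ⌊s / σ.h⌋₊ ≤ ⌊t / σ.h⌋₊ := Nat.floor_le_floor (by gcongr)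
  obtain ⟨l, hl⟩ := Nat.exists_eq_add_of_le hle
  refine ⟨l, hl, ?_⟩
  have ht : 0 ≤ t := hs.trans hst
  have a1 : (⌊t / σ.h⌋₊ : ℝ) * σ.h ≤ t := by
    rw [← le_div_iff₀ hh]; exact Nat.floor_le (by positivity)
  have a2 : (⌊s / σ.h⌋₊ : ℝ) * σ.h ≤ s := by
    rw [← le_div_iff₀ hh]; exact Nat.floor_le (by positivity)
  have a3 := Nat.lt_floor_add_one (t / σ.h)
  have a4 := Nat.lt_floor_add_one (s / σ.h)
  rw [div_lt_iff₀ hh] at a3 a4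
  have e : (l : ℝ) * σ.h = (⌊t / σ.h⌋₊ : ℝ) * σ.h - (⌊s / σ.h⌋₊ : ℝ) * σ.h := by
    rw [hl]; push_cast; ring
  rw [e, abs_le]
  constructor <;> linarith

/-- a convergent sequence of schemes -/
structure Seq (γ C : ℝ) (σ : ℕ → Scheme d) (δ : ℕ → ℝ) (g : (Fin d → ℝ) → ℝ) : Prop where
  γ_pos : 0 < γ
  C_nonneg : 0 ≤ C
  good : ∀ n, (σ n).Good C (δ n)
  δ_lim : Tendsto δ atTop (nhds 0)
  γ_eq : ∀ n, (σ n).γ = γ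
  g_int : Integrable g
  g_nonneg : ∀ x, 0 ≤ g x

variable {γ C : ℝ} {σ : ℕ → Scheme d} {δ : ℕ → ℝ} {g : (Fin d → ℝ) → ℝ}

theorem Seq.ev_le (H : Seq γ C σ δ g) {η : ℝ} (hη : 0 < η) : ∃ n0 : ℕ, ∀ n ≥ n0, δ n ≤ η := by
  have := H.δ_lim.eventually (eventually_le_nhds hη)
  exact eventually_atTop.1 this

theorem Seq.un_equi (H : Seq γ C σ δ g) {η : ℝ} (hη : 0 < η) :
    ∃ τ > 0, ∃ n0 : ℕ, ∀ n ≥ n0, ∀ s t, 0 ≤ s → s ≤ t → t - s ≤ τ →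
      ∫ x, |(σ n).un g t x - (σ n).un g s x| ≤ η := by
  obtain ⟨τ, hτ, K⟩ := time_equi γ C H.γ_pos H.C_nonneg H.g_int H.g_nonneg hη
  obtain ⟨n0, hn0⟩ := H.ev_le (by positivity : 0 < min 1 (τ / 2))
  refine ⟨τ / 2, by positivity, n0, fun n hn s t hs hst hts => ?_⟩
  have hδ := hn0 n hn
  obtain ⟨l, hl, hlh⟩ := (σ n).floor_diff hs hst
  unfold un
  rw [hl]
  refine K (σ n) (δ n) (H.good n) (hδ.trans (min_le_left _ _)) (H.γ_eq n) _ l ?_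
  have h1 := (H.good n).h_le
  have h2 := hδ.trans (min_le_right _ _)
  have := (abs_le.1 hlh).2
  linarith

theorem Seq.exists_lim (H : Seq γ C σ δ g) :
    ∃ ψ : ℕ → ℕ, StrictMono ψ ∧ ∃ u : ℝ → (Fin d → ℝ) → ℝ, ∀ t, 0 ≤ t → Integrable (u t) ∧
      Tendsto (fun n => ∫ x, |(σ (ψ n)).un g t x - u t x|) atTop (nhds 0) := by
  obtain ⟨ψ, hψ, W, hW⟩ := extract (fun n t => ((σ n).un_int H.g_int t).toL1 _)
    (fun t ht η hη => by
      obtain ⟨δ0, hδ0, F, hF, hFi, K⟩ := net γ C H.γ_pos H.C_nonneg H.g_int H.g_nonneg ht hη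
      obtain ⟨n0, hn0⟩ := H.ev_le hδ0
      refine ⟨n0, Set.image (fun f : F => (hFi f.1 f.2).toL1 f.1) Set.univ, ?_, fun n hn => ?_⟩
      · have := hF.to_subtype
        exact Set.finite_univ.image _
      · obtain ⟨f, hf, hfe⟩ := K (σ n) (δ n) (H.good n) (hn0 n hn) (H.γ_eq n)
        refine ⟨_, ⟨⟨f, hf⟩, trivial, rfl⟩, ?_⟩
        rw [toL1_dist]
        exact hfe)
    (fun η hη => by
      obtain ⟨τ, hτ, n0, K⟩ := H.un_equi hη
      refine ⟨τ, hτ, n0, fun n hn s t hs hst hts => ?_⟩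
      rw [toL1_dist]
      exact K n hn s t hs hst hts)
  refine ⟨ψ, hψ, fun t => W t, fun t ht => ⟨L1.integrable_coeFn _, ?_⟩⟩
  have h1 := tendsto_iff_dist_tendsto_zero.1 (hW t ht)
  refine h1.congr fun n => ?_
  conv_lhs => rw [← Integrable.toL1_coeFn (W t) (L1.integrable_coeFn _)]
  rw [toL1_dist]

/-- limit data -/
structure Lim (γ C : ℝ) (σ : ℕ → Scheme d) (δ : ℕ → ℝ) (g : (Fin d → ℝ) → ℝ)
    (u : ℝ → (Fin d → ℝ) → ℝ) : Prop extends Seq γ C σ δ g where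
  int : ∀ t, 0 ≤ t → Integrable (u t)
  conv : ∀ t, 0 ≤ t → Tendsto (fun n => ∫ x, |(σ n).un g t x - u t x|) atTop (nhds 0)

variable {u : ℝ → (Fin d → ℝ) → ℝ}

theorem l1_comm (f g : (Fin d → ℝ) → ℝ) : ∫ x, |f x - g x| = ∫ x, |g x - f x| := by
  simp only [abs_sub_comm]

theorem Lim.equi (H : Lim γ C σ δ g u) {η : ℝ} (hη : 0 < η) :
    ∃ τ > 0, ∀ s t, 0 ≤ s → 0 ≤ t → |t - s| ≤ τ → ∫ x, |u t x - u s x| ≤ η := by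
  obtain ⟨τ, hτ, n0, K⟩ := H.un_equi hη
  have key : ∀ s t, 0 ≤ s → s ≤ t → t - s ≤ τ → ∫ x, |u t x - u s x| ≤ η := by
    intro s t hs hst hts
    have ht := hs.trans hst
    have h1 := ((H.conv t ht).add (tendsto_const_nhds (x := η))).add (H.conv s hs)
    simp only [zero_add, add_zero] at h1
    refine ge_of_tendsto h1 ?_
    filter_upwards [eventually_ge_atTop n0] with n hn
    have i1 := (σ n).un_int H.g_int t
    have i2 := (σ n).un_int H.g_int s
    have a1 := l1_tri (H.int t ht) i1 (H.int s hs)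
    have a2 := l1_tri i1 i2 (H.int s hs)
    have a3 := K n hn s t hs hst hts
    rw [l1_comm (u t) ((σ n).un g t)] at a1
    linarith
  refine ⟨τ, hτ, fun s t hs ht hst => ?_⟩
  rw [abs_le] at hst
  rcases le_total s t with h | h
  · exact key s t hs h hst.2
  · rw [l1_comm]; exact key t s ht h (by linarith)

theorem Lim.conv' (H : Lim γ C σ δ g u) {t : ℝ} (ht : 0 ≤ t) {s : ℕ → ℝ} (hs : ∀ n, 0 ≤ s n)
    (hst : Tendsto s atTop (nhds t)) :
    Tendsto (fun n => ∫ x, |(σ n).un g (s n) x - u t x|) atTop (nhds 0) := by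
  rw [Metric.tendsto_atTop]
  intro ε hε
  obtain ⟨τ, hτ, n0, K⟩ := H.un_equi (by positivity : 0 < ε / 3)
  obtain ⟨n1, hn1⟩ := Metric.tendsto_atTop.1 (H.conv t ht) (ε / 3) (by positivity)
  obtain ⟨n2, hn2⟩ := Metric.tendsto_atTop.1 hst τ hτ
  refine ⟨max n0 (max n1 n2), fun n hn => ?_⟩
  have a0 : n0 ≤ n := (le_max_left _ _).trans hn
  have a1 := hn1 n (((le_max_left _ _).trans (le_max_right _ _)).trans hn)
  have a2 := hn2 n (((le_max_right _ _).trans (le_max_right _ _)).trans hn)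
  rw [Real.dist_eq, sub_zero, abs_of_nonneg (integral_nonneg fun x => abs_nonneg _)] at a1 ⊢
  rw [Real.dist_eq, abs_lt] at a2
  have i1 := (σ n).un_int H.g_int t
  have i2 := (σ n).un_int H.g_int (s n)
  have a3 := l1_tri i2 i1 (H.int t ht)
  have a4 : ∫ x, |(σ n).un g (s n) x - (σ n).un g t x| ≤ ε / 3 := by
    rcases le_total (s n) t with h | h
    · rw [l1_comm]; exact K n a0 _ _ (hs n) h (by linarith)
    · exact K n a0 _ _ ht h (by linarith)
  linarith

theorem un_nonneg (H : Lim γ C σ δ g u) (n : ℕ) (t : ℝ) (x : Fin d → ℝ) : 0 ≤ (σ n).un g t x :=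
  (H.good n).U_nonneg _ H.g_nonneg x

theorem Lim.nonneg (H : Lim γ C σ δ g u) {t : ℝ} (ht : 0 ≤ t) : ∀ᵐ x, 0 ≤ u t x := by
  obtain ⟨ns, -, h⟩ := l1_ae_subseq (fun n => (σ n).un_int H.g_int t) (H.int t ht) (H.conv t ht)
  filter_upwards [h] with x hx
  exact ge_of_tendsto' hx fun n => un_nonneg H _ _ _

/-- integrals against bounded functions converge -/
theorem tendsto_integral_mul {v : ℕ → (Fin d → ℝ) → ℝ} {w : (Fin d → ℝ) → ℝ}
    (hv : ∀ n, Integrable (v n)) (hw : Integrable w)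
    (h : Tendsto (fun n => ∫ x, |v n x - w x|) atTop (nhds 0)) {φ : (Fin d → ℝ) → ℝ}
    (hφ : Continuous φ) {M : ℝ} (hM : ∀ x, |φ x| ≤ M) :
    Tendsto (fun n => ∫ x, φ x * v n x) atTop (nhds (∫ x, φ x * w x)) := by
  rw [tendsto_iff_norm_sub_tendsto_zero]
  have h0 : Tendsto (fun n => M * ∫ x, |v n x - w x|) atTop (nhds 0) := by
    simpa using h.const_mul M
  have hi : ∀ {f : (Fin d → ℝ) → ℝ}, Integrable f → Integrable fun x => φ x * f x := fun hf =>
    hf.bdd_mul hφ.aestronglyMeasurable (c := M) (Eventually.of_forall hM)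
  refine squeeze_zero (fun n => norm_nonneg _) (fun n => ?_) h0
  rw [← integral_sub (hi (hv n)) (hi hw), ← integral_const_mul, Real.norm_eq_abs]
  refine (abs_integral_le_integral_abs).trans ?_
  refine integral_mono ((hi (hv n)).fsub (hi hw)).abs (((hv n).fsub hw).abs.const_mul M) fun x => ?_
  simp only
  rw [← mul_sub, abs_mul]
  exact mul_le_mul_of_nonneg_right (hM x) (abs_nonneg _)

theorem Lim.mass (H : Lim γ C σ δ g u) {t : ℝ} (ht : 0 ≤ t) : ∫ x, u t x = ∫ x, g x := by
  have h1 := tendsto_integral_mul (fun n => (σ n).un_int H.g_int t) (H.int t ht) (H.conv t ht)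
    (φ := fun _ => 1) continuous_const (M := 1) (by simp)
  simp only [one_mul] at h1
  refine tendsto_nhds_unique h1 ?_
  have : ∀ n, ∫ x, (σ n).un g t x = ∫ x, g x := fun n => (σ n).U_mass _ H.g_int
  simp only [this]
  exact tendsto_const_nhds

theorem Lim.zero (H : Lim γ C σ δ g u) : u 0 =ᵐ[volume] g := by
  have h1 := H.conv 0 le_rfl
  have : ∀ n, (σ n).un g 0 = g := by
    intro n; unfold un U; simp [JumpData.iter_zero]
  simp only [this] at h1
  have h2 := (tendsto_nhds_unique h1 tendsto_const_nhds).symm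
  rw [integral_eq_zero_iff_of_nonneg (fun x => abs_nonneg _) (H.g_int.fsub (H.int 0 le_rfl)).abs] at h2
  filter_upwards [h2] with x hx
  have : |g x - u 0 x| = 0 := hx
  have := abs_eq_zero.1 this
  linarith

end Scheme


/-! ## Part 12: the weak equation -/

/-- bounded continuous coefficients -/
structure Coef {d : ℕ} (a : Fin d → Fin d → (Fin d → ℝ) → ℝ → ℝ)
    (b : Fin d → (Fin d → ℝ) → ℝ → ℝ) (M : ℝ) : Prop where
  M_nonneg : 0 ≤ M
  ac : ∀ i j, Continuous (fun p : (Fin d → ℝ) × ℝ => a i j p.1 p.2)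
  bc : ∀ i, Continuous (fun p : (Fin d → ℝ) × ℝ => b i p.1 p.2)
  ab : ∀ i j x r, |a i j x r| ≤ M
  bb : ∀ i x r, |b i x r| ≤ M

/-- the integrand of the weak formulation -/
def Fw {d : ℕ} (a : Fin d → Fin d → (Fin d → ℝ) → ℝ → ℝ)
    (b : Fin d → (Fin d → ℝ) → ℝ → ℝ) (p0 : (Fin d → ℝ) → ℝ) (p1 : Fin d → (Fin d → ℝ) → ℝ)
    (p2 : Fin d → Fin d → (Fin d → ℝ) → ℝ) (x : Fin d → ℝ) (r : ℝ) : ℝ :=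
  r * p0 x + (∑ i, ∑ j, a i j x r * r * p2 i j x) + r * ∑ i, b i x r * p1 i x

theorem Fw_cont {d : ℕ} {a : Fin d → Fin d → (Fin d → ℝ) → ℝ → ℝ}
    {b : Fin d → (Fin d → ℝ) → ℝ → ℝ} {M : ℝ} (hab : Coef a b M) {p0 : (Fin d → ℝ) → ℝ}
    {p1 : Fin d → (Fin d → ℝ) → ℝ} {p2 : Fin d → Fin d → (Fin d → ℝ) → ℝ} (h0 : Continuous p0)
    (h1 : ∀ i, Continuous (p1 i)) (h2 : ∀ i j, Continuous (p2 i j)) :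
    Continuous (fun p : (Fin d → ℝ) × ℝ => Fw a b p0 p1 p2 p.1 p.2) := by
  unfold Fw
  have := hab.ac; have := hab.bc
  fun_prop

theorem Fw_le {d : ℕ} {a : Fin d → Fin d → (Fin d → ℝ) → ℝ → ℝ}
    {b : Fin d → (Fin d → ℝ) → ℝ → ℝ} {M : ℝ} (hab : Coef a b M) {p0 : (Fin d → ℝ) → ℝ}
    {p1 : Fin d → (Fin d → ℝ) → ℝ} {p2 : Fin d → Fin d → (Fin d → ℝ) → ℝ} {K : ℝ} (hK : 0 ≤ K)
    (h0 : ∀ x, |p0 x| ≤ K)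
    (h1 : ∀ i x, |p1 i x| ≤ K) (h2 : ∀ i j x, |p2 i j x| ≤ K) (x : Fin d → ℝ) (r : ℝ) :
    |Fw a b p0 p1 p2 x r| ≤ (K + d * d * M * K + d * M * K) * |r| := by
  unfold Fw
  have hM := hab.M_nonneg
  have e0 : |r * p0 x| ≤ K * |r| := by
    rw [abs_mul, mul_comm]; exact mul_le_mul_of_nonneg_right (h0 x) (abs_nonneg _)
  have e2 : |∑ i, ∑ j, a i j x r * r * p2 i j x| ≤ d * d * M * K * |r| := by
    calc _ ≤ ∑ i : Fin d, ∑ j : Fin d, |a i j x r * r * p2 i j x| :=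
          (Finset.abs_sum_le_sum_abs _ _).trans
            (Finset.sum_le_sum fun i _ => Finset.abs_sum_le_sum_abs _ _)
      _ ≤ ∑ i : Fin d, ∑ j : Fin d, M * |r| * K := by
          refine Finset.sum_le_sum fun i _ => Finset.sum_le_sum fun j _ => ?_
          rw [abs_mul, abs_mul]
          exact mul_le_mul (mul_le_mul_of_nonneg_right (hab.ab i j x r) (abs_nonneg _)) (h2 i j x)
            (abs_nonneg _) (by positivity)
      _ = _ := by simp; ring
  have e1 : |r * ∑ i, b i x r * p1 i x| ≤ d * M * K * |r| := by
    rw [abs_mul]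
    calc _ ≤ |r| * ∑ i : Fin d, M * K := by
          refine mul_le_mul_of_nonneg_left ?_ (abs_nonneg _)
          refine (Finset.abs_sum_le_sum_abs _ _).trans (Finset.sum_le_sum fun i _ => ?_)
          rw [abs_mul]
          exact mul_le_mul (hab.bb i x r) (h1 i x) (abs_nonneg _) hM
      _ = _ := by simp; ring
  have := abs_add_le (r * p0 x + ∑ i, ∑ j, a i j x r * r * p2 i j x) (r * ∑ i, b i x r * p1 i x)
  have := abs_add_le (r * p0 x) (∑ i, ∑ j, a i j x r * r * p2 i j x)
  linarith

namespace Scheme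
variable {d : ℕ} {γ C : ℝ} {σ : ℕ → Scheme d} {δ : ℕ → ℝ} {g : (Fin d → ℝ) → ℝ}
  {u : ℝ → (Fin d → ℝ) → ℝ} {a : Fin d → Fin d → (Fin d → ℝ) → ℝ → ℝ}
  {b : Fin d → (Fin d → ℝ) → ℝ → ℝ} {M : ℝ}

/-- convergence of the schemes to the coefficients -/
def Cv (a : Fin d → Fin d → (Fin d → ℝ) → ℝ → ℝ)
  (b : Fin d → (Fin d → ℝ) → ℝ → ℝ) (σ : ℕ → Scheme d) : Prop :=
  ∀ (n : ℕ) (x : Fin d → ℝ) (s : ℝ), ‖x‖ ≤ n → 0 ≤ s → s ≤ n →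
    (∀ i j, |(σ n).Am i j x s - a i j x s * s| ≤ 1 / (n + 1)) ∧ ∀ i, (σ n).f i x s = b i x s * s

/-- the spatial weak integrand -/
noncomputable def Fs (a : Fin d → Fin d → (Fin d → ℝ) → ℝ → ℝ)
  (b : Fin d → (Fin d → ℝ) → ℝ → ℝ) (φ : (Fin d → ℝ) → ℝ) : (Fin d → ℝ) → ℝ → ℝ :=
  Fw a b (fun _ => 0) (fun i => pd i φ) (fun i j => pd2 i j φ)

theorem Qs_tendsto (hab : Coef a b M) (hcv : Cv a b σ) {φ : (Fin d → ℝ) → ℝ} {K : ℝ} (hφ : TF φ K)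
    (x : Fin d → ℝ) (r : ℝ) :
    Tendsto (fun p : ℕ × ℝ => (σ p.1).Qs φ x p.2) (atTop ×ˢ nhdsWithin r (Set.Ici 0))
      (nhds (Fs a b φ x r)) := by
  have hc : Continuous (fun p : (Fin d → ℝ) × ℝ => Fs a b φ p.1 p.2) :=
    Fw_cont hab continuous_const hφ.pdc hφ.pd2c
  have hcx : Continuous (fun s : ℝ => Fs a b φ x s) := hc.comp (by fun_prop : Continuous fun s : ℝ => (x, s))
  have l1 : Tendsto (fun p : ℕ × ℝ => Fs a b φ x p.2) (atTop ×ˢ nhdsWithin r (Set.Ici 0))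
      (nhds (Fs a b φ x r)) :=
    ((hcx.tendsto r).mono_left nhdsWithin_le_nhds).comp tendsto_snd
  have l2 : Tendsto (fun p : ℕ × ℝ => (σ p.1).Qs φ x p.2 - Fs a b φ x p.2)
      (atTop ×ˢ nhdsWithin r (Set.Ici 0)) (nhds 0) := by
    have h0 : Tendsto (fun p : ℕ × ℝ => (d * d * K) * (1 / ((p.1 : ℝ) + 1)))
        (atTop ×ˢ nhdsWithin r (Set.Ici 0)) (nhds 0) := by
      have := (tendsto_one_div_add_atTop_nhds_zero_nat (𝕜 := ℝ)).const_mul (d * d * K : ℝ)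
      rw [mul_zero] at this
      exact this.comp tendsto_fst
    refine squeeze_zero_norm' ?_ h0
    have ev1 : ∀ᶠ p : ℕ × ℝ in atTop ×ˢ nhdsWithin r (Set.Ici 0), ⌈max ‖x‖ (r + 1)⌉₊ ≤ p.1 :=
      tendsto_fst.eventually (eventually_ge_atTop _)
    have ev2 : ∀ᶠ p : ℕ × ℝ in atTop ×ˢ nhdsWithin r (Set.Ici 0), p.2 ∈ Set.Ici (0 : ℝ) :=
      tendsto_snd.eventually self_mem_nhdsWithin
    have ev3 : ∀ᶠ p : ℕ × ℝ in atTop ×ˢ nhdsWithin r (Set.Ici 0), p.2 ≤ r + 1 :=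
      tendsto_snd.eventually (nhdsWithin_le_nhds (eventually_le_nhds (by linarith)))
    filter_upwards [ev1, ev2, ev3] with p h1 h2 h3
    have h1' : max ‖x‖ (r + 1) ≤ (p.1 : ℝ) := (Nat.le_ceil _).trans (by exact_mod_cast h1)
    obtain ⟨ha, hb⟩ := hcv p.1 x p.2 ((le_max_left _ _).trans h1') h2
      (h3.trans ((le_max_right _ _).trans h1'))
    have e : (σ p.1).Qs φ x p.2 - Fs a b φ x p.2
        = ∑ i, ∑ j, ((σ p.1).Am i j x p.2 - a i j x p.2 * p.2) * pd2 i j φ x := by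
      unfold Qs Fs Fw
      simp only [hb, sub_mul, Finset.sum_sub_distrib, Finset.mul_sum, mul_zero, zero_add]
      have : ∑ i, b i x p.2 * p.2 * pd i φ x = ∑ i, p.2 * (b i x p.2 * pd i φ x) :=
        Finset.sum_congr rfl fun i _ => by ring
      rw [this]; ring
    rw [e, Real.norm_eq_abs]
    calc _ ≤ ∑ i : Fin d, ∑ j : Fin d, |((σ p.1).Am i j x p.2 - a i j x p.2 * p.2) * pd2 i j φ x| :=
          (Finset.abs_sum_le_sum_abs _ _).trans
            (Finset.sum_le_sum fun i _ => Finset.abs_sum_le_sum_abs _ _)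
      _ ≤ ∑ i : Fin d, ∑ j : Fin d, 1 / ((p.1 : ℝ) + 1) * K := by
          refine Finset.sum_le_sum fun i _ => Finset.sum_le_sum fun j _ => ?_
          rw [abs_mul]
          exact mul_le_mul (ha i j) (hφ.pd2b i j x) (abs_nonneg _) (by positivity)
      _ = _ := by simp; ring
  have := l2.add l1
  simpa using this

theorem Lim.conv_unif (H : Lim γ C σ δ g u) {t : ℝ} (ht : 0 ≤ t) {η : ℝ} (hη : 0 < η) :
    ∃ τ > 0, ∃ n0 : ℕ, ∀ n ≥ n0, ∀ s, 0 ≤ s → |s - t| ≤ τ →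
      ∫ x, |(σ n).un g s x - u t x| ≤ η := by
  obtain ⟨τ, hτ, n0, K⟩ := H.un_equi (by positivity : 0 < η / 2)
  obtain ⟨n1, hn1⟩ := Metric.tendsto_atTop.1 (H.conv t ht) (η / 2) (by positivity)
  refine ⟨τ, hτ, max n0 n1, fun n hn s hs hst => ?_⟩
  have a0 : n0 ≤ n := (le_max_left _ _).trans hn
  have a1 := hn1 n ((le_max_right _ _).trans hn)
  rw [Real.dist_eq, sub_zero, abs_of_nonneg (integral_nonneg fun x => abs_nonneg _)] at a1
  rw [abs_le] at hst
  have i1 := (σ n).un_int H.g_int t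
  have i2 := (σ n).un_int H.g_int s
  have a3 := l1_tri i2 i1 (H.int t ht)
  have a4 : ∫ x, |(σ n).un g s x - (σ n).un g t x| ≤ η / 2 := by
    rcases le_total s t with h | h
    · rw [l1_comm]; exact K n a0 _ _ hs h (by linarith)
    · exact K n a0 _ _ ht h (by linarith)
  linarith

set_option maxHeartbeats 1000000 in
theorem Lim.Qs_unif (H : Lim γ C σ δ g u) (hab : Coef a b M) (hcv : Cv a b σ)
    {φ : (Fin d → ℝ) → ℝ} {K : ℝ} (hφ : TF φ K) {t : ℝ} (ht : 0 ≤ t) {η : ℝ} (hη : 0 < η) :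
    ∃ τ > 0, ∃ n0 : ℕ, ∀ n ≥ n0, ∀ s, 0 ≤ s → |s - t| ≤ τ →
      |(∫ x, (σ n).Qs φ x ((σ n).un g s x)) - ∫ x, Fs a b φ x (u t x)| ≤ η := by
  by_contra! hcon
  have hp : ∀ m : ℕ, (0 : ℝ) < 1 / ((m : ℝ) + 1) := fun m => by positivity
  choose n hn s hs hst hbad using fun m : ℕ => hcon (1 / ((m : ℝ) + 1)) (hp m) m
  have hn' : Tendsto n atTop atTop := tendsto_atTop_mono hn tendsto_id
  have hs' : ∀ τ > 0, ∀ᶠ m in atTop, |s m - t| ≤ τ := by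
    intro τ hτ
    have := (tendsto_one_div_add_atTop_nhds_zero_nat (𝕜 := ℝ)).eventually (eventually_le_nhds hτ)
    filter_upwards [this] with m hm using (hst m).trans hm
  have hK := hφ.K_nonneg
  have hγ := H.γ_pos
  have hC := H.C_nonneg
  have hA2 : 0 ≤ A2 d γ C := by unfold A2; positivity
  have hM := hab.M_nonneg
  have hpos : 0 ≤ K * A2 d γ C + (K + d * d * M * K + d * M * K) := by positivity
  have hFb : ∀ m x r, |(σ (n m)).Qs φ x r| ≤
      (K * A2 d γ C + (K + d * d * M * K + d * M * K)) * |r| := by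
    intro m x r
    have h1 := (H.good (n m)).Qs_le hφ x r
    rw [H.γ_eq] at h1
    rw [add_mul]
    have : 0 ≤ (K + d * d * M * K + d * M * K) * |r| := by positivity
    linarith
  have hFb' : ∀ x r, |Fs a b φ x r| ≤
      (K * A2 d γ C + (K + d * d * M * K + d * M * K)) * |r| := by
    intro x r
    have h1 := Fw_le hab hK (p0 := fun _ => 0) (by simpa using hK) hφ.pdb hφ.pd2b x r
    rw [add_mul]
    have h2 : 0 ≤ K * A2 d γ C * |r| := by positivity
    unfold Fs
    linarith
  have hF : ∀ x r, 0 ≤ r → Tendsto (fun p : ℕ × ℝ => (σ (n p.1)).Qs φ x p.2)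
      (atTop ×ˢ nhdsWithin r (Set.Ici 0)) (nhds (Fs a b φ x r)) := by
    intro x r _
    have h1 : Tendsto (fun p : ℕ × ℝ => (n p.1, p.2)) (atTop ×ˢ nhdsWithin r (Set.Ici 0))
      (atTop ×ˢ nhdsWithin r (Set.Ici 0)) := (hn'.comp tendsto_fst).prodMk tendsto_snd
    have h2 := Qs_tendsto (σ := σ) hab hcv hφ x r
    have h3 := Tendsto.comp h2 h1
    simpa only [Function.comp_def] using h3
  have hcv' : Tendsto (fun m => ∫ x, |(σ (n m)).un g (s m) x - u t x|) atTop (nhds 0) := by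
    rw [Metric.tendsto_atTop]
    intro ε hε
    obtain ⟨τ, hτ, n0, Hc⟩ := H.conv_unif ht (half_pos hε)
    have := (hs' τ hτ).and (hn'.eventually (eventually_ge_atTop n0))
    obtain ⟨N, hN⟩ := eventually_atTop.1 this
    refine ⟨N, fun m hm => ?_⟩
    have h1 := Hc (n m) (hN m hm).2 (s m) (hs m) (hN m hm).1
    rw [Real.dist_eq, sub_zero, abs_of_nonneg (integral_nonneg fun x => abs_nonneg _)]
    linarith
  have hv : ∀ m, Integrable ((σ (n m)).un g (s m)) := fun m => (σ (n m)).un_int H.g_int _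
  have hv0 : ∀ m, ∀ᵐ x, 0 ≤ (σ (n m)).un g (s m) x :=
    fun m => Eventually.of_forall fun x => un_nonneg H _ _ x
  have hQc : ∀ m, Continuous fun p : (Fin d → ℝ) × ℝ => (σ (n m)).Qs φ p.1 p.2 :=
    fun m => (σ (n m)).Qs_cont hφ
  have key : Tendsto (fun m => ∫ x, (σ (n m)).Qs φ x ((σ (n m)).un g (s m) x)) atTop
      (nhds (∫ x, Fs a b φ x (u t x))) :=
    lim_lemma (v := fun m => (σ (n m)).un g (s m)) (w := u t) hv (H.int t ht) hv0 hcv'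
      (fun m => (σ (n m)).Qs φ) (Fs a b φ) hpos hQc hFb hFb' hF
  rw [Metric.tendsto_atTop] at key
  obtain ⟨N, hN⟩ := key η hη
  have h1 := hN N le_rfl
  have h2 := hbad N
  rw [Real.dist_eq] at h1
  linarith

set_option maxHeartbeats 1000000 in
theorem Lim.weak (H : Lim γ C σ δ g u) (hab : Coef a b M) (hcv : Cv a b σ)
    {φ : (Fin d → ℝ) → ℝ} {K : ℝ} (hφ : TF φ K) {t : ℝ} (ht : 0 ≤ t) {η : ℝ} (hη : 0 < η) :
    ∃ τ > 0, ∀ s, t ≤ s → s - t ≤ τ →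
      |(∫ x, φ x * u s x) - (∫ x, φ x * u t x) - (s - t) * ∫ x, Fs a b φ x (u t x)|
        ≤ η * (s - t) := by
  obtain ⟨τ, hτ, n0, HQ⟩ := H.Qs_unif hab hcv hφ ht hη
  refine ⟨τ / 2, by positivity, fun s hts hst => ?_⟩
  set q := ∫ x, Fs a b φ x (u t x) with hq
  have hs : 0 ≤ s := ht.trans hts
  obtain ⟨Mφ, hMφ⟩ := hφ.bdd
  have c1 := tendsto_integral_mul (fun n => (σ n).un_int H.g_int s) (H.int s hs) (H.conv s hs)
    hφ.cont hMφ
  have c2 := tendsto_integral_mul (fun n => (σ n).un_int H.g_int t) (H.int t ht) (H.conv t ht)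
    hφ.cont hMφ
  have hK := hφ.K_nonneg
  have hγ := H.γ_pos
  have hC := H.C_nonneg
  have hA1 : 0 ≤ A1 d γ C := by unfold A1; positivity
  have hm0 : 0 ≤ ∫ x, |g x| := integral_nonneg fun x => abs_nonneg _
  have lhs : Tendsto (fun n => |(∫ x, φ x * (σ n).un g s x) - (∫ x, φ x * (σ n).un g t x)
      - (s - t) * q|) atTop (nhds |(∫ x, φ x * u s x) - (∫ x, φ x * u t x) - (s - t) * q|) :=
    ((c1.sub c2).sub tendsto_const_nhds).abs
  have rhs : Tendsto (fun n => δ n * |q| + (s - t + δ n) * (η + K * (A1 d γ C * δ n) * ∫ x, |g x|))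
      atTop (nhds (0 * |q| + (s - t + 0) * (η + K * (A1 d γ C * 0) * ∫ x, |g x|))) := by
    have := H.δ_lim
    exact (this.mul_const _).add ((tendsto_const_nhds.add this).mul
      (tendsto_const_nhds.add (((this.const_mul _).const_mul _).mul_const _)))
  have e : 0 * |q| + (s - t + 0) * (η + K * (A1 d γ C * 0) * ∫ x, |g x|) = η * (s - t) := by ring
  rw [e] at rhs
  obtain ⟨n1, hn1⟩ := H.ev_le (by positivity : 0 < τ / 2)
  refine le_of_tendsto_of_tendsto lhs rhs ?_
  filter_upwards [eventually_ge_atTop n0, eventually_ge_atTop n1] with n hn0 hn1'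
  have G := H.good n
  have hδτ := hn1 n hn1'
  have hh := (σ n).h_pos
  have hhδ := G.h_le
  have hδ0 := G.δ_nonneg
  obtain ⟨l, hl, hlh⟩ := (σ n).floor_diff ht hts
  set k := ⌊t / (σ n).h⌋₊ with hk
  have hkt : |(k : ℝ) * (σ n).h - t| ≤ (σ n).h := by
    have a2 : (k : ℝ) * (σ n).h ≤ t := by
      rw [← le_div_iff₀ hh]; exact Nat.floor_le (by positivity)
    have a4 := Nat.lt_floor_add_one (t / (σ n).h)
    rw [div_lt_iff₀ hh] at a4
    rw [abs_le]
    constructor <;> linarith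
  set h := (σ n).h with hh'
  set I : ℕ → ℝ := fun j => ∫ x, φ x * (σ n).jump.gen ((σ n).U j g) x with hI
  have es : (∫ x, φ x * (σ n).un g s x) - (∫ x, φ x * (σ n).un g t x)
      = ∑ j ∈ Finset.range l, h * I (k + j) := by
    unfold un
    rw [hl]
    unfold U
    rw [(σ n).jump.integral_mul_iter _ H.g_int hφ.cont.aestronglyMeasurable hMφ (k + l),
      (σ n).jump.integral_mul_iter _ H.g_int hφ.cont.aestronglyMeasurable hMφ k,
      Finset.sum_range_add]
    simp only [hI, U]
    ring
  have ej : ∀ j ∈ Finset.range l, |h * I (k + j) - h * q| ≤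
      h * (η + K * (A1 d γ C * δ n) * ∫ x, |g x|) := by
    intro j hj
    have hjl : (j : ℝ) + 1 ≤ l := by exact_mod_cast Finset.mem_range.1 hj
    rw [← mul_sub, abs_mul, abs_of_pos hh]
    refine mul_le_mul_of_nonneg_left ?_ hh.le
    have b1 := G.gen_consist hφ ((σ n).U_integrable (k + j) H.g_int)
    rw [H.γ_eq n] at b1
    have b1' : ∫ x, |(σ n).U (k + j) g x| = ∫ x, |g x| := by
      simp only [abs_of_nonneg (G.U_nonneg _ H.g_nonneg _), abs_of_nonneg (H.g_nonneg _)]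
      exact (σ n).U_mass _ H.g_int
    rw [b1'] at b1
    have b2 := HQ n hn0 (((k + j : ℕ) : ℝ) * h) (by positivity) (by
      rw [abs_le] at *
      push_cast
      have : (j : ℝ) * h + h ≤ l * h := by nlinarith
      have : 0 ≤ (j : ℝ) * h := by positivity
      constructor <;> linarith)
    have b3 : (σ n).un g (((k + j : ℕ) : ℝ) * h) = (σ n).U (k + j) g := by
      unfold un
      rw [mul_div_cancel_right₀ _ hh.ne', Nat.floor_natCast]
    rw [b3] at b2
    have := abs_sub_le (I (k + j)) (∫ x, (σ n).Qs φ x ((σ n).U (k + j) g x)) q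
    linarith
  have e1 : |(∑ j ∈ Finset.range l, h * I (k + j)) - l * h * q| ≤
      l * h * (η + K * (A1 d γ C * δ n) * ∫ x, |g x|) := by
    have : (l : ℝ) * h * q = ∑ j ∈ Finset.range l, h * q := by simp; ring
    rw [this, ← Finset.sum_sub_distrib]
    refine (Finset.abs_sum_le_sum_abs _ _).trans ((Finset.sum_le_sum ej).trans ?_)
    simp; linarith
  rw [es]
  have e2 : (∑ j ∈ Finset.range l, h * I (k + j)) - (s - t) * q
      = ((∑ j ∈ Finset.range l, h * I (k + j)) - l * h * q) + (l * h - (s - t)) * q := by ring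
  rw [e2]
  refine (abs_add_le _ _).trans ?_
  rw [abs_mul]
  have e3 : |(l : ℝ) * h - (s - t)| * |q| ≤ δ n * |q| := by
    gcongr; exact hlh.trans hhδ
  have e4 : (l : ℝ) * h ≤ s - t + δ n := by
    have := (abs_le.1 hlh).2; linarith
  have e5 : l * h * (η + K * (A1 d γ C * δ n) * ∫ x, |g x|)
      ≤ (s - t + δ n) * (η + K * (A1 d γ C * δ n) * ∫ x, |g x|) := by gcongr
  linarith

end Scheme


/-! ## Part 13: the space-time weak formulation -/

theorem pdx_slice {d : ℕ} {φ : ℝ × (Fin d → ℝ) → ℝ} (h : Differentiable ℝ φ) (t : ℝ) (i : Fin d)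
    (x : Fin d → ℝ) : pd i (fun y => φ (t, y)) x = pdx i φ (t, x) := by
  unfold pd pdx
  have h1 : HasFDerivAt (fun y : Fin d → ℝ => (t, y)) (ContinuousLinearMap.inr ℝ ℝ (Fin d → ℝ)) x :=
    hasFDerivAt_prodMk_right t x
  have h2 := (h (t, x)).hasFDerivAt.comp x h1
  have h3 : fderiv ℝ (fun y => φ (t, y)) x
      = (fderiv ℝ φ (t, x)).comp (ContinuousLinearMap.inr ℝ ℝ (Fin d → ℝ)) := h2.fderiv
  rw [h3]
  simp

theorem pdx_smooth {d : ℕ} {φ : ℝ × (Fin d → ℝ) → ℝ} (h : ContDiff ℝ (⊤ : ℕ∞) φ) (i : Fin d) :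
    ContDiff ℝ (⊤ : ℕ∞) (pdx i φ) := by
  unfold pdx
  exact (h.fderiv_right (m := (⊤ : ℕ∞)) (by simp)).clm_apply contDiff_const

theorem pdt_smooth {d : ℕ} {φ : ℝ × (Fin d → ℝ) → ℝ} (h : ContDiff ℝ (⊤ : ℕ∞) φ) :
    ContDiff ℝ (⊤ : ℕ∞) (pdt φ) := by
  unfold pdt
  exact (h.fderiv_right (m := (⊤ : ℕ∞)) (by simp)).clm_apply contDiff_const

theorem pdxx_slice {d : ℕ} {φ : ℝ × (Fin d → ℝ) → ℝ} (h : ContDiff ℝ (⊤ : ℕ∞) φ) (t : ℝ)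
    (i j : Fin d) (x : Fin d → ℝ) : pd2 i j (fun y => φ (t, y)) x = pdxx i j φ (t, x) := by
  unfold pd2 pdxx
  have e : pd j (fun y => φ (t, y)) = fun y => pdx j φ (t, y) :=
    funext fun y => pdx_slice (h.differentiable (by simp)) t j y
  rw [e]
  exact pdx_slice ((pdx_smooth h j).differentiable (by simp)) t i x

theorem slice_tf {d : ℕ} {φ : ℝ × (Fin d → ℝ) → ℝ} (h : ContDiff ℝ (⊤ : ℕ∞) φ)
    (hc : HasCompactSupport φ) (t : ℝ) : ∃ K, TF (fun y => φ (t, y)) K := by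
  refine TF.exists (h.comp (contDiff_prodMk_right t)) ?_
  refine HasCompactSupport.intro (hc.isCompact.image continuous_snd) fun x hx => ?_
  by_contra h0
  exact hx ⟨(t, x), subset_tsupport _ h0, rfl⟩

/-- uniform bounds on all derivatives entering the weak form -/
theorem deriv_bounds {d : ℕ} {φ : ℝ × (Fin d → ℝ) → ℝ} (h : ContDiff ℝ (⊤ : ℕ∞) φ)
    (hc : HasCompactSupport φ) : ∃ K, 0 ≤ K ∧ (∀ p, |φ p| ≤ K) ∧ (∀ p, |pdt φ p| ≤ K) ∧
      (∀ i p, |pdx i φ p| ≤ K) ∧ (∀ i j p, |pdxx i j φ p| ≤ K) ∧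
      ∀ t s x, |φ (s, x) - φ (t, x) - (s - t) * pdt φ (t, x)| ≤ K * (s - t) ^ 2 := by
  obtain ⟨K0, hK0, b0, b1, -, t1, -, -⟩ := taylor_exists h hc
  have hx : ∀ i, ∃ K, ∀ p, |pdx i φ p| ≤ K := fun i =>
    (hc.fderiv_apply (𝕜 := ℝ) _).exists_bound_of_continuous (pdx_smooth h i).continuous
  have hxx : ∀ i j, ∃ K, ∀ p, |pdxx i j φ p| ≤ K := fun i j =>
    ((hc.fderiv_apply (𝕜 := ℝ) _).fderiv_apply (𝕜 := ℝ) _).exists_bound_of_continuous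
      (pdx_smooth (pdx_smooth h j) i).continuous
  obtain ⟨Kt, hKt⟩ : ∃ K, ∀ p, |pdt φ p| ≤ K :=
    (hc.fderiv_apply (𝕜 := ℝ) _).exists_bound_of_continuous (pdt_smooth h).continuous
  choose K1 hK1 using hx
  choose K2 hK2 using hxx
  have e1 : 0 ≤ ∑ i, |K1 i| := Finset.sum_nonneg fun _ _ => abs_nonneg _
  have e2 : 0 ≤ ∑ i, ∑ j, |K2 i j| :=
    Finset.sum_nonneg fun _ _ => Finset.sum_nonneg fun _ _ => abs_nonneg _
  have et := abs_nonneg Kt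
  refine ⟨K0 + |Kt| + (∑ i, |K1 i|) + ∑ i, ∑ j, |K2 i j|, by positivity, fun p => ?_, fun p => ?_,
    fun i p => ?_, fun i j p => ?_, fun t s x => ?_⟩
  · linarith [b0 p]
  · linarith [hKt p, le_abs_self Kt]
  · have := Finset.single_le_sum (f := fun i => |K1 i|) (fun _ _ => abs_nonneg _) (Finset.mem_univ i)
    linarith [hK1 i p, le_abs_self (K1 i)]
  · have h1 := Finset.single_le_sum (f := fun i => ∑ j, |K2 i j|)
      (fun _ _ => Finset.sum_nonneg fun _ _ => abs_nonneg _) (Finset.mem_univ i)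
    have h2 := Finset.single_le_sum (f := fun j => |K2 i j|)
      (fun _ _ => abs_nonneg _) (Finset.mem_univ j)

    linarith [hK2 i j p, le_abs_self (K2 i j)]
  · have := t1 (t, x) (s - t, 0)
    have e : ((t, x) : ℝ × (Fin d → ℝ)) + (s - t, 0) = (s, x) := by simp
    have e' : fderiv ℝ φ (t, x) (s - t, 0) = (s - t) * pdt φ (t, x) := by
      have : ((s - t, 0) : ℝ × (Fin d → ℝ)) = (s - t) • ((1 : ℝ), (0 : Fin d → ℝ)) := by simp
      rw [this, map_smul]; rfl
    have e'' : ‖((s - t, 0) : ℝ × (Fin d → ℝ))‖ ^ 2 = (s - t) ^ 2 := by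
      simp [Prod.norm_def]
    rw [e, e', e''] at this
    refine this.trans ?_
    have := sq_nonneg (s - t)
    gcongr
    linarith

namespace Scheme
variable {d : ℕ} {γ C : ℝ} {σ : ℕ → Scheme d} {δ : ℕ → ℝ} {g : (Fin d → ℝ) → ℝ}
  {u : ℝ → (Fin d → ℝ) → ℝ} {a : Fin d → Fin d → (Fin d → ℝ) → ℝ → ℝ}
  {b : Fin d → (Fin d → ℝ) → ℝ → ℝ} {M : ℝ}

theorem Lim.cont_l1 (H : Lim γ C σ δ g u) {t : ℝ} (ht : 0 ≤ t) :
    Tendsto (fun s => ∫ x, |u s x - u t x|) (nhdsWithin t (Set.Ici 0)) (nhds 0) := by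
  rw [Metric.tendsto_nhdsWithin_nhds]
  intro ε hε
  obtain ⟨τ, hτ, K⟩ := H.equi (half_pos hε)
  refine ⟨τ, hτ, fun s hs hst => ?_⟩
  rw [Real.dist_eq] at hst
  have := K t s ht hs hst.le
  rw [Real.dist_eq, sub_zero, abs_of_nonneg (integral_nonneg fun x => abs_nonneg _)]
  linarith

theorem Lim.cont_W (H : Lim γ C σ δ g u) (W : ℝ → (Fin d → ℝ) → ℝ → ℝ)
    (hWc : Continuous fun p : ℝ × (Fin d → ℝ) × ℝ => W p.1 p.2.1 p.2.2) {A : ℝ} (hA : 0 ≤ A)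
    (hb : ∀ t x r, |W t x r| ≤ A * |r|) :
    ContinuousOn (fun t => ∫ x, W t x (u t x)) (Set.Ici 0) := by
  rw [continuousOn_iff_continuous_domRestrict, continuous_iff_seqContinuous]
  intro s t hst
  have hs1 : Tendsto (fun n => (s n : ℝ)) atTop (nhds (t : ℝ)) :=
    (continuous_subtype_val.tendsto t).comp hst
  have hs2 : Tendsto (fun n => (s n : ℝ)) atTop (nhdsWithin (t : ℝ) (Set.Ici 0)) :=
    tendsto_nhdsWithin_iff.2 ⟨hs1, Eventually.of_forall fun n => (s n).2⟩
  have hF : ∀ x r, 0 ≤ r → Tendsto (fun p : ℕ × ℝ => W (s p.1) x p.2)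
      (atTop ×ˢ nhdsWithin r (Set.Ici 0)) (nhds (W t x r)) := by
    intro x r _
    have h2 := hWc.tendsto ((t : ℝ), x, r)
    have h3 : Tendsto (fun p : ℕ × ℝ => ((s p.1 : ℝ), x, p.2))
        (atTop ×ˢ nhdsWithin r (Set.Ici 0)) (nhds ((t : ℝ), x, r)) :=
      (hs1.comp tendsto_fst).prodMk_nhds
        (tendsto_const_nhds.prodMk_nhds (tendsto_snd.mono_right nhdsWithin_le_nhds))
    have h4 := Tendsto.comp h2 h3
    simpa only [Function.comp_def] using h4
  have hc : ∀ n, Continuous fun p : (Fin d → ℝ) × ℝ => W (s n) p.1 p.2 := fun n =>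
    hWc.comp (by fun_prop : Continuous fun p : (Fin d → ℝ) × ℝ => ((s n : ℝ), p.1, p.2))
  exact lim_lemma (v := fun n => u (s n)) (w := u t) (fun n => H.int _ (s n).2) (H.int _ t.2)
    (fun n => H.nonneg (s n).2) ((H.cont_l1 t.2).comp hs2) (fun n => W (s n)) (W t) hA hc
    (fun n => hb _) (hb _) hF

theorem Lim.cont_weak (H : Lim γ C σ δ g u) {φ : (Fin d → ℝ) → ℝ} (hφ : Continuous φ)
    (hM : ∃ M : ℝ, ∀ x, |φ x| ≤ M) :
    ContinuousOn (fun t => ∫ x, φ x * u t x) (Set.Ici (0 : ℝ)) := by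
  obtain ⟨M, hM⟩ := hM
  refine H.cont_W (fun _ x r => φ x * r) (by fun_prop) (A := |M|) (abs_nonneg _) fun t x r => ?_
  rw [abs_mul]
  exact mul_le_mul_of_nonneg_right ((hM x).trans (le_abs_self _)) (abs_nonneg _)

set_option maxHeartbeats 1000000 in
theorem Lim.sol (H : Lim γ C σ δ g u) (hab : Coef a b M) (hcv : Cv a b σ) : IsFPESol a b u := by
  intro φ hφ hc hsupp
  obtain ⟨K, hK, k0, kt, kx, kxx, ktay⟩ := deriv_bounds hφ hc
  set W : ℝ → (Fin d → ℝ) → ℝ → ℝ := fun t => Fw a b (fun x => pdt φ (t, x))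
    (fun i x => pdx i φ (t, x)) (fun i j x => pdxx i j φ (t, x)) with hW
  set D : ℝ → ℝ := fun t => ∫ x, W t x (u t x) with hD
  set G : ℝ → ℝ := fun t => ∫ x, φ (t, x) * u t x with hG
  change ∫ t in Set.Ioi (0 : ℝ), D t = 0
  have hM := hab.M_nonneg
  have ct := (pdt_smooth hφ).continuous
  have cx := fun i => (pdx_smooth hφ i).continuous
  have cxx : ∀ i j, Continuous (pdxx i j φ) :=
    fun i j => (pdx_smooth (pdx_smooth hφ j) i).continuous
  have cφ := hφ.continuous
  have ca := hab.ac
  have cb := hab.bc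
  have hDc : ContinuousOn D (Set.Ici 0) := by
    refine H.cont_W W ?_ (A := K + d * d * M * K + d * M * K) (by positivity) fun t x r =>
      Fw_le hab hK (fun x => kt _) (fun i x => kx i _) (fun i j x => kxx i j _) x r
    simp only [hW, Fw]
    have ca' : ∀ i j, Continuous fun p : ℝ × (Fin d → ℝ) × ℝ => a i j p.2.1 p.2.2 := fun i j =>
      (ca i j).comp continuous_snd
    have cb' : ∀ i, Continuous fun p : ℝ × (Fin d → ℝ) × ℝ => b i p.2.1 p.2.2 := fun i =>
      (cb i).comp continuous_snd
    fun_prop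
  have hGc : ContinuousOn G (Set.Ici 0) := by
    refine H.cont_W (fun t x r => φ (t, x) * r) (by fun_prop) (A := K) hK fun t x r => ?_
    rw [abs_mul]
    exact mul_le_mul_of_nonneg_right (k0 _) (abs_nonneg _)
  have hm0 : 0 ≤ ∫ x, g x := integral_nonneg H.g_nonneg
  have hder : ∀ t, 0 ≤ t → HasDerivWithinAt G (D t) (Set.Ioi t) t := by
    intro t ht
    obtain ⟨K', hT⟩ := slice_tf hφ hc t
    have hK' := hT.K_nonneg
    rw [hasDerivWithinAt_iff_isLittleO, Asymptotics.isLittleO_iff]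
    intro c hc0
    set η := c / (2 + K + K * ∫ x, g x) with hη
    have hη0 : 0 < η := by positivity
    obtain ⟨τ1, hτ1, W1⟩ := H.weak hab hcv hT ht hη0
    obtain ⟨τ2, hτ2, W2⟩ := H.equi hη0
    have hev : ∀ᶠ s in nhdsWithin t (Set.Ioi t), s < t + min (min τ1 τ2) η :=
      nhdsWithin_le_nhds (eventually_lt_nhds (by
        have : 0 < min (min τ1 τ2) η := by positivity
        linarith))
    filter_upwards [hev, self_mem_nhdsWithin] with s hs hts
    have hts' : t < s := hts
    have hs0 : 0 ≤ s := ht.trans hts'.le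
    have m1 : s - t ≤ τ1 := by
      have := min_le_left (min τ1 τ2) η; have := min_le_left τ1 τ2; linarith
    have m2 : s - t ≤ τ2 := by
      have := min_le_left (min τ1 τ2) η; have := min_le_right τ1 τ2; linarith
    have m3 : s - t ≤ η := by
      have := min_le_right (min τ1 τ2) η; linarith
    have r1 := W1 s hts'.le m1
    have r2 := W2 t s ht hs0 (by rw [abs_of_pos (by linarith)]; exact m2)
    have ius := H.int s hs0
    have iut := H.int t ht
    have imul : ∀ {ψ f : (Fin d → ℝ) → ℝ}, Continuous ψ → (∀ x, |ψ x| ≤ K) → Integrable f →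
        Integrable fun x => ψ x * f x := fun hψ hb hf =>
      hf.bdd_mul hψ.aestronglyMeasurable (c := K) (Eventually.of_forall hb)
    have cs : ∀ s, Continuous fun x : Fin d → ℝ => φ (s, x) := fun s => by fun_prop
    have cts : Continuous fun x : Fin d → ℝ => pdt φ (t, x) := by fun_prop
    have iF : Integrable fun x => Fs a b (fun y => φ (t, y)) x (u t x) := by
      have hcF : Continuous (fun p : (Fin d → ℝ) × ℝ => Fs a b (fun y => φ (t, y)) p.1 p.2) :=
        Fw_cont hab continuous_const hT.pdc hT.pd2c
      refine Scheme.integrable_comp_le hcF (A := K' + d * d * M * K' + d * M * K') ?_ iut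
      intro x r
      exact Fw_le hab hK' (p0 := fun _ => 0) (by simpa using hK') hT.pdb hT.pd2b x r
    have eD : D t = (∫ x, Fs a b (fun y => φ (t, y)) x (u t x)) + ∫ x, pdt φ (t, x) * u t x := by
      rw [← integral_add iF (imul cts (fun x => kt _) iut)]
      simp only [hD, hW]
      congr 1; funext x
      unfold Fs Fw
      simp only [pdx_slice (hφ.differentiable (by simp)), pdxx_slice hφ]
      ring
    have eG : G s - G t - (s - t) * D t =
        ((∫ x, φ (t, x) * u s x) - (∫ x, φ (t, x) * u t x)
          - (s - t) * ∫ x, Fs a b (fun y => φ (t, y)) x (u t x))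
        + (∫ x, (φ (s, x) - φ (t, x) - (s - t) * pdt φ (t, x)) * u s x)
        + (s - t) * ∫ x, pdt φ (t, x) * (u s x - u t x) := by
      have e1 : ∫ x, (φ (s, x) - φ (t, x) - (s - t) * pdt φ (t, x)) * u s x
          = (∫ x, φ (s, x) * u s x) - (∫ x, φ (t, x) * u s x)
            - (s - t) * ∫ x, pdt φ (t, x) * u s x := by
        rw [← integral_const_mul, ← integral_sub (imul (cs s) (fun x => k0 _) ius)
          (imul (cs t) (fun x => k0 _) ius), ← integral_sub ((imul (cs s) (fun x => k0 _) ius).fsub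
          (imul (cs t) (fun x => k0 _) ius)) ((imul cts (fun x => kt _) ius).const_mul _)]
        congr 1; funext x; ring
      have e2 : ∫ x, pdt φ (t, x) * (u s x - u t x)
          = (∫ x, pdt φ (t, x) * u s x) - ∫ x, pdt φ (t, x) * u t x := by
        rw [← integral_sub (imul cts (fun x => kt _) ius) (imul cts (fun x => kt _) iut)]
        congr 1; funext x; ring
      rw [e1, e2, eD]
      simp only [hG]
      ring
    have n2 : |∫ x, (φ (s, x) - φ (t, x) - (s - t) * pdt φ (t, x)) * u s x|
        ≤ K * (s - t) ^ 2 * ∫ x, g x := by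
      have hm := H.mass hs0
      rw [← hm, ← integral_const_mul]
      rw [← Real.norm_eq_abs]
      refine norm_integral_le_of_norm_le (ius.const_mul _) ?_
      filter_upwards [H.nonneg hs0] with x hx
      rw [norm_mul, Real.norm_eq_abs, Real.norm_eq_abs, abs_of_nonneg hx]
      exact mul_le_mul_of_nonneg_right (ktay t s x) hx
    have n3 : |∫ x, pdt φ (t, x) * (u s x - u t x)| ≤ K * η := by
      refine le_trans ?_ (mul_le_mul_of_nonneg_left r2 hK)
      rw [← integral_const_mul, ← Real.norm_eq_abs]
      refine norm_integral_le_of_norm_le ((ius.fsub iut).abs.const_mul _) ?_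
      filter_upwards with x
      rw [norm_mul, Real.norm_eq_abs, Real.norm_eq_abs]
      exact mul_le_mul_of_nonneg_right (kt _) (abs_nonneg _)
    rw [smul_eq_mul, Real.norm_eq_abs, Real.norm_eq_abs, eG, abs_of_pos (by linarith : 0 < s - t)]
    have hst0 : 0 < s - t := by linarith
    have n3' : |(s - t) * ∫ x, pdt φ (t, x) * (u s x - u t x)| ≤ (s - t) * (K * η) := by
      rw [abs_mul, abs_of_pos hst0]
      exact mul_le_mul_of_nonneg_left n3 hst0.le
    have n2' : K * (s - t) ^ 2 * (∫ x, g x) ≤ (K * ∫ x, g x) * η * (s - t) := by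
      have : K * (s - t) ^ 2 * (∫ x, g x) = (K * ∫ x, g x) * (s - t) * (s - t) := by ring
      rw [this]
      gcongr
    have hce : c = (2 + K + K * ∫ x, g x) * η := by
      rw [hη]; field_simp
    have hηst : 0 ≤ η * (s - t) := by positivity
    refine (abs_add_three _ _ _).trans ?_
    rw [hce]
    nlinarith
  have hG0 : ∀ t, (∀ x, (t, x) ∉ tsupport φ) → G t = 0 := by
    intro t h
    simp only [hG, image_eq_zero_of_notMem_tsupport (h _), zero_mul, integral_zero]
  have hFTC : ∀ T, 0 ≤ T → ∫ t in (0 : ℝ)..T, D t = G T - G 0 := by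
    intro T hT
    refine intervalIntegral.integral_eq_sub_of_hasDeriv_right ?_ ?_ ?_
    · rw [Set.uIcc_of_le hT]; exact hGc.mono fun x hx => hx.1
    · rw [min_eq_left hT]; intro x hx; exact hder x hx.1.le
    · refine ContinuousOn.intervalIntegrable ?_
      rw [Set.uIcc_of_le hT]; exact hDc.mono fun x hx => hx.1
  by_cases hint : IntegrableOn D (Set.Ioi 0)
  · have l1 := intervalIntegral_tendsto_integral_Ioi 0 hint tendsto_id
    refine tendsto_nhds_unique l1 ?_
    refine Tendsto.congr' ?_ tendsto_const_nhds
    obtain ⟨R, hR⟩ := hc.isCompact.isBounded.subset_closedBall 0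
    filter_upwards [eventually_gt_atTop (max R 0)] with T hT
    have hT0 : 0 < T := (le_max_right _ _).trans_lt hT
    have hTR : R < T := (le_max_left _ _).trans_lt hT
    rw [id, hFTC T hT0.le, hG0 T, hG0 0, sub_zero]
    · intro x hx; exact lt_irrefl (0 : ℝ) (hsupp hx)
    · intro x hx
      have := hR hx
      rw [mem_closedBall_zero_iff] at this
      have h2 := norm_fst_le ((T, x) : ℝ × (Fin d → ℝ))
      simp only [Real.norm_eq_abs] at h2
      have := le_abs_self T
      linarith
  · exact integral_undef hint

end Scheme


/-! ## Part 14: from smooth decompositions to good schemes -/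

namespace Scheme
variable {d : ℕ}

/-- second difference versus difference of first derivatives -/
theorem s4_single {ρ : (Fin d → ℝ) → ℝ} (hρ : ContDiff ℝ (⊤ : ℕ∞) ρ) (hc : HasCompactSupport ρ)
    (v : Fin d → ℝ) : ∃ B, 0 ≤ B ∧ ∀ ε, 0 < ε → ∀ x,
      |(ε ^ 2)⁻¹ * D2 ρ (ε • v) x - ∑ i, v i * (fderiv ℝ ρ (x + ε • ev i) v
        - fderiv ℝ ρ (x - ε • ev i) v) / (2 * ε)| ≤ B * ε := by
  obtain ⟨K, hK, -, -, -, -, t2, t3⟩ := taylor_exists hρ hc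
  refine ⟨K * ‖v‖ ^ 3 + ∑ i : Fin d, |v i| * (K * ‖v‖), by positivity, fun ε hε x => ?_⟩
  have h3 := t3 x (ε • v)
  have e0 : fderiv ℝ (fderiv ℝ ρ) x (ε • v) (ε • v) = ε ^ 2 * fderiv ℝ (fderiv ℝ ρ) x v v := by
    simp only [map_smul, smul_apply, smul_eq_mul]; ring
  rw [e0, norm_smul, Real.norm_eq_abs, abs_of_pos hε] at h3
  have a1 : |(ε ^ 2)⁻¹ * D2 ρ (ε • v) x - fderiv ℝ (fderiv ℝ ρ) x v v| ≤ K * ‖v‖ ^ 3 * ε := by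
    have : (ε ^ 2)⁻¹ * D2 ρ (ε • v) x - fderiv ℝ (fderiv ℝ ρ) x v v
        = (ε ^ 2)⁻¹ * (D2 ρ (ε • v) x - ε ^ 2 * fderiv ℝ (fderiv ℝ ρ) x v v) := by
      field_simp
    rw [this, abs_mul, abs_of_pos (by positivity : 0 < (ε ^ 2)⁻¹)]
    calc _ ≤ (ε ^ 2)⁻¹ * (K * (ε * ‖v‖) ^ 3) :=
          mul_le_mul_of_nonneg_left h3 (by positivity)
      _ = _ := by field_simp
  have a2 : ∀ i, |(fderiv ℝ ρ (x + ε • ev i) v - fderiv ℝ ρ (x - ε • ev i) v) / (2 * ε)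
      - fderiv ℝ (fderiv ℝ ρ) x (ev i) v| ≤ K * ‖v‖ * ε := by
    intro i
    have hn : ‖ε • (ev i : Fin d → ℝ)‖ ≤ ε := by
      rw [norm_smul, Real.norm_eq_abs, abs_of_pos hε]
      have := norm_ev_le (d := d) i
      nlinarith
    have key : ∀ w : Fin d → ℝ, ‖w‖ ≤ ε → |fderiv ℝ ρ (x + w) v - fderiv ℝ ρ x v
        - fderiv ℝ (fderiv ℝ ρ) x w v| ≤ K * ε ^ 2 * ‖v‖ := by
      intro w hw
      have := (fderiv ℝ ρ (x + w) - fderiv ℝ ρ x - fderiv ℝ (fderiv ℝ ρ) x w).le_opNorm v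
      rw [Real.norm_eq_abs] at this
      refine this.trans (mul_le_mul_of_nonneg_right ((t2 x w).trans ?_) (norm_nonneg _))
      gcongr
    have k1 := key (ε • ev i) hn
    have k2 := key (-(ε • ev i)) (by rwa [norm_neg])
    rw [← sub_eq_add_neg] at k2
    simp only [map_smul, map_neg, smul_apply, smul_eq_mul,
      neg_apply] at k1 k2
    have : (fderiv ℝ ρ (x + ε • ev i) v - fderiv ℝ ρ (x - ε • ev i) v) / (2 * ε)
      - fderiv ℝ (fderiv ℝ ρ) x (ev i) v = (2 * ε)⁻¹ *
        (fderiv ℝ ρ (x + ε • ev i) v - fderiv ℝ ρ (x - ε • ev i) v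
          - 2 * (ε * fderiv ℝ (fderiv ℝ ρ) x (ev i) v)) := by field_simp
    rw [this, abs_mul, abs_of_pos (by positivity : 0 < (2 * ε)⁻¹)]
    have h5 : |fderiv ℝ ρ (x + ε • ev i) v - fderiv ℝ ρ (x - ε • ev i) v
          - 2 * (ε * fderiv ℝ (fderiv ℝ ρ) x (ev i) v)| ≤ 2 * (K * ε ^ 2 * ‖v‖) := by
      rw [abs_le] at *
      constructor <;> linarith [k1.1, k1.2, k2.1, k2.2]
    calc _ ≤ (2 * ε)⁻¹ * (2 * (K * ε ^ 2 * ‖v‖)) := mul_le_mul_of_nonneg_left h5 (by positivity)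
      _ = _ := by field_simp
  have e1 : fderiv ℝ (fderiv ℝ ρ) x v v = ∑ i, v i * fderiv ℝ (fderiv ℝ ρ) x (ev i) v := by
    have h1 : fderiv ℝ (fderiv ℝ ρ) x v = ∑ i, v i • fderiv ℝ (fderiv ℝ ρ) x (ev i) := by
      conv_lhs => rw [pi_eq_sum_univ' v]
      simp [ev]
    rw [h1]
    simp
  have a3 : |fderiv ℝ (fderiv ℝ ρ) x v v - ∑ i, v i * (fderiv ℝ ρ (x + ε • ev i) v
        - fderiv ℝ ρ (x - ε • ev i) v) / (2 * ε)| ≤ (∑ i : Fin d, |v i| * (K * ‖v‖)) * ε := by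
    rw [e1, ← Finset.sum_sub_distrib, Finset.sum_mul]
    refine (Finset.abs_sum_le_sum_abs _ _).trans (Finset.sum_le_sum fun i _ => ?_)
    rw [mul_div_assoc, ← mul_sub, abs_mul, abs_sub_comm, mul_assoc]
    exact mul_le_mul_of_nonneg_left (a2 i) (abs_nonneg _)
  have := abs_sub_le ((ε ^ 2)⁻¹ * D2 ρ (ε • v) x) (fderiv ℝ (fderiv ℝ ρ) x v v)
    (∑ i, v i * (fderiv ℝ ρ (x + ε • ev i) v - fderiv ℝ ρ (x - ε • ev i) v) / (2 * ε))
  linarith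

set_option maxHeartbeats 1000000 in
theorem exists_good {Q : Type} [fQ : Fintype Q] {ρ : Q → (Fin d → ℝ) → ℝ} {c : Q → ℝ → ℝ}
    {v : Q → (Fin d → ℝ)} {f : Fin d → (Fin d → ℝ) → ℝ → ℝ} {γ C Lf : ℝ} (hγ : 0 < γ) (hC : 1 ≤ C)
    (hρ : ∀ q, ContDiff ℝ (⊤ : ℕ∞) (ρ q)) (hρc : ∀ q, HasCompactSupport (ρ q))
    (hρ0 : ∀ q x, 0 ≤ ρ q x) (c_mono : ∀ q, Monotone (c q)) (c_zero : ∀ q, c q 0 = 0)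
    (c_lip : ∀ q r r', |c q r - c q r'| ≤ |r - r'|)
    (f_cont : ∀ i, Continuous (fun p : (Fin d → ℝ) × ℝ => f i p.1 p.2))
    (f_zero : ∀ i x, f i x 0 = 0) (hLf : 0 ≤ Lf)
    (f_lip : ∀ i x r r', |f i x r - f i x r'| ≤ Lf * |r - r'|)
    (f_unif : ∀ η > 0, ∃ τ > 0, ∀ z : Fin d → ℝ, ‖z‖ ≤ τ → ∀ i x r,
      |f i (x + z) r - f i x r| ≤ η * |r|)
    (s1 : ∀ i x s, |∑ q, c q s * (v q i * fderiv ℝ (ρ q) x (v q))| ≤ C * |s|)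
    (s2 : ∀ i j x s, |∑ q, ρ q x * c q s * (v q i * v q j)| ≤ C * |s|)
    (s3 : ∀ i x s, |f i x s| ≤ C * |s|) {δ : ℝ} (hδ : 0 < δ) :
    ∃ σ : Scheme d, σ.Good C δ ∧ σ.γ = γ ∧ σ.f = f ∧
      ∀ i j x r, σ.Am i j x r
        = (if i = j then γ * r else 0) + ∑ q, ρ q x * c q r * (v q i * v q j) := by
  choose K hK k0 k1 k2 kt1 kt2 kt3 using fun q => taylor_exists (hρ q) (hρc q)
  choose B hB hB4 using fun q => s4_single (hρ q) (hρc q) (v q)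
  have hlip : ∀ q, ∀ x z, |ρ q (x + z) - ρ q x| ≤ K q * ‖z‖ := by
    intro q x z
    have := Convex.norm_image_sub_le_of_norm_fderiv_le (𝕜 := ℝ) (f := ρ q) (s := Set.univ)
      (C := K q) (fun y _ => (hρ q).differentiable (by simp) y) (fun y _ => k1 q y) convex_univ
      (Set.mem_univ x) (Set.mem_univ (x + z))
    simpa using this
  have hc1 : ∀ q r, |c q r| ≤ |r| := by
    intro q r
    have := c_lip q r 0
    simpa [c_zero] using this
  set L : ℝ := 1 + ∑ q, K q * (1 + ‖v q‖) with hL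
  have hL0 : 0 ≤ ∑ q, K q * (1 + ‖v q‖) :=
    Finset.sum_nonneg fun q _ => mul_nonneg (hK q) (by positivity)
  have hL1 : 1 ≤ L := by linarith
  have hKL : ∀ q, K q * (1 + ‖v q‖) ≤ L := fun q => by
    have := Finset.single_le_sum (f := fun q => K q * (1 + ‖v q‖))
      (fun q _ => mul_nonneg (hK q) (by positivity)) (Finset.mem_univ q)
    linarith
  -- choice of ε
  set B4 : ℝ := L * ∑ q, B q with hB4'
  set B5 : ℝ := ∑ q, K q * ‖v q‖ ^ 3 with hB5'
  have b40 : 0 ≤ B4 := mul_nonneg (by linarith) (Finset.sum_nonneg fun q _ => hB q)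
  have b50 : 0 ≤ B5 := Finset.sum_nonneg fun q _ => mul_nonneg (hK q) (by positivity)
  obtain ⟨ε, hε, hεδ, hε4, hε5, hεf⟩ : ∃ ε : ℝ, 0 < ε ∧ ε ≤ δ ∧ ε * B4 ≤ C ∧ ε * B5 ≤ δ ∧
      ε * Lf ≤ γ := by
    have aux : ∀ Z W : ℝ, 0 ≤ Z → 0 < W → ∀ e, 0 ≤ e → e ≤ W / (Z + 1) → e * Z ≤ W := by
      intro Z W hZ hW e he hew
      rw [le_div_iff₀ (by linarith)] at hew
      nlinarith
    refine ⟨min (min δ (C / (B4 + 1))) (min (δ / (B5 + 1)) (γ / (Lf + 1))), by positivity,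
      (min_le_left _ _).trans (min_le_left _ _), aux _ _ b40 (by linarith) _ (by positivity)
      ((min_le_left _ _).trans (min_le_right _ _)), aux _ _ b50 hδ _ (by positivity)
      ((min_le_right _ _).trans (min_le_left _ _)), aux _ _ hLf hγ _ (by positivity)
      ((min_le_right _ _).trans (min_le_right _ _))⟩
  -- choice of ε'
  set Z : ℝ := (ε ^ 2)⁻¹ * ∑ q, K q with hZ
  have hZ0 : 0 ≤ Z := mul_nonneg (by positivity) (Finset.sum_nonneg fun q _ => hK q)
  obtain ⟨τ, hτ, hτf⟩ := f_unif (δ * ε / (2 * (d + 1))) (by positivity)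
  obtain ⟨ε', hε', hε'δ, hε'τ, hε'Z⟩ : ∃ ε' : ℝ, 0 < ε' ∧ ε' ≤ δ ∧ ε' ≤ τ ∧ 4 * (ε' * Z) ≤ δ := by
    refine ⟨min (min δ τ) (δ / (4 * (Z + 1))), by positivity,
      (min_le_left _ _).trans (min_le_left _ _), (min_le_left _ _).trans (min_le_right _ _), ?_⟩
    have h1 := min_le_right (min δ τ) (δ / (4 * (Z + 1)))
    have h0 : 0 ≤ min (min δ τ) (δ / (4 * (Z + 1))) := by positivity
    rw [le_div_iff₀ (by positivity)] at h1
    nlinarith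
  -- choice of h
  set J : ℝ := γ / ε ^ 2 + γ / ε' ^ 2 + (ε ^ 2)⁻¹ * (L * L) with hJ
  have hJ0 : 0 ≤ J := by positivity
  set n : ℝ := (Fintype.card ((Fin d × Bool) ⊕ ((Fin d × Bool) ⊕ (Q × Bool))) : ℝ) with hn
  have hn0 : 0 ≤ n := by positivity
  obtain ⟨h, hh, hhδ, hh1, hh2⟩ : ∃ h : ℝ, 0 < h ∧ h ≤ δ ∧ h * (n * J) ≤ 1 ∧
      h * (4 * n ^ 2 * J ^ 2) ≤ 1 := by
    have aux : ∀ Z : ℝ, 0 ≤ Z → ∀ e, 0 ≤ e → e ≤ 1 / (Z + 1) → e * Z ≤ 1 := by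
      intro Z hZ e he hew
      rw [le_div_iff₀ (by linarith)] at hew
      nlinarith
    exact ⟨min δ (min (1 / (n * J + 1)) (1 / (4 * n ^ 2 * J ^ 2 + 1))), by positivity,
      min_le_left _ _, aux _ (by positivity) _ (by positivity)
      ((min_le_right _ _).trans (min_le_left _ _)), aux _ (by positivity) _ (by positivity)
      ((min_le_right _ _).trans (min_le_right _ _))⟩
  let σ : Scheme d :=
    { Q := Q, fQ := fQ, ρ := ρ, c := c, v := v, f := f, γ := γ, ε := ε, ε' := ε', h := h, L := L
      Lf := Lf, γ_pos := hγ, ε_pos := hε, ε'_pos := hε', h_pos := hh, L_nonneg := by linarith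
      Lf_nonneg := hLf
      ρ_smooth := fun q => (hρ q).of_le (by norm_cast)
      ρ_nonneg := hρ0
      ρ_le := fun q x => by
        have h1 := k0 q x
        have h2 := hKL q
        have h3 := mul_nonneg (hK q) (norm_nonneg (v q))
        have := le_abs_self (ρ q x)
        linarith
      dρ_le := fun q x => by
        have h1 := (fderiv ℝ (ρ q) x).le_opNorm (v q)
        rw [Real.norm_eq_abs] at h1
        have h2 := mul_le_mul_of_nonneg_right (k1 q x) (norm_nonneg (v q))
        have h3 := hKL q
        have h4 := hK q
        linarith
      c_mono := c_mono, c_zero := c_zero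
      c_lip := fun q r r' => (c_lip q r r').trans (by
        have := abs_nonneg (r - r')
        nlinarith)
      f_cont := f_cont, f_zero := f_zero, f_lip := f_lip, f_small := hεf }
  refine ⟨σ, ?_, rfl, rfl, fun i j x r => rfl⟩
  refine ⟨by linarith, hδ.le, hh1, hh2, hhδ, hεδ, hε'δ, s1, s2, s3, ?_, ?_, ?_⟩
  · intro x s
    refine (Finset.abs_sum_le_sum_abs _ _).trans ?_
    have hterm : ∀ q ∈ (Finset.univ : Finset σ.Q), |σ.Ch q s * ((σ.ε ^ 2)⁻¹ * D2 (σ.ρ q) (σ.ε • σ.v q) x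
      - ∑ i, σ.v q i * (fderiv ℝ (σ.ρ q) (x + σ.ε • ev i) (σ.v q)
        - fderiv ℝ (σ.ρ q) (x - σ.ε • ev i) (σ.v q)) / (2 * σ.ε))| ≤ L * s ^ 2 * (B q * ε) := by
      intro q _
      rw [abs_mul]
      exact mul_le_mul (σ.Ch_le q s) (hB4 q ε hε x) (abs_nonneg _) (by positivity)
    refine (Finset.sum_le_sum hterm).trans ?_
    have e : ∑ q : Q, L * s ^ 2 * (B q * ε) = ε * B4 * s ^ 2 := by
      rw [hB4', Finset.mul_sum, Finset.mul_sum, Finset.sum_mul]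
      exact Finset.sum_congr rfl fun q _ => by ring
    refine (le_of_eq e).trans ?_
    exact mul_le_mul_of_nonneg_right hε4 (sq_nonneg s)
  · intro x s
    have : ∑ q : Q, ρ q x * |c q s| * ‖v q‖ ^ 3 ≤ B5 * |s| := by
      rw [hB5', Finset.sum_mul]
      refine Finset.sum_le_sum fun q _ => ?_
      have h1 := (le_abs_self _).trans (k0 q x)
      have h2 := hc1 q s
      have h3 := hK q
      have h4 := hρ0 q x
      calc ρ q x * |c q s| * ‖v q‖ ^ 3 ≤ K q * |s| * ‖v q‖ ^ 3 := by gcongr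
        _ = _ := by ring
    calc ε * ∑ q : Q, ρ q x * |c q s| * ‖v q‖ ^ 3 ≤ ε * (B5 * |s|) :=
          mul_le_mul_of_nonneg_left this hε.le
      _ = ε * B5 * |s| := by ring
      _ ≤ _ := mul_le_mul_of_nonneg_right hε5 (abs_nonneg _)
  · intro z hz x r
    have hz' : ‖z‖ ≤ ε' := hz
    have t1 : ∀ (i : Fin d) (b : Bool), |σ.jump.F (Sum.inl (i, b)) (x + z) r
        - σ.jump.F (Sum.inl (i, b)) x r| ≤ δ / (4 * (d + 1)) * |r| := by
      intro i b
      have e : σ.jump.F (Sum.inl (i, b)) (x + z) r - σ.jump.F (Sum.inl (i, b)) x r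
          = bsgn b * ((f i (x + z) r - f i x r) / (2 * ε)) := by
        change (γ / (2 * ε ^ 2) * r + bsgn b * (f i (x + z) r / (2 * ε)))
          - (γ / (2 * ε ^ 2) * r + bsgn b * (f i x r / (2 * ε))) = _
        ring
      rw [e, abs_mul, abs_bsgn, one_mul, abs_div, abs_of_pos (by positivity : 0 < 2 * ε),
        div_le_iff₀ (by positivity)]
      refine (hτf z (hz'.trans hε'τ) i x r).trans (le_of_eq ?_)
      field_simp
      ring
    have t2 : ∀ (i : Fin d) (b : Bool), |σ.jump.F (Sum.inr (Sum.inl (i, b))) (x + z) r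
        - σ.jump.F (Sum.inr (Sum.inl (i, b))) x r| = 0 := by
      intro i b
      change |(γ / (2 * ε' ^ 2) * r) - (γ / (2 * ε' ^ 2) * r)| = 0
      simp
    have t3 : ∀ (q : Q) (b : Bool), |σ.jump.F (Sum.inr (Sum.inr (q, b))) (x + z) r
        - σ.jump.F (Sum.inr (Sum.inr (q, b))) x r| ≤ (ε ^ 2)⁻¹ * K q * ε' * |r| := by
      intro q b
      change |((ε ^ 2)⁻¹ * (ρ q (x + z) * c q r)) - ((ε ^ 2)⁻¹ * (ρ q x * c q r))| ≤ _
      rw [← mul_sub, ← sub_mul, abs_mul, abs_mul, abs_of_pos (by positivity : 0 < (ε ^ 2)⁻¹)]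
      have h1 := hlip q x z
      have h2 := hc1 q r
      have h3 : K q * ‖z‖ ≤ K q * ε' := mul_le_mul_of_nonneg_left hz' (hK q)
      calc (ε ^ 2)⁻¹ * (|ρ q (x + z) - ρ q x| * |c q r|) ≤ (ε ^ 2)⁻¹ * ((K q * ε') * |r|) := by
            refine mul_le_mul_of_nonneg_left ?_ (by positivity)
            exact mul_le_mul (h1.trans h3) h2 (abs_nonneg _) (mul_nonneg (hK q) hε'.le)
        _ = _ := by ring
    rw [Fintype.sum_sum_type, Fintype.sum_sum_type, Fintype.sum_prod_type, Fintype.sum_prod_type,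
      Fintype.sum_prod_type]
    have u1 : ∑ i : Fin d, ∑ b : Bool, |σ.jump.F (Sum.inl (i, b)) (x + z) r
        - σ.jump.F (Sum.inl (i, b)) x r| ≤ δ / 2 * |r| := by
      calc _ ≤ ∑ i : Fin d, ∑ b : Bool, δ / (4 * (d + 1)) * |r| :=
            Finset.sum_le_sum fun i _ => Finset.sum_le_sum fun b _ => t1 i b
        _ = (d / (d + 1)) * (δ / 2 * |r|) := by
            simp only [Finset.sum_const, Finset.card_univ, Fintype.card_bool, Fintype.card_fin,
              nsmul_eq_mul]
            push_cast
            field_simp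
            ring
        _ ≤ 1 * (δ / 2 * |r|) := by
            refine mul_le_mul_of_nonneg_right ?_ (by positivity)
            rw [div_le_one (by positivity)]; linarith
        _ = _ := one_mul _
    have u2 : ∑ i : Fin d, ∑ b : Bool, |σ.jump.F (Sum.inr (Sum.inl (i, b))) (x + z) r
        - σ.jump.F (Sum.inr (Sum.inl (i, b))) x r| = 0 :=
      Finset.sum_eq_zero fun i _ => Finset.sum_eq_zero fun b _ => t2 i b
    have u3 : ∑ q : σ.Q, ∑ b : Bool, |σ.jump.F (Sum.inr (Sum.inr (q, b))) (x + z) r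
        - σ.jump.F (Sum.inr (Sum.inr (q, b))) x r| ≤ δ / 2 * |r| := by
      have hs : ∑ q : Q, ∑ b : Bool, (ε ^ 2)⁻¹ * K q * ε' * |r| = 2 * (ε' * Z) * |r| := by
        rw [hZ]
        simp only [Finset.sum_const, Finset.card_univ, Fintype.card_bool, nsmul_eq_mul,
          Finset.mul_sum, Finset.sum_mul]
        exact Finset.sum_congr rfl fun q _ => by push_cast; ring
      refine (Finset.sum_le_sum fun q _ => Finset.sum_le_sum fun b _ => t3 q b).trans
        ((le_of_eq hs).trans ?_)
      exact mul_le_mul_of_nonneg_right (by linarith) (abs_nonneg _)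
    rw [u2]
    linarith

end Scheme


/-! ## Part 15: discretisation of the coefficients -/

/-- truncation -/
noncomputable def Tn (N s : ℝ) : ℝ := max 0 (min s N)
/-- slices of the truncation -/
noncomputable def cl (w : ℝ) (l : ℕ) (s : ℝ) : ℝ := max 0 (min (s - l * w) w)

theorem Tn_nonneg (N s : ℝ) : 0 ≤ Tn N s := le_max_left _ _

theorem Tn_le_abs (N s : ℝ) : Tn N s ≤ |s| :=
  max_le (abs_nonneg _) ((min_le_left _ _).trans (le_abs_self _))

theorem Tn_le {N : ℝ} (hN : 0 ≤ N) (s : ℝ) : Tn N s ≤ N := max_le hN (min_le_right _ _)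

theorem Tn_of_mem {N s : ℝ} (h0 : 0 ≤ s) (h1 : s ≤ N) : Tn N s = s := by
  unfold Tn; rw [min_eq_left h1, max_eq_right h0]

theorem Tn_cont (N : ℝ) : Continuous (Tn N) := by unfold Tn; fun_prop

theorem Tn_lip (N r s : ℝ) : |Tn N r - Tn N s| ≤ |r - s| := by
  unfold Tn
  refine (abs_max_sub_max_le_max 0 _ 0 _).trans (max_le (by simp) ?_)
  exact (abs_min_sub_min_le_max _ _ _ _).trans (max_le le_rfl (by simp))

theorem cl_mono (w : ℝ) (l : ℕ) : Monotone (cl w l) := by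
  intro r s h
  unfold cl
  exact max_le_max le_rfl (min_le_min (by linarith) le_rfl)

theorem cl_zero {w : ℝ} (hw : 0 ≤ w) (l : ℕ) : cl w l 0 = 0 := by
  unfold cl
  have : (0 : ℝ) ≤ l * w := by positivity
  rw [max_eq_left]
  exact (min_le_left _ _).trans (by linarith)

theorem cl_lip (w : ℝ) (l : ℕ) (r s : ℝ) : |cl w l r - cl w l s| ≤ |r - s| := by
  have := Tn_lip w (r - l * w) (s - l * w)
  simpa [Tn, cl] using this

theorem cl_eq {w : ℝ} (hw : 0 ≤ w) (l : ℕ) (s : ℝ) :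
    cl w l s = Tn ((l + 1 : ℕ) * w) s - Tn (l * w) s := by
  unfold cl Tn
  have h1 : (0 : ℝ) ≤ l * w := by positivity
  push_cast
  rw [add_mul, one_mul]
  rcases le_total s (l * w) with h | h
  · rw [min_eq_left h, min_eq_left (by linarith : s ≤ l * w + w), sub_self, max_eq_left]
    exact (min_le_left _ _).trans (by linarith)
  · rw [min_eq_right h, max_eq_right h1]
    rcases le_total s (l * w + w) with h2 | h2
    · rw [min_eq_left h2, min_eq_left (by linarith), max_eq_right (by linarith),
        max_eq_right (by linarith)]
    · rw [min_eq_right h2, min_eq_right (by linarith), max_eq_right hw, max_eq_right (by linarith)]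
      ring

theorem disc_one {P m : ℝ → ℝ} (hP : ∀ r, HasDerivAt P (m r) r) (hP0 : P 0 = 0) {w η : ℝ}
    (hw : 0 < w) (hη : 0 ≤ η) (μ : ℕ → ℝ) (s : ℝ) (k : ℕ)
    (hμ : ∀ l < k, ∀ r, l * w ≤ r → r ≤ (l + 1 : ℕ) * w → |m r - μ l| ≤ η) :
    |(∑ l ∈ Finset.range k, cl w l s * μ l) - P (Tn (k * w) s)| ≤ η * Tn (k * w) s := by
  induction k with
  | zero => simp [Tn, hP0]
  | succ k ih =>
    have ih' := ih fun l hl => hμ l (hl.trans k.lt_succ_self)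
    rw [Finset.sum_range_succ, cl_eq hw.le]
    have hk0 : (0 : ℝ) ≤ k * w := by positivity
    have hk1 : ((k + 1 : ℕ) : ℝ) * w = k * w + w := by push_cast; ring
    have key : |P (Tn ((k + 1 : ℕ) * w) s) - P (Tn (k * w) s)
        - (Tn ((k + 1 : ℕ) * w) s - Tn (k * w) s) * μ k|
        ≤ η * (Tn ((k + 1 : ℕ) * w) s - Tn (k * w) s) := by
      rcases le_total s (k * w) with h | h
      · have : Tn ((k + 1 : ℕ) * w) s = Tn (k * w) s := by
          unfold Tn
          rw [min_eq_left h, min_eq_left (by rw [hk1]; linarith)]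
        rw [this]; simp
      · have e1 : Tn (k * w) s = k * w := by
          unfold Tn; rw [min_eq_right h, max_eq_right hk0]
        have e2 : k * w ≤ Tn ((k + 1 : ℕ) * w) s := by
          unfold Tn
          exact le_max_of_le_right (le_min h (by rw [hk1]; linarith))
        have e3 : Tn ((k + 1 : ℕ) * w) s ≤ (k + 1 : ℕ) * w := Tn_le (by rw [hk1]; linarith) s
        rw [e1]
        set T := Tn ((k + 1 : ℕ) * w) s
        have := Convex.norm_image_sub_le_of_norm_hasDerivWithin_le
          (f := fun r => P r - μ k * r) (f' := fun r => m r - μ k * 1) (C := η)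
          (s := Set.Icc (k * w : ℝ) ((k + 1 : ℕ) * w)) (x := k * w) (y := T)
          (fun r _ => ((hP r).sub ((hasDerivAt_id r).const_mul (μ k))).hasDerivWithinAt)
          (fun r hr => by
            rw [mul_one, Real.norm_eq_abs]
            exact hμ k k.lt_succ_self r hr.1 hr.2) (convex_Icc _ _)
          ⟨le_rfl, e2.trans e3⟩ ⟨e2, e3⟩
        rw [Real.norm_eq_abs, Real.norm_eq_abs, abs_of_nonneg (by linarith : 0 ≤ T - k * w)] at this
        refine le_trans (le_of_eq ?_) this
        congr 1; ring
    rw [abs_le] at *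
    constructor <;> nlinarith [ih'.1, ih'.2, key.1, key.2]

theorem disc_time {d : ℕ} {m P : Fin d → Fin d → (Fin d → ℝ) → ℝ → ℝ}
    (hm : ∀ i j, Continuous fun p : (Fin d → ℝ) × ℝ => m i j p.1 p.2)
    (hP : ∀ i j x r, HasDerivAt (P i j x) (m i j x r) r) (hP0 : ∀ i j x, P i j x 0 = 0) {R : ℝ}
    (hmR : ∀ i j x r, R ≤ ‖x‖ → m i j x r = 0) {N : ℝ} (hN : 0 < N) {η : ℝ} (hη : 0 < η) :
    ∃ (k : ℕ) (w r0 : ℝ), 0 < w ∧ 0 < r0 ∧ ∀ x y, ‖x - y‖ ≤ r0 → ∀ i j s,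
      |(∑ l : Fin k, cl w l s * m i j y (l * w)) - P i j x (Tn N s)| ≤ η * |s| := by
  have hmc : Continuous fun p : (Fin d → ℝ) × ℝ => fun i j => m i j p.1 p.2 :=
    continuous_pi fun i => continuous_pi fun j => hm i j
  have huc := ((isCompact_closedBall (0 : Fin d → ℝ) (R + 1)).prod
    (isCompact_Icc (a := (0 : ℝ)) (b := N))).uniformContinuousOn_of_continuous hmc.continuousOn
  rw [Metric.uniformContinuousOn_iff] at huc
  obtain ⟨τ, hτ, H⟩ := huc η hη
  obtain ⟨k, hk⟩ := exists_nat_gt (N / (τ / 2))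
  have hk0 : (0 : ℝ) < k := lt_of_le_of_lt (by positivity) hk
  have hw : N / k < τ / 2 := by
    rw [div_lt_iff₀ (by positivity)] at hk
    rw [div_lt_iff₀ hk0]; linarith
  have hw0 : 0 < N / k := by positivity
  have hkw : (k : ℝ) * (N / k) = N := by field_simp
  refine ⟨k, N / k, min (τ / 2) 1, hw0, by positivity, fun x y hxy i j s => ?_⟩
  have hxy1 : ‖x - y‖ ≤ 1 := hxy.trans (min_le_right _ _)
  have hxy2 : ‖x - y‖ < τ := lt_of_le_of_lt (hxy.trans (min_le_left _ _)) (by linarith)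
  rw [← Finset.sum_range (fun l => cl (N / k) l s * m i j y (l * (N / k)))]
  have := disc_one (hP i j x) (hP0 i j x) hw0 hη.le (fun l => m i j y (l * (N / k))) s k ?_
  · rw [hkw] at this
    exact this.trans (mul_le_mul_of_nonneg_left (Tn_le_abs _ _) hη.le)
  · intro l hl r hr1 hr2
    have hl' : ((l + 1 : ℕ) : ℝ) ≤ k := by exact_mod_cast hl
    have hl0 : (0 : ℝ) ≤ l * (N / k) := by positivity
    have hl2 : ((l + 1 : ℕ) : ℝ) * (N / k) ≤ N := by
      calc _ ≤ (k : ℝ) * (N / k) := mul_le_mul_of_nonneg_right hl' hw0.le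
        _ = N := hkw
    have hl3 : ((l + 1 : ℕ) : ℝ) * (N / k) = l * (N / k) + N / k := by push_cast; ring
    have t1 : ‖x‖ ≤ ‖x - y‖ + ‖y‖ := by simpa using norm_add_le (x - y) y
    have t2 : ‖y‖ ≤ ‖x - y‖ + ‖x‖ := by
      rw [norm_sub_rev]; simpa using norm_add_le (y - x) x
    by_cases hx : ‖x‖ ≤ R + 1 ∧ ‖y‖ ≤ R + 1
    · have h1 := H (x, r) ⟨by simpa using hx.1, by linarith, by linarith⟩ (y, l * (N / k))
        ⟨by simpa using hx.2, hl0, by linarith⟩ (by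
          rw [Prod.dist_eq]
          refine max_lt (by rwa [dist_eq_norm]) ?_
          rw [Real.dist_eq, abs_of_nonneg (by simpa using hr1)]
          simp only
          linarith)
      have h2 := (dist_pi_lt_iff hη).1 ((dist_pi_lt_iff hη).1 h1 i) j
      rw [Real.dist_eq] at h2
      exact h2.le
    · have hx' : R ≤ ‖x‖ ∧ R ≤ ‖y‖ := by
        by_contra hcon
        apply hx
        rw [not_and_or, not_le, not_le] at hcon
        rcases hcon with h | h <;> constructor <;> linarith
      rw [hmR i j x r hx'.1, hmR i j y _ hx'.2]
      simpa using hη.le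

/-- mollification estimates -/
theorem moll {d : ℕ} {g lam Φ : (Fin d → ℝ) → ℝ} {R e K δ L Mg : ℝ} (hg : Measurable g)
    (hgb : ∀ y, |g y| ≤ Mg) (he : 0 ≤ e) (hK : 0 ≤ K) (hL : 0 ≤ L)
    (hgl : ∀ y, |g y - lam y| ≤ e) (hlam : ∀ x y, |lam x - lam y| ≤ K * ‖x - y‖)
    (hgR : ∀ y, R < ‖y‖ → g y - lam y = 0) (hΦ : Continuous Φ)
    (hΦc : HasCompactSupport Φ) (hΦ0 : ∀ z, 0 ≤ Φ z) (hΦ1 : ∫ z, Φ z = 1)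
    (hΦδ : ∀ z, δ < ‖z‖ → Φ z = 0) (hΦL : ∀ x y, |Φ x - Φ y| ≤ L * ‖x - y‖) :
    (∀ x, |(∫ y, g y * Φ (x - y)) - lam x| ≤ e + K * δ) ∧
    ∀ x x', |(∫ y, g y * Φ (x - y)) - ∫ y, g y * Φ (x' - y)|
      ≤ (K + e * L * volume.real (Metric.closedBall (0 : Fin d → ℝ) R)) * ‖x - x'‖ := by
  have iΦ : Integrable Φ := hΦ.integrable_of_hasCompactSupport hΦc
  have iΦx : ∀ x, Integrable fun y => Φ (x - y) := fun x => iΦ.comp_sub_left x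
  have hlc : Continuous lam := by
    have : LipschitzWith (Real.toNNReal K) lam := by
      refine LipschitzWith.of_dist_le_mul fun r r' => ?_
      rw [Real.dist_eq, dist_eq_norm, Real.coe_toNNReal _ hK]
      exact hlam r r'
    exact this.continuous
  have hlb : ∀ y, |lam y| ≤ Mg + e := fun y => by
    have h1 := hgb y; have h2 := hgl y
    rw [abs_le] at *
    constructor <;> linarith [h1.1, h1.2, h2.1, h2.2]
  have ig : ∀ x, Integrable fun y => g y * Φ (x - y) := fun x =>
    (iΦx x).bdd_mul hg.aestronglyMeasurable (c := Mg) (Eventually.of_forall hgb)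
  have il : ∀ x, Integrable fun y => lam y * Φ (x - y) := fun x =>
    (iΦx x).bdd_mul hlc.aestronglyMeasurable (c := Mg + e) (Eventually.of_forall hlb)
  constructor
  · intro x
    have h1 : ∫ y, Φ (x - y) = 1 := by rw [integral_sub_left_eq_self]; exact hΦ1
    have e1 : (∫ y, g y * Φ (x - y)) - lam x = ∫ y, (g y - lam x) * Φ (x - y) := by
      simp only [sub_mul]
      rw [integral_sub (ig x) ((iΦx x).const_mul _), integral_const_mul, h1, mul_one]
    rw [e1, ← Real.norm_eq_abs]
    have e2 : e + K * δ = ∫ y, (e + K * δ) * Φ (x - y) := by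
      rw [integral_const_mul, h1, mul_one]
    rw [e2]
    refine norm_integral_le_of_norm_le ((iΦx x).const_mul _) (Eventually.of_forall fun y => ?_)
    rw [norm_mul, Real.norm_eq_abs, Real.norm_eq_abs, abs_of_nonneg (hΦ0 _)]
    by_cases hy : δ < ‖x - y‖
    · rw [hΦδ _ hy]; simp
    · refine mul_le_mul_of_nonneg_right ?_ (hΦ0 _)
      have a1 := abs_sub_le (g y) (lam y) (lam x)
      have a2 := hlam y x
      rw [norm_sub_rev] at a2
      have a3 := mul_le_mul_of_nonneg_left (not_lt.1 hy) hK
      linarith [hgl y]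
  · intro x x'
    have e1 : (∫ y, g y * Φ (x - y)) - (∫ y, g y * Φ (x' - y))
        = (∫ y, (g y - lam y) * (Φ (x - y) - Φ (x' - y)))
          + ((∫ y, lam y * Φ (x - y)) - ∫ y, lam y * Φ (x' - y)) := by
      have : ∀ y, (g y - lam y) * (Φ (x - y) - Φ (x' - y))
          = (g y * Φ (x - y) - g y * Φ (x' - y)) - (lam y * Φ (x - y) - lam y * Φ (x' - y)) :=
        fun y => by ring
      simp only [this]
      rw [integral_sub ((ig x).fsub (ig x')) ((il x).fsub (il x')), integral_sub (ig x) (ig x'),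
        integral_sub (il x) (il x')]
      ring
    have e2 : ∀ x, ∫ y, lam y * Φ (x - y) = ∫ z, lam (x - z) * Φ z := by
      intro x
      rw [← integral_sub_left_eq_self (fun z => lam (x - z) * Φ z) volume x]
      simp
    have il' : ∀ x, Integrable fun z => lam (x - z) * Φ z := fun x =>
      iΦ.bdd_mul (hlc.comp (by fun_prop : Continuous fun z => x - z)).aestronglyMeasurable
        (c := Mg + e) (Eventually.of_forall fun z => hlb _)
    have b2 : |(∫ y, lam y * Φ (x - y)) - ∫ y, lam y * Φ (x' - y)| ≤ K * ‖x - x'‖ := by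
      rw [e2, e2, ← integral_sub (il' x) (il' x'), ← Real.norm_eq_abs]
      have : K * ‖x - x'‖ = ∫ z, (K * ‖x - x'‖) * Φ z := by
        rw [integral_const_mul, hΦ1, mul_one]
      rw [this]
      refine norm_integral_le_of_norm_le (iΦ.const_mul _) (Eventually.of_forall fun y => ?_)
      rw [← sub_mul, norm_mul, Real.norm_eq_abs, Real.norm_eq_abs, abs_of_nonneg (hΦ0 _)]
      refine mul_le_mul_of_nonneg_right ?_ (hΦ0 _)
      have := hlam (x - y) (x' - y)
      rwa [sub_sub_sub_cancel_right] at this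
    have b1 : |∫ y, (g y - lam y) * (Φ (x - y) - Φ (x' - y))|
        ≤ e * L * volume.real (Metric.closedBall (0 : Fin d → ℝ) R) * ‖x - x'‖ := by
      have hfin : volume (Metric.closedBall (0 : Fin d → ℝ) R) < ⊤ := measure_closedBall_lt_top
      have : e * L * volume.real (Metric.closedBall (0 : Fin d → ℝ) R) * ‖x - x'‖
          = ∫ y, (Metric.closedBall (0 : Fin d → ℝ) R).indicator (fun _ => e * (L * ‖x - x'‖)) y := by
        rw [integral_indicator measurableSet_closedBall, setIntegral_const, smul_eq_mul]; ring
      rw [this, ← Real.norm_eq_abs]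
      refine norm_integral_le_of_norm_le ?_ (Eventually.of_forall fun y => ?_)
      · rw [integrable_indicator_iff measurableSet_closedBall]
        exact integrableOn_const hfin.ne
      · by_cases hy : R < ‖y‖
        · rw [hgR y hy, zero_mul, norm_zero]
          exact Set.indicator_nonneg (fun _ _ => by positivity) _
        · rw [Set.indicator_of_mem (by simpa using hy), norm_mul, Real.norm_eq_abs,
            Real.norm_eq_abs]
          refine mul_le_mul (hgl y) ?_ (abs_nonneg _) he
          have := hΦL (x - y) (x' - y)
          rwa [sub_sub_sub_cancel_right] at this
    rw [e1, add_mul]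
    refine (abs_add_le _ _).trans ?_
    linarith


/-! ## Part 16: decomposition of the diffusion matrix into jumps -/

open scoped MatrixOrder in
theorem psd_factor {d : ℕ} (m : Fin d → Fin d → ℝ) (hs : ∀ i j, m i j = m j i)
    (hp : ∀ ξ : Fin d → ℝ, 0 ≤ ∑ i, ∑ j, m i j * ξ i * ξ j) :
    ∃ B : Fin d → Fin d → ℝ, ∀ i j, m i j = ∑ k, B k i * B k j := by
  have hH : (Matrix.of m).IsHermitian := by
    ext i j
    simp [hs i j]
  have hP : (Matrix.of m).PosSemidef := by
    refine Matrix.PosSemidef.of_dotProduct_mulVec_nonneg hH fun ξ => ?_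
    refine (hp ξ).trans_eq ?_
    simp only [dotProduct, Matrix.mulVec, Matrix.of_apply, Pi.star_apply, star_trivial, Finset.mul_sum]
    exact Finset.sum_congr rfl fun i _ => Finset.sum_congr rfl fun j _ => by ring
  obtain ⟨B, hB⟩ := CStarAlgebra.nonneg_iff_eq_star_mul_self.mp hP.nonneg
  refine ⟨B, fun i j => ?_⟩
  have := congrFun (congrFun hB i) j
  simpa [Matrix.mul_apply, Matrix.star_apply] using this

theorem norm_single_le {d : ℕ} (j : Fin d) : ‖(Pi.single j 1 : Fin d → ℝ)‖ ≤ 1 := by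
  rw [Pi.norm_single]; simp

set_option maxHeartbeats 1000000 in
theorem decomp {d : ℕ} {m P : Fin d → Fin d → (Fin d → ℝ) → ℝ → ℝ}
    (hm : ∀ i j, Continuous fun p : (Fin d → ℝ) × ℝ => m i j p.1 p.2)
    (hP : ∀ i j x r, HasDerivAt (P i j x) (m i j x r) r) (hP0 : ∀ i j x, P i j x 0 = 0) {R : ℝ}
    (hmR : ∀ i j x r, R ≤ ‖x‖ → m i j x r = 0) (hPR : ∀ i j x r, R ≤ ‖x‖ → P i j x r = 0)
    (hsym : ∀ i j x r, m i j x r = m j i x r)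
    (hpsd : ∀ x r (ξ : Fin d → ℝ), 0 ≤ ∑ i, ∑ j, m i j x r * ξ i * ξ j)
    {C1 : ℝ} (hC1 : 0 ≤ C1)
    (hPl : ∀ i j x y r, 0 ≤ r → |P i j x r - P i j y r| ≤ C1 * ‖x - y‖ * r)
    {N : ℝ} (hN : 0 < N) {κ : ℝ} (hκ : 0 < κ) :
    ∃ (Q : Type) (_ : Fintype Q) (ρ : Q → (Fin d → ℝ) → ℝ) (c : Q → ℝ → ℝ) (v : Q → Fin d → ℝ),
      (∀ q, ContDiff ℝ (⊤ : ℕ∞) (ρ q)) ∧ (∀ q, HasCompactSupport (ρ q)) ∧ (∀ q x, 0 ≤ ρ q x) ∧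
      (∀ q, Monotone (c q)) ∧ (∀ q, c q 0 = 0) ∧ (∀ q r r', |c q r - c q r'| ≤ |r - r'|) ∧
      (∀ i x s, |∑ q, c q s * (v q i * fderiv ℝ (ρ q) x (v q))| ≤ d * (C1 + 1) * |s|) ∧
      (∀ i j x s, |(∑ q, ρ q x * c q s * (v q i * v q j)) - P i j x (Tn N s)| ≤ κ * |s|) := by
  -- the mollifier
  obtain ⟨δ, hδ, hδκ⟩ : ∃ δ : ℝ, 0 < δ ∧ C1 * δ ≤ κ / 2 := by
    refine ⟨κ / 2 / (C1 + 1), by positivity, ?_⟩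
    rw [mul_div_assoc', div_le_iff₀ (by positivity)]
    nlinarith
  let bump : ContDiffBump (0 : Fin d → ℝ) := ⟨δ / 2, δ, by linarith, by linarith⟩
  obtain ⟨Φ, hΦd⟩ : ∃ Φ : (Fin d → ℝ) → ℝ, Φ = bump.normed volume := ⟨_, rfl⟩
  have hΦs : ContDiff ℝ (⊤ : ℕ∞) Φ := hΦd ▸ bump.contDiff_normed
  have hΦc : HasCompactSupport Φ := hΦd ▸ bump.hasCompactSupport_normed
  have hΦ0 : ∀ z, 0 ≤ Φ z := fun z => hΦd ▸ bump.nonneg_normed z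
  have hΦ1 : ∫ z, Φ z = 1 := by rw [hΦd]; exact bump.integral_normed
  have hΦδ : ∀ z, δ < ‖z‖ → Φ z = 0 := fun z hz => by
    by_contra hne
    have : z ∈ Function.support Φ := hne
    rw [hΦd, bump.support_normed_eq] at this
    have h2 : ‖z‖ < δ := by simpa using this
    linarith
  obtain ⟨L, hL⟩ := ContDiff.lipschitzWith_of_hasCompactSupport hΦc hΦs (by simp)
  have hΦL : ∀ x y, |Φ x - Φ y| ≤ L * ‖x - y‖ := fun x y => by
    have := hL.dist_le_mul x y
    rwa [Real.dist_eq, dist_eq_norm] at this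
  set V := volume.real (Metric.closedBall (0 : Fin d → ℝ) R) with hV
  have hV0 : 0 ≤ V := measureReal_nonneg
  have hL0 : (0 : ℝ) ≤ L := L.2
  obtain ⟨η, hη, hηκ, hηL⟩ : ∃ η : ℝ, 0 < η ∧ η ≤ κ / 2 ∧ η * L * V ≤ 1 := by
    refine ⟨min (κ / 2) (1 / (L * V + 1)), by positivity, min_le_left _ _, ?_⟩
    have h1 : min (κ / 2) (1 / (L * V + 1)) ≤ 1 / (L * V + 1) := min_le_right _ _
    rw [mul_assoc]
    have h0 : 0 ≤ L * V := by positivity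
    refine (mul_le_mul_of_nonneg_right h1 h0).trans ?_
    rw [one_div, inv_mul_le_iff₀ (by positivity)]
    linarith
  obtain ⟨k, w, r0, hw, hr0, hdisc⟩ := disc_time hm hP hP0 hmR hN hη
  obtain ⟨K, p, Y, hpm, hpY⟩ := exists_disc d R hr0
  choose B hB using fun (x : Fin d → ℝ) (r : ℝ) =>
    psd_factor (fun i j => m i j x r) (fun i j => hsym i j x r) (hpsd x r)
  -- the cells
  let S : (Fin d → Fin K) → Set (Fin d → ℝ) := fun q => p ⁻¹' {q} ∩ Metric.closedBall 0 R
  have hSm : ∀ q, MeasurableSet (S q) := fun q =>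
    (hpm (MeasurableSet.singleton q)).inter measurableSet_closedBall
  have hΦc' : Continuous Φ := hΦs.continuous
  have iΦ : Integrable Φ := hΦc'.integrable_of_hasCompactSupport hΦc
  obtain ⟨ρ, hρ⟩ : ∃ ρ : (Fin d → Fin K) → (Fin d → ℝ) → ℝ,
      ∀ q x, ρ q x = ∫ y, (S q).indicator (fun _ => (1 : ℝ)) y * Φ (x - y) := ⟨_, fun _ _ => rfl⟩
  have iS : ∀ q x, Integrable fun y => (S q).indicator (fun _ => (1 : ℝ)) y * Φ (x - y) :=
    fun q x => (iΦ.comp_sub_left x).bdd_mul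
      (measurable_const.indicator (hSm q)).aestronglyMeasurable (c := 1)
      (Eventually.of_forall fun y => by
        by_cases hy : y ∈ S q <;> simp [hy])
  have hρs : ∀ q, ContDiff ℝ (⊤ : ℕ∞) (ρ q) := by
    intro q
    have hli : LocallyIntegrable ((S q).indicator fun _ => (1 : ℝ)) volume :=
      (locallyIntegrable_const 1).indicator (hSm q)
    have := HasCompactSupport.contDiff_convolution_right (n := (⊤ : ℕ∞))
      (ContinuousLinearMap.mul ℝ ℝ) hΦc hli hΦs
    convert this using 1
    ext x
    rw [hρ, convolution_def]
    rfl
  have hρ0 : ∀ q x, 0 ≤ ρ q x := fun q x => by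
    rw [hρ]
    exact integral_nonneg fun y =>
      mul_nonneg (Set.indicator_nonneg (fun _ _ => zero_le_one) _) (hΦ0 _)
  have hρc : ∀ q, HasCompactSupport (ρ q) := fun q => by
    refine hcs_of_zero (R := R + δ + 1) fun x hx => ?_
    rw [hρ]
    refine integral_eq_zero_of_ae (Eventually.of_forall fun y => ?_)
    by_cases hy : y ∈ S q
    · have hy2 : ‖y‖ ≤ R := by simpa using hy.2
      have : ‖x‖ ≤ ‖x - y‖ + ‖y‖ := by simpa using norm_add_le (x - y) y
      simp [hΦδ (x - y) (by linarith)]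
    · simp [hy]
  -- the averaged matrices
  obtain ⟨G0, hG0⟩ : ∃ G0 : Fin d → Fin d → ℝ → (Fin d → Fin K) → ℝ,
      ∀ i j s q, G0 i j s q = ∑ l : Fin k, cl w l s * m i j (Y q) (l * w) := ⟨_, fun _ _ _ _ => rfl⟩
  have quad : ∀ i j s (h : (Fin d → Fin K) → ℝ),
      ∑ q : (Fin d → Fin K) × Fin k × Fin d, h q.1 * cl w q.2.1 s *
        (B (Y q.1) (q.2.1 * w) q.2.2 i * B (Y q.1) (q.2.1 * w) q.2.2 j)
      = ∑ q, h q * G0 i j s q := by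
    intro i j s h
    simp only [Fintype.sum_prod_type, hG0, hB, Finset.mul_sum]
    exact Finset.sum_congr rfl fun _ _ => Finset.sum_congr rfl fun _ _ =>
      Finset.sum_congr rfl fun _ _ => by ring
  obtain ⟨G, hG⟩ : ∃ G : Fin d → Fin d → ℝ → (Fin d → ℝ) → ℝ,
      ∀ i j s, G i j s = (Metric.closedBall 0 R).indicator fun y => G0 i j s (p y) :=
    ⟨_, fun _ _ _ => rfl⟩
  have hGF : ∀ i j s x, ∑ q, ρ q x * G0 i j s q = ∫ y, G i j s y * Φ (x - y) := by
    intro i j s x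
    simp only [hρ, ← integral_mul_const]
    rw [← integral_finsetSum _ fun q _ => (iS q x).mul_const _]
    refine integral_congr_ae (Eventually.of_forall fun y => ?_)
    simp only [hG]
    by_cases hy : y ∈ Metric.closedBall (0 : Fin d → ℝ) R
    · rw [Set.indicator_of_mem hy, Finset.sum_eq_single (p y)]
      · rw [Set.indicator_of_mem (show y ∈ S (p y) from ⟨rfl, hy⟩)]; ring
      · intro q _ hq
        rw [Set.indicator_of_notMem (fun h : y ∈ S q => hq (Eq.symm h.1))]; ring
      · simp
    · rw [Set.indicator_of_notMem hy, Finset.sum_eq_zero, zero_mul]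
      intro q _
      rw [Set.indicator_of_notMem (fun h : y ∈ S q => hy h.2)]; ring
  have hmoll : ∀ i j s, (∀ x, |(∫ y, G i j s y * Φ (x - y)) - P i j x (Tn N s)|
        ≤ η * |s| + C1 * |s| * δ) ∧
      ∀ x x', |(∫ y, G i j s y * Φ (x - y)) - ∫ y, G i j s y * Φ (x' - y)|
        ≤ (C1 * |s| + η * |s| * L * V) * ‖x - x'‖ := by
    intro i j s
    refine moll (Mg := ∑ q, |G0 i j s q|) (lam := fun x => P i j x (Tn N s)) ?_ ?_
      (by positivity) (by positivity) hL0 ?_ ?_ ?_ hΦc' hΦc hΦ0 hΦ1 hΦδ hΦL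
    · rw [hG]
      exact ((Measurable.of_discrete (f := G0 i j s)).comp hpm).indicator measurableSet_closedBall
    · intro y
      rw [hG]
      by_cases hy : y ∈ Metric.closedBall (0 : Fin d → ℝ) R
      · rw [Set.indicator_of_mem hy]
        exact Finset.single_le_sum (f := fun q => |G0 i j s q|) (fun _ _ => abs_nonneg _)
          (Finset.mem_univ (p y))
      · rw [Set.indicator_of_notMem hy, abs_zero]
        exact Finset.sum_nonneg fun _ _ => abs_nonneg _
    · intro y
      rw [hG]
      by_cases hy : y ∈ Metric.closedBall (0 : Fin d → ℝ) R
      · rw [Set.indicator_of_mem hy, hG0]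
        exact hdisc y (Y (p y)) (hpY y (by simpa using hy)) i j s
      · rw [Set.indicator_of_notMem hy, hPR i j y _ (by
          have : R < ‖y‖ := by simpa using hy
          exact this.le)]
        simp only [sub_zero, abs_zero]; positivity
    · intro x y
      refine (hPl i j x y _ (Tn_nonneg N s)).trans ?_
      rw [mul_right_comm]
      exact mul_le_mul_of_nonneg_right
        (mul_le_mul_of_nonneg_left (Tn_le_abs _ _) hC1) (norm_nonneg _)
    · intro y hy
      rw [hG, hPR i j y _ hy.le, Set.indicator_of_notMem (by simpa using hy), sub_zero]
  refine ⟨(Fin d → Fin K) × Fin k × Fin d, inferInstance, fun q => ρ q.1, fun q => cl w q.2.1,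
    fun q => B (Y q.1) (q.2.1 * w) q.2.2, fun q => hρs _, fun q => hρc _, fun q => hρ0 _,
    fun q => cl_mono _ _, fun q => cl_zero hw.le _, fun q => cl_lip _ _, ?_, ?_⟩
  · intro i x s
    have e1 : ∑ q : (Fin d → Fin K) × Fin k × Fin d, cl w q.2.1 s *
        (B (Y q.1) (q.2.1 * w) q.2.2 i *
          fderiv ℝ (ρ q.1) x (B (Y q.1) (q.2.1 * w) q.2.2))
        = ∑ j, ∑ q, pd j (ρ q) x * G0 i j s q := by
      simp only [fderiv_eq_sum, ← quad, Finset.mul_sum]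
      rw [Finset.sum_comm]
      exact Finset.sum_congr rfl fun _ _ => Finset.sum_congr rfl fun _ _ => by ring
    rw [e1]
    have e2 : ∀ j, |∑ q, pd j (ρ q) x * G0 i j s q| ≤ (C1 + 1) * |s| := by
      intro j
      have hd : HasFDerivAt (fun x => ∑ q, ρ q x * G0 i j s q)
          (∑ q, G0 i j s q • fderiv ℝ (ρ q) x) x :=
        HasFDerivAt.fun_sum fun q _ =>
          (((hρs q).differentiable (by simp)) x).hasFDerivAt.mul_const (G0 i j s q)
      have hb := norm_fderiv_le_of_lip' ℝ (f := fun x => ∑ q, ρ q x * G0 i j s q) (x₀ := x)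
        (C := C1 * |s| + η * |s| * L * V) (by positivity) (Eventually.of_forall fun y => by
          simp only [hGF]
          rw [Real.norm_eq_abs]
          exact (hmoll i j s).2 y x)
      have e3 : ∑ q, pd j (ρ q) x * G0 i j s q
          = fderiv ℝ (fun x => ∑ q, ρ q x * G0 i j s q) x (Pi.single j 1) := by
        rw [hd.fderiv]
        simp only [pd, _root_.sum_apply, _root_.smul_apply, smul_eq_mul]
        exact Finset.sum_congr rfl fun _ _ => mul_comm _ _
      rw [e3, ← Real.norm_eq_abs]
      refine (ContinuousLinearMap.le_opNorm _ _).trans ?_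
      refine (mul_le_mul hb (norm_single_le j) (norm_nonneg _) (by positivity)).trans ?_
      have := mul_le_mul_of_nonneg_right hηL (abs_nonneg s)
      nlinarith
    refine (Finset.abs_sum_le_sum_abs _ _).trans ?_
    refine (Finset.sum_le_sum fun j _ => e2 j).trans (le_of_eq ?_)
    rw [Finset.sum_const, Finset.card_univ, Fintype.card_fin, nsmul_eq_mul, mul_assoc]
  · intro i j x s
    have := quad i j s (fun q => ρ q x)
    rw [this, hGF]
    refine ((hmoll i j s).1 x).trans ?_
    nlinarith [abs_nonneg s, mul_le_mul_of_nonneg_right hδκ (abs_nonneg s),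
      mul_le_mul_of_nonneg_right hηκ (abs_nonneg s)]


/-! ## Part 17: approximation of the coefficients -/

/-- drift part -/
theorem drift_lip {d : ℕ} {b : Fin d → (Fin d → ℝ) → ℝ → ℝ}
    (hb : ∀ i, ContDiff ℝ 1 (fun p : (Fin d → ℝ) × ℝ => b i p.1 p.2)) {R N : ℝ} :
    ∃ L : ℝ, 0 ≤ L ∧ ∀ i x r r', ‖x‖ ≤ R → 0 ≤ r → r ≤ N → 0 ≤ r' → r' ≤ N →
      |b i x r - b i x r'| ≤ L * |r - r'| := by
  have hK : IsCompact (Metric.closedBall (0 : Fin d → ℝ) R ×ˢ Set.Icc (0 : ℝ) N) :=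
    (isCompact_closedBall _ _).prod isCompact_Icc
  choose C hC using fun i =>
    hK.exists_bound_of_continuousOn ((hb i).continuous_fderiv (by simp)).continuousOn
  refine ⟨∑ i, |C i|, Finset.sum_nonneg fun _ _ => abs_nonneg _, fun i x r r' hx h1 h2 h3 h4 => ?_⟩
  have hx' : x ∈ Metric.closedBall (0 : Fin d → ℝ) R := by simpa using hx
  have := Convex.norm_image_sub_le_of_norm_fderiv_le (𝕜 := ℝ)
    (f := fun p : (Fin d → ℝ) × ℝ => b i p.1 p.2)
    (s := Metric.closedBall (0 : Fin d → ℝ) R ×ˢ Set.Icc (0 : ℝ) N) (C := C i)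
    (fun y _ => (hb i).differentiable (by simp) y) (hC i)
    ((convex_closedBall _ _).prod (convex_Icc _ _)) (x := (x, r')) (y := (x, r))
    ⟨hx', h3, h4⟩ ⟨hx', h1, h2⟩
  rw [Real.norm_eq_abs] at this
  refine this.trans ?_
  have e : ‖((x, r) : (Fin d → ℝ) × ℝ) - (x, r')‖ = |r - r'| := by
    rw [Prod.mk_sub_mk, sub_self, Prod.norm_mk, norm_zero, Real.norm_eq_abs,
      max_eq_right (abs_nonneg _)]
  rw [e]
  refine mul_le_mul_of_nonneg_right ?_ (abs_nonneg _)
  exact (le_abs_self _).trans (Finset.single_le_sum (f := fun i => |C i|)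
    (fun _ _ => abs_nonneg _) (Finset.mem_univ i))

theorem drift_unif {d : ℕ} {h : Fin d → (Fin d → ℝ) → ℝ → ℝ}
    (hc : ∀ i, Continuous (fun p : (Fin d → ℝ) × ℝ => h i p.1 p.2)) {R N : ℝ}
    (h0 : ∀ i x r, R ≤ ‖x‖ → h i x r = 0) {η : ℝ} (hη : 0 < η) :
    ∃ τ > 0, ∀ z : Fin d → ℝ, ‖z‖ ≤ τ → ∀ i x r, 0 ≤ r → r ≤ N →
      |h i (x + z) r - h i x r| ≤ η := by
  have hmc : Continuous fun p : (Fin d → ℝ) × ℝ => fun i => h i p.1 p.2 := continuous_pi hc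
  have huc := ((isCompact_closedBall (0 : Fin d → ℝ) (R + 1)).prod
    (isCompact_Icc (a := (0 : ℝ)) (b := N))).uniformContinuousOn_of_continuous hmc.continuousOn
  rw [Metric.uniformContinuousOn_iff] at huc
  obtain ⟨τ, hτ, H⟩ := huc η hη
  refine ⟨min (τ / 2) 1, by positivity, fun z hz i x r hr0 hr1 => ?_⟩
  have hz1 : ‖z‖ ≤ 1 := hz.trans (min_le_right _ _)
  have hz2 : ‖z‖ < τ := lt_of_le_of_lt (hz.trans (min_le_left _ _)) (by linarith)
  have t1 : ‖x + z‖ ≤ ‖x‖ + ‖z‖ := norm_add_le _ _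
  have t2 : ‖x‖ ≤ ‖x + z‖ + ‖z‖ := by simpa using norm_sub_le (x + z) z
  by_cases hx : ‖x‖ ≤ R + 1 ∧ ‖x + z‖ ≤ R + 1
  · have h1 := H (x + z, r) ⟨by simpa using hx.2, hr0, hr1⟩ (x, r)
      ⟨by simpa using hx.1, hr0, hr1⟩ (by
        rw [Prod.dist_eq]
        exact max_lt (by simpa [dist_eq_norm] using hz2) (by simpa using hτ))
    have h2 := (dist_pi_lt_iff hη).1 h1 i
    rw [Real.dist_eq] at h2
    exact h2.le
  · have hx' : R ≤ ‖x‖ ∧ R ≤ ‖x + z‖ := by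
      by_contra hcon
      apply hx
      rw [not_and_or, not_le, not_le] at hcon
      rcases hcon with h | h <;> constructor <;> linarith
    rw [h0 i x r hx'.1, h0 i _ r hx'.2]
    simpa using hη.le

set_option maxHeartbeats 1000000 in
theorem coef_scheme {d : ℕ} {a : Fin d → Fin d → (Fin d → ℝ) → ℝ → ℝ}
    {b : Fin d → (Fin d → ℝ) → ℝ → ℝ} {γ M : ℝ} (hM : 0 ≤ M)
    (ha : ∀ i j, ContDiff ℝ 2 (fun p : (Fin d → ℝ) × ℝ => a i j p.1 p.2))
    (hab : ∀ i j x r, |a i j x r| ≤ M)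
    (hax : ∀ i j x r, ‖fderiv ℝ (fun y => a i j y r) x‖ ≤ M)
    (has : ∀ i j x r, a i j x r = a j i x r) (hγ : 0 < γ)
    (hH2 : ∀ (x ξ : Fin d → ℝ) (r : ℝ),
      γ * ∑ i, ξ i ^ 2 ≤ ∑ i, ∑ j, (a i j x r + r * deriv (fun s => a i j x s) r) * ξ i * ξ j)
    (hb : ∀ i, ContDiff ℝ 1 (fun p : (Fin d → ℝ) × ℝ => b i p.1 p.2))
    (hbb : ∀ i x r, |b i x r| ≤ M)
    {θ : (Fin d → ℝ) → ℝ} {Kθ R : ℝ} (hθc : Continuous θ) (hθ0 : ∀ x, 0 ≤ θ x)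
    (hθ1 : ∀ x, θ x ≤ 1) (hK : 0 ≤ Kθ) (hθl : ∀ x y, |θ x - θ y| ≤ Kθ * ‖x - y‖)
    (hθR : ∀ x, R ≤ ‖x‖ → θ x = 0) {N κ δ C : ℝ} (hN : 0 < N) (hκ : 0 < κ) (hκ1 : κ ≤ 1)
    (hδ : 0 < δ) (hC1 : 1 + M + γ ≤ C) (hC2 : d * (M + Kθ * (M + γ) + 1) ≤ C) :
    ∃ σ : Scheme d, σ.Good C δ ∧ σ.γ = γ ∧ ∀ x s, θ x = 1 → 0 ≤ s → s ≤ N →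
      (∀ i j, |σ.Am i j x s - a i j x s * s| ≤ κ * s) ∧ ∀ i, σ.f i x s = b i x s * s := by
  have hAd : ∀ i j x r, HasDerivAt (fun s => a i j x s) (deriv (fun s => a i j x s) r) r := by
    intro i j x r
    have h1 : DifferentiableAt ℝ (fun p : (Fin d → ℝ) × ℝ => a i j p.1 p.2) (x, r) :=
      (ha i j).differentiable (by simp) _
    have h2 : DifferentiableAt ℝ (fun s => a i j x s) r :=
      h1.comp (f := fun s : ℝ => (x, s)) r (by fun_prop)
    exact h2.hasDerivAt
  have hAdc : ∀ i j, Continuous fun p : (Fin d → ℝ) × ℝ => deriv (fun s => a i j p.1 s) p.2 := by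
    intro i j
    have e : (fun p : (Fin d → ℝ) × ℝ => deriv (fun s => a i j p.1 s) p.2)
        = fun p => fderiv ℝ (fun p : (Fin d → ℝ) × ℝ => a i j p.1 p.2) p (0, 1) := by
      ext ⟨x, r⟩
      have h1 : HasFDerivAt (fun p : (Fin d → ℝ) × ℝ => a i j p.1 p.2)
          (fderiv ℝ (fun p : (Fin d → ℝ) × ℝ => a i j p.1 p.2) (x, r)) (x, r) :=
        ((ha i j).differentiable (by simp) _).hasFDerivAt
      have h2 : HasDerivAt (fun s : ℝ => ((x, s) : (Fin d → ℝ) × ℝ)) (0, 1) r :=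
        (hasDerivAt_const r x).prodMk (hasDerivAt_id r)
      exact (h1.comp_hasDerivAt r h2).deriv
    rw [e]
    exact ((ha i j).continuous_fderiv (by simp)).clm_apply continuous_const
  have hac : ∀ i j, Continuous fun p : (Fin d → ℝ) × ℝ => a i j p.1 p.2 :=
    fun i j => (ha i j).continuous
  have hal : ∀ i j x y r, |a i j x r - a i j y r| ≤ M * ‖x - y‖ := by
    intro i j x y r
    have := Convex.norm_image_sub_le_of_norm_fderiv_le (𝕜 := ℝ) (f := fun y => a i j y r)
      (s := Set.univ) (C := M) (fun y _ => by
        have h1 : DifferentiableAt ℝ (fun p : (Fin d → ℝ) × ℝ => a i j p.1 p.2) (y, r) :=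
          (ha i j).differentiable (by simp) _
        exact h1.comp (f := fun y : Fin d → ℝ => (y, r)) y (by fun_prop))
      (fun y _ => hax i j y r) convex_univ (Set.mem_univ y) (Set.mem_univ x)
    simpa using this
  obtain ⟨D, hD, hDs, hDb⟩ : ∃ D : Fin d → Fin d → ℝ, (∀ i j, D i j = if i = j then γ else 0) ∧
      (∀ i j, D i j = D j i) ∧ ∀ i j, |D i j| ≤ γ := by
    refine ⟨_, fun _ _ => rfl, fun i j => by simp only [eq_comm], fun i j => ?_⟩
    split_ifs
    · rw [abs_of_pos hγ]
    · simpa using hγ.le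
  have hAb : ∀ i j x r, |a i j x r - D i j| ≤ M + γ := fun i j x r => by
    have h1 := hab i j x r; have h2 := hDb i j
    rw [abs_le] at *
    constructor <;> linarith [h1.1, h1.2, h2.1, h2.2]
  have hdp := decomp (N := N) (κ := κ) (R := R) (C1 := M + Kθ * (M + γ))
    (m := fun i j x r => θ x * (a i j x r + r * deriv (fun s => a i j x s) r - D i j))
    (P := fun i j x r => θ x * ((a i j x r - D i j) * r))
    (fun i j => by
      have := hac i j; have := hAdc i j
      fun_prop)
    (fun i j x r => by
      have h1 := ((((hAd i j x r).sub_const (D i j)).mul (hasDerivAt_id r)).const_mul (θ x))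
      refine h1.congr_deriv ?_
      simp only [id]
      ring)
    (fun i j x => by simp) (fun i j x r h => by simp [hθR x h]) (fun i j x r h => by simp [hθR x h])
    (fun i j x r => by
      have : (fun s => a i j x s) = fun s => a j i x s := funext fun s => has i j x s
      simp only [this, has i j x r, hDs i j])
    (fun x r ξ => by
      have e : ∑ i, ∑ j, θ x * (a i j x r + r * deriv (fun s => a i j x s) r - D i j) * ξ i * ξ j
          = θ x * ((∑ i, ∑ j, (a i j x r + r * deriv (fun s => a i j x s) r) * ξ i * ξ j)
            - γ * ∑ i, ξ i ^ 2) := by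
        have e2 : γ * ∑ i, ξ i ^ 2 = ∑ i, ∑ j, D i j * ξ i * ξ j := by
          simp only [hD, ite_mul, zero_mul, Finset.sum_ite_eq, Finset.mem_univ, if_true,
            Finset.mul_sum]
          exact Finset.sum_congr rfl fun i _ => by ring
        rw [e2, ← Finset.sum_sub_distrib, Finset.mul_sum]
        refine Finset.sum_congr rfl fun i _ => ?_
        rw [← Finset.sum_sub_distrib, Finset.mul_sum]
        exact Finset.sum_congr rfl fun j _ => by ring
      rw [e]
      exact mul_nonneg (hθ0 x) (sub_nonneg.2 (hH2 x ξ r)))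
    (by positivity)
    (fun i j x y r hr => by
      have e : θ x * ((a i j x r - D i j) * r) - θ y * ((a i j y r - D i j) * r)
          = (θ x * (a i j x r - a i j y r) + (θ x - θ y) * (a i j y r - D i j)) * r := by ring
      rw [e, abs_mul, abs_of_nonneg hr]
      refine mul_le_mul_of_nonneg_right ((abs_add_le _ _).trans ?_) hr
      rw [abs_mul, abs_mul, abs_of_nonneg (hθ0 x), add_mul]
      have h1 := mul_le_mul (hθ1 x) (hal i j x y r) (abs_nonneg _) zero_le_one
      have h2 := mul_le_mul (hθl x y) (hAb i j y r) (abs_nonneg _) (by positivity)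
      nlinarith)
    hN hκ
  obtain ⟨Q, hQ, ρ, c, v, hρ, hρc, hρ0, cm, c0, cl', s1, s2⟩ := hdp
  obtain ⟨Lb, hLb, hblip⟩ := drift_lip hb (R := R) (N := N)
  obtain ⟨f, hf⟩ : ∃ f : Fin d → (Fin d → ℝ) → ℝ → ℝ,
      ∀ i x s, f i x s = θ x * b i x (Tn N s) * Tn N s := ⟨_, fun _ _ _ => rfl⟩
  have hθb : ∀ i x r, |θ x * b i x r| ≤ M := fun i x r => by
    rw [abs_mul, abs_of_nonneg (hθ0 x)]
    have := mul_le_mul (hθ1 x) (hbb i x r) (abs_nonneg _) zero_le_one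
    linarith
  have hbc : ∀ i, Continuous fun p : (Fin d → ℝ) × ℝ => b i p.1 p.2 := fun i => (hb i).continuous
  have hTn := Tn_cont N
  have habsT : ∀ s, |Tn N s| ≤ |s| := fun s => by
    rw [abs_of_nonneg (Tn_nonneg _ _)]; exact Tn_le_abs _ _
  have f3 : ∀ i x s, |f i x s| ≤ M * |s| := fun i x s => by
    rw [hf, abs_mul]
    exact mul_le_mul (hθb i x _) (habsT s) (abs_nonneg _) hM
  obtain ⟨σ, g1, g2, g3, g4⟩ := Scheme.exists_good (f := f) (C := C) (Lf := Lb * |N| + M) (δ := δ)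
    hγ (by linarith) hρ hρc hρ0 cm c0 cl'
    (fun i => by
      have h1 : Continuous fun p : (Fin d → ℝ) × ℝ => b i p.1 (Tn N p.2) :=
        (hbc i).comp (by fun_prop : Continuous fun p : (Fin d → ℝ) × ℝ => (p.1, Tn N p.2))
      simp only [hf]
      fun_prop)
    (fun i x => by
      rw [hf]
      have : Tn N 0 = 0 := Tn_of_mem le_rfl hN.le
      rw [this, mul_zero])
    (by positivity)
    (fun i x r r' => by
      rw [hf, hf]
      by_cases hx : R ≤ ‖x‖
      · rw [hθR x hx]; simp; positivity
      · have e : θ x * b i x (Tn N r) * Tn N r - θ x * b i x (Tn N r') * Tn N r'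
            = θ x * (b i x (Tn N r) - b i x (Tn N r')) * Tn N r
              + θ x * b i x (Tn N r') * (Tn N r - Tn N r') := by ring
        rw [e, add_mul]
        have l := Tn_lip N r r'
        refine (abs_add_le _ _).trans (add_le_add ?_ ?_)
        · have h1 := hblip i x (Tn N r) (Tn N r') (not_le.1 hx).le (Tn_nonneg _ _) (Tn_le hN.le _)
            (Tn_nonneg _ _) (Tn_le hN.le _)
          have h2 : |b i x (Tn N r) - b i x (Tn N r')| ≤ Lb * |r - r'| :=
            h1.trans (mul_le_mul_of_nonneg_left l hLb)
          rw [abs_mul, abs_mul, abs_of_nonneg (hθ0 x), abs_of_nonneg (Tn_nonneg _ _), abs_of_pos hN]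
          calc θ x * |b i x (Tn N r) - b i x (Tn N r')| * Tn N r
              ≤ 1 * (Lb * |r - r'|) * N := by
                refine mul_le_mul (mul_le_mul (hθ1 x) h2 (abs_nonneg _) zero_le_one)
                  (Tn_le hN.le _) (Tn_nonneg _ _) (by positivity)
            _ = Lb * N * |r - r'| := by ring
        · rw [abs_mul]
          exact mul_le_mul (hθb i x _) l (abs_nonneg _) hM)
    (fun η hη => by
      obtain ⟨τ, hτ, H⟩ := drift_unif (h := fun i x r => θ x * b i x r) (R := R) (N := N)
        (fun i => by have := hbc i; fun_prop) (fun i x r h => by simp [hθR x h]) hη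
      refine ⟨τ, hτ, fun z hz i x r => ?_⟩
      rw [hf, hf, ← sub_mul, abs_mul]
      exact mul_le_mul (H z hz i x (Tn N r) (Tn_nonneg _ _) (Tn_le hN.le _)) (habsT r)
        (abs_nonneg _) hη.le)
    (fun i x s => (s1 i x s).trans (mul_le_mul_of_nonneg_right hC2 (abs_nonneg _)))
    (fun i j x s => by
      have h1 := s2 i j x s
      have h2 : |θ x * ((a i j x (Tn N s) - D i j) * Tn N s)| ≤ (M + γ) * |s| := by
        rw [abs_mul, abs_mul, abs_of_nonneg (hθ0 x)]
        have := mul_le_mul (hθ1 x) (mul_le_mul (hAb i j x (Tn N s)) (habsT s) (abs_nonneg _)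
          (by positivity)) (by positivity) zero_le_one
        linarith
      have h3 := abs_sub_abs_le_abs_sub (∑ q, ρ q x * c q s * (v q i * v q j))
        (θ x * ((a i j x (Tn N s) - D i j) * Tn N s))
      have h4 := mul_le_mul_of_nonneg_right hκ1 (abs_nonneg s)
      have h5 := mul_le_mul_of_nonneg_right hC1 (abs_nonneg s)
      nlinarith)
    (fun i x s => (f3 i x s).trans (mul_le_mul_of_nonneg_right (by linarith) (abs_nonneg _))) hδ
  refine ⟨σ, g1, g2, fun x s hx hs0 hsN => ⟨fun i j => ?_, fun i => ?_⟩⟩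
  · rw [g4]
    have h1 := s2 i j x s
    rw [Tn_of_mem hs0 hsN, abs_of_nonneg hs0] at h1
    simp only [hx, one_mul] at h1
    refine le_trans (le_of_eq ?_) h1
    congr 1
    rw [hD]
    split_ifs <;> ring
  · rw [g3, hf, Tn_of_mem hs0 hsN, hx, one_mul]


/-! ## Part 18: the main theorem -/

/-- under (H1)–(H3), if `u₀` is a probability density, there is an
`L¹`-continuous distributional solution of the Fokker–Planck equation with `u(0) = u₀`
consisting of probability densities, whose time marginals `u(t,x)dx` are weakly
continuous in `t`. -/
theorem statement11 (d : ℕ) (a : Fin d → Fin d → (Fin d → ℝ) → ℝ → ℝ)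
    (b : Fin d → (Fin d → ℝ) → ℝ → ℝ) (γ : ℝ)
    (hd : 1 ≤ d)
    (ha_smooth : ∀ i j, ContDiff ℝ 2 (fun p : (Fin d → ℝ) × ℝ => a i j p.1 p.2))
    (ha_bdd : ∀ i j, ∃ M : ℝ, ∀ (x : Fin d → ℝ) (r : ℝ), |a i j x r| ≤ M)
    (hax_cont : ∀ i j,
      Continuous (fun p : (Fin d → ℝ) × ℝ => fderiv ℝ (fun y => a i j y p.2) p.1))
    (hax_bdd : ∀ i j, ∃ M : ℝ, ∀ (x : Fin d → ℝ) (r : ℝ),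
      ‖fderiv ℝ (fun y => a i j y r) x‖ ≤ M)
    (ha_symm : ∀ i j x r, a i j x r = a j i x r)
    (hγ : 0 < γ)
    (hH2 : ∀ (x ξ : Fin d → ℝ) (r : ℝ),
      γ * ∑ i, ξ i ^ 2 ≤ ∑ i, ∑ j, (a i j x r + r * deriv (fun s => a i j x s) r) * ξ i * ξ j)
    (hb_smooth : ∀ i, ContDiff ℝ 1 (fun p : (Fin d → ℝ) × ℝ => b i p.1 p.2))
    (hb_bdd : ∀ i, ∃ M : ℝ, ∀ (x : Fin d → ℝ) (r : ℝ), |b i x r| ≤ M)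
    (hb_zero : ∀ i x, b i x 0 = 0)
    (u₀ : (Fin d → ℝ) → ℝ) (hu₀ : Integrable u₀)
    (hu₀pos : 0 ≤ᵐ[volume] u₀) (hu₀mass : (∫ x, u₀ x) = 1) :
    ∃ u : ℝ → (Fin d → ℝ) → ℝ,
      (∀ t : ℝ, 0 ≤ t → Integrable (u t)) ∧
      (u 0 =ᵐ[volume] u₀) ∧
      (∀ t ∈ Set.Ici (0 : ℝ),
        Tendsto (fun s => ∫ x, |u s x - u t x|) (nhdsWithin t (Set.Ici 0)) (nhds 0)) ∧
      IsFPESol a b u ∧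
      (∀ t : ℝ, 0 ≤ t → (0 ≤ᵐ[volume] u t) ∧ (∫ x, u t x) = 1) ∧
      (∀ φ : (Fin d → ℝ) → ℝ, Continuous φ → (∃ M : ℝ, ∀ x, |φ x| ≤ M) →
        ContinuousOn (fun t => ∫ x, φ x * u t x) (Set.Ici (0 : ℝ))) := by
  choose Ma hMa using ha_bdd
  choose Mx hMx using hax_bdd
  choose Mb hMb using hb_bdd
  obtain ⟨M, hM, hM1, hM2, hM3⟩ : ∃ M : ℝ, 0 ≤ M ∧ (∀ i j x r, |a i j x r| ≤ M) ∧
      (∀ i j x r, ‖fderiv ℝ (fun y => a i j y r) x‖ ≤ M) ∧ ∀ i x r, |b i x r| ≤ M := by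
    have p1 : 0 ≤ ∑ i, ∑ j, |Ma i j| :=
      Finset.sum_nonneg fun _ _ => Finset.sum_nonneg fun _ _ => abs_nonneg _
    have p2 : 0 ≤ ∑ i, ∑ j, |Mx i j| :=
      Finset.sum_nonneg fun _ _ => Finset.sum_nonneg fun _ _ => abs_nonneg _
    have p3 : 0 ≤ ∑ i, |Mb i| := Finset.sum_nonneg fun _ _ => abs_nonneg _
    have q : ∀ (A : Fin d → Fin d → ℝ) i j, A i j ≤ ∑ i, ∑ j, |A i j| := fun A i j =>
      (le_abs_self _).trans ((Finset.single_le_sum (f := fun j => |A i j|)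
        (fun _ _ => abs_nonneg _) (Finset.mem_univ j)).trans
        (Finset.single_le_sum (f := fun i => ∑ j, |A i j|)
          (fun _ _ => Finset.sum_nonneg fun _ _ => abs_nonneg _) (Finset.mem_univ i)))
    have q3 : ∀ i, Mb i ≤ ∑ i, |Mb i| := fun i => (le_abs_self _).trans
      (Finset.single_le_sum (f := fun i => |Mb i|) (fun _ _ => abs_nonneg _) (Finset.mem_univ i))
    refine ⟨(∑ i, ∑ j, |Ma i j|) + (∑ i, ∑ j, |Mx i j|) + ∑ i, |Mb i|, by positivity,
      fun i j x r => ?_, fun i j x r => ?_, fun i x r => ?_⟩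
    · linarith [hMa i j x r, q Ma i j]
    · linarith [hMx i j x r, q Mx i j]
    · linarith [hMb i x r, q3 i]
  have hcoef : Coef a b M :=
    ⟨hM, fun i j => (ha_smooth i j).continuous, fun i => (hb_smooth i).continuous, hM1, hM3⟩
  obtain ⟨χ, χs, χc, χ0, χ1, χin, χout⟩ := exists_cutoff d
  obtain ⟨K, hK⟩ := ContDiff.lipschitzWith_of_hasCompactSupport χc χs (by simp)
  have hK0 : (0 : ℝ) ≤ K := K.2
  obtain ⟨C, hC1, hC2⟩ : ∃ C : ℝ, 1 + M + γ ≤ C ∧ d * (M + K * (M + γ) + 1) ≤ C :=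
    ⟨_, le_max_left _ _, le_max_right _ _⟩
  have hsch : ∀ n : ℕ, ∃ σ : Scheme d, σ.Good C (1 / ((n : ℝ) + 1)) ∧ σ.γ = γ ∧
      ∀ x (s : ℝ), ‖x‖ ≤ n → 0 ≤ s → s ≤ n →
      (∀ i j, |σ.Am i j x s - a i j x s * s| ≤ 1 / ((n : ℝ) + 1)) ∧
      ∀ i, σ.f i x s = b i x s * s := by
    intro n
    have hn : (0 : ℝ) < (n : ℝ) + 1 := by positivity
    have hn1 : ((n : ℝ) + 1)⁻¹ ≤ 1 := inv_le_one_of_one_le₀ (by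
      have : (0 : ℝ) ≤ n := n.cast_nonneg
      linarith)
    have hns : ∀ x : Fin d → ℝ, ‖((n : ℝ) + 1)⁻¹ • x‖ = ((n : ℝ) + 1)⁻¹ * ‖x‖ := fun x => by
      rw [norm_smul, norm_inv, Real.norm_of_nonneg hn.le]
    obtain ⟨σ, g1, g2, g3⟩ := coef_scheme hM ha_smooth hM1 hM2 ha_symm hγ hH2 hb_smooth hM3
      (θ := fun x => χ (((n : ℝ) + 1)⁻¹ • x)) (Kθ := K) (R := 2 * ((n : ℝ) + 1))
      (contDiff_scale χs _).continuous (fun x => χ0 _) (fun x => χ1 _) hK0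
      (fun x y => by
        have h1 := hK.dist_le_mul (((n : ℝ) + 1)⁻¹ • x) (((n : ℝ) + 1)⁻¹ • y)
        rw [Real.dist_eq, dist_eq_norm, ← smul_sub, hns] at h1
        refine h1.trans (mul_le_mul_of_nonneg_left ?_ hK0)
        exact mul_le_of_le_one_left (norm_nonneg _) hn1)
      (fun x hx => χout _ (by
        rw [hns, inv_mul_eq_div, le_div_iff₀ hn]
        exact hx))
      (N := (n : ℝ) + 1) (κ := ((n : ℝ) + 1)⁻¹ * ((n : ℝ) + 1)⁻¹) (δ := 1 / ((n : ℝ) + 1))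
      hn (by positivity) (mul_le_one₀ hn1 (by positivity) hn1) (by positivity) hC1 hC2
    refine ⟨σ, g1, g2, fun x s hx hs0 hsn => ?_⟩
    obtain ⟨k1, k2⟩ := g3 x s (χin _ (by
      rw [hns, inv_mul_eq_div, div_le_one hn]
      linarith)) hs0 (by linarith)
    refine ⟨fun i j => (k1 i j).trans ?_, k2⟩
    rw [one_div, mul_assoc]
    refine mul_le_of_le_one_right (by positivity) ?_
    rw [inv_mul_eq_div, div_le_one hn]
    linarith
  choose σ hgood hσγ hσcv using hsch
  obtain ⟨g, hg⟩ : ∃ g : (Fin d → ℝ) → ℝ, g = fun x => max (u₀ x) 0 := ⟨_, rfl⟩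
  have hgi : Integrable g := hg ▸ hu₀.pos_part
  have hgu : g =ᵐ[volume] u₀ := by
    filter_upwards [hu₀pos] with x hx
    rw [hg]
    exact max_eq_left hx
  have HS : Scheme.Seq γ C σ (fun n : ℕ => 1 / ((n : ℝ) + 1)) g :=
    ⟨hγ, by linarith, hgood, tendsto_one_div_add_atTop_nhds_zero_nat, hσγ, hgi,
      fun x => by rw [hg]; exact le_max_right _ _⟩
  obtain ⟨ψ, hψ, u, hu⟩ := HS.exists_lim
  have HL : Scheme.Lim γ C (fun n => σ (ψ n)) (fun n => 1 / ((ψ n : ℝ) + 1)) g u :=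
    { γ_pos := hγ
      C_nonneg := by linarith
      good := fun n => hgood (ψ n)
      δ_lim := by
        have h3 := Tendsto.comp (tendsto_one_div_add_atTop_nhds_zero_nat (𝕜 := ℝ)) hψ.tendsto_atTop
        simpa only [Function.comp_def] using h3
      γ_eq := fun n => hσγ (ψ n)
      g_int := hgi
      g_nonneg := HS.g_nonneg
      int := fun t ht => (hu t ht).1
      conv := fun t ht => (hu t ht).2 }
  have hcv : Scheme.Cv a b (fun n => σ (ψ n)) := by
    intro n x s hx hs0 hsn
    have hle : (n : ℝ) ≤ ψ n := by exact_mod_cast hψ.le_apply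
    obtain ⟨k1, k2⟩ := hσcv (ψ n) x s (hx.trans hle) hs0 (hsn.trans hle)
    refine ⟨fun i j => (k1 i j).trans ?_, k2⟩
    exact one_div_le_one_div_of_le (by positivity) (by linarith)
  refine ⟨u, HL.int, HL.zero.trans hgu, fun t ht => HL.cont_l1 ht, HL.sol hcoef hcv,
    fun t ht => ⟨HL.nonneg ht, ?_⟩, fun φ hφ hb => HL.cont_weak hφ hb⟩
  rw [HL.mass ht, integral_congr_ae hgu, hu₀mass]
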